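/- arXiv:2406.05861 — 2 statements merged into one kernel-verified Lean document; each statement's English description precedes it below -/
import Mathlib

section
/- For every natural number m there exists a simple polygon P in the Euclidean plane with at least m vertices, whose vertices have pairwise geodesic distance at least 1, such that every vertex guard set of P contains two distinct guards g, h with geodesic distance δ(g,h) at most 2. -/
open Set Metric
open scoped ENNReal

noncomputable section

/-- The Euclidean plane. -/
abbrev Plane : Type := EuclideanSpace ℝ (Fin 2)

/-- A *simple polygon*: the compact region of the plane bounded by a simple
closed polygonal curve, together with the cyclic sequence of vertices of that
curve.  The field `carrier` is the region (boundary included); the field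
`frontier_eq` states that the topological boundary of the region is exactly
the closed polygonal curve through the vertices, and the fields
`edges_adjacent`/`edges_disjoint` state that this curve is simple. -/
structure SimplePolygon where
  /-- the number of vertices -/
  n : ℕ
  /-- a polygon has at least three vertices -/
  three_le : 3 ≤ n
  /-- the vertices, in cyclic order along the boundary curve -/
  vertex : ZMod n → Plane
  /-- the compact region bounded by the polygonal curve -/
  carrier : Set Plane
  isCompact : IsCompact carrier
  isConnected : IsConnected carrier
  /-- the region is the closure of its interior (it is a genuine
  two-dimensional region) -/
  regular : carrier = closure (interior carrier)
  /-- the topological boundary of the region is the union of the edges of the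
  closed polygonal curve through the vertices -/
  frontier_eq : frontier carrier = ⋃ i : ZMod n, segment ℝ (vertex i) (vertex (i + 1))
  /-- the vertices are pairwise distinct -/
  vertex_injective : Function.Injective vertex
  /-- consecutive edges of the curve meet exactly in their common vertex -/
  edges_adjacent : ∀ i : ZMod n,
    segment ℝ (vertex i) (vertex (i + 1)) ∩ segment ℝ (vertex (i + 1)) (vertex (i + 2)) =
      {vertex (i + 1)}
  /-- non-adjacent edges of the curve are disjoint -/
  edges_disjoint : ∀ i j : ZMod n, i ≠ j → i + 1 ≠ j → j + 1 ≠ i →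
    Disjoint (segment ℝ (vertex i) (vertex (i + 1))) (segment ℝ (vertex j) (vertex (j + 1)))

/-- The geodesic distance between `p` and `q` inside the set `P`: the infimum
of the lengths (total variations) of continuous paths from `p` to `q` staying
in `P`.  (Non-rectifiable paths have length `∞` and hence do not contribute.) -/
def geodesicDist (P : Set Plane) (p q : Plane) : ℝ≥0∞ :=
  ⨅ (γ : ℝ → Plane) (_ : ContinuousOn γ (Icc 0 1)) (_ : γ 0 = p) (_ : γ 1 = q)
    (_ : MapsTo γ (Icc 0 1) P), eVariationOn γ (Icc 0 1)

/-- `p` sees `q` within `P` if the closed segment `[p,q]` is contained in `P`. -/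
def Sees (P : Set Plane) (p q : Plane) : Prop :=
  segment ℝ p q ⊆ P

/-- `G` is a guard set for `P` if `G ⊆ P` and every point of `P` is seen by
some point of `G`. -/
def IsGuardSet (P : Set Plane) (G : Set Plane) : Prop :=
  G ⊆ P ∧ ∀ x ∈ P, ∃ g ∈ G, Sees P g x

/-- A vertex guard set of a simple polygon: a guard set consisting of
vertices of the polygon. -/
def SimplePolygon.IsVertexGuardSet (P : SimplePolygon) (G : Set Plane) : Prop :=
  G ⊆ Set.range P.vertex ∧ IsGuardSet P.carrier G

/-- The dispersion distance of a guard set `G` in `P`: the infimum of the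
geodesic distances between pairs of distinct guards. -/
def dispersionDist (P : Set Plane) (G : Set Plane) : ℝ≥0∞ :=
  ⨅ (g : Plane) (_ : g ∈ G) (h : Plane) (_ : h ∈ G) (_ : g ≠ h), geodesicDist P g h

/-- The vertex `P.vertex i` is *reflex* (interior angle strictly greater than
`180°`): sufficiently close to the vertex, the segment joining a point of the
incoming edge to a point of the outgoing edge (both distinct from the vertex)
always leaves the polygon. -/
def SimplePolygon.IsReflexAt (P : SimplePolygon) (i : ZMod P.n) : Prop :=
  ∃ δ > (0 : ℝ), ∀ a ∈ segment ℝ (P.vertex (i - 1)) (P.vertex i),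
    ∀ c ∈ segment ℝ (P.vertex i) (P.vertex (i + 1)),
      a ≠ P.vertex i → c ≠ P.vertex i →
      dist a (P.vertex i) < δ → dist c (P.vertex i) < δ →
      ¬ segment ℝ a c ⊆ P.carrier

/-- The vertices of `P` are labeled in counterclockwise order: the shoelace
signed area of the vertex cycle is positive. -/
def SimplePolygon.IsCCW (P : SimplePolygon) : Prop :=
  0 < ∑ i ∈ Finset.range P.n,
    (P.vertex (i : ZMod P.n) 0 * P.vertex ((i : ZMod P.n) + 1) 1 -
      P.vertex ((i : ZMod P.n) + 1) 0 * P.vertex (i : ZMod P.n) 1)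

namespace ZigZag

/-- A point of the plane given by its coordinates. -/
def pt (x y : ℝ) : Plane := !₂[x, y]

@[simp] lemma pt_zero (x y : ℝ) : (pt x y) 0 = x := by simp [pt]
@[simp] lemma pt_one (x y : ℝ) : (pt x y) 1 = y := by simp [pt]

lemma pt_eq {p : Plane} {x y : ℝ} (h0 : p 0 = x) (h1 : p 1 = y) : p = pt x y := by
  ext i; fin_cases i
  · simpa using h0
  · simpa using h1

lemma mem_seg {p a b : Plane} : p ∈ segment ℝ a b ↔
    ∃ t : ℝ, 0 ≤ t ∧ t ≤ 1 ∧ p 0 = a 0 + t * (b 0 - a 0) ∧ p 1 = a 1 + t * (b 1 - a 1) := by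
  rw [segment_eq_image']
  constructor
  · rintro ⟨t, ⟨h0, h1⟩, rfl⟩
    exact ⟨t, h0, h1, by simp, by simp⟩
  · rintro ⟨t, h0, h1, e0, e1⟩
    refine ⟨t, ⟨h0, h1⟩, ?_⟩
    ext i; fin_cases i
    · simp [e0]
    · simp [e1]

lemma dist_sq (a b : Plane) : dist a b ^ 2 = (a 0 - b 0) ^ 2 + (a 1 - b 1) ^ 2 := by
  rw [EuclideanSpace.dist_eq, Real.sq_sqrt (by positivity)]
  simp [Fin.sum_univ_two, Real.dist_eq, sq_abs]

/-- Geodesic distance is bounded below by Euclidean distance. -/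
lemma one_le_geod {P : Set Plane} {a b : Plane}
    (h : 1 ≤ (a 0 - b 0) ^ 2 + (a 1 - b 1) ^ 2) : 1 ≤ geodesicDist P a b := by
  have hd : 1 ≤ dist a b := by
    rw [← dist_sq] at h
    nlinarith [dist_nonneg (x := a) (y := b)]
  unfold geodesicDist
  refine le_iInf fun γ => le_iInf fun _ => le_iInf fun h0 => le_iInf fun h1 => le_iInf fun _ => ?_
  refine le_trans ?_ (eVariationOn.edist_le γ (s := Icc 0 1) (x := 0) (y := 1) (by simp) (by simp))
  rw [h0, h1, edist_dist]
  simpa using ENNReal.ofReal_le_ofReal hd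

/-- A path made of two segments of length at most one has length at most two. -/
lemma geod_le_two {P : Set Plane} {p q r : Plane} (h1 : segment ℝ p q ⊆ P)
    (h2 : segment ℝ q r ⊆ P) (d1 : (p 0 - q 0) ^ 2 + (p 1 - q 1) ^ 2 ≤ 1)
    (d2 : (q 0 - r 0) ^ 2 + (q 1 - r 1) ^ 2 ≤ 1) : geodesicDist P p r ≤ 2 := by
  have n1 : ‖q - p‖ ≤ 1 := by
    rw [← dist_sq, dist_comm, dist_eq_norm] at d1
    nlinarith [norm_nonneg (q - p)]
  have n2 : ‖r - q‖ ≤ 1 := by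
    rw [← dist_sq, dist_comm, dist_eq_norm] at d2
    nlinarith [norm_nonneg (r - q)]
  set γ : ℝ → Plane := fun t => p + (min (2 * t) 1) • (q - p) + (max (2 * t - 1) 0) • (r - q)
    with hγ
  have key : ∀ s t : ℝ, |min (2 * s) 1 - min (2 * t) 1| + |max (2 * s - 1) 0 - max (2 * t - 1) 0|
      ≤ 2 * |s - t| := by
    have main : ∀ s t : ℝ, t ≤ s → |min (2 * s) 1 - min (2 * t) 1| +
        |max (2 * s - 1) 0 - max (2 * t - 1) 0| ≤ 2 * |s - t| := by
      intro s t hst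
      rw [abs_of_nonneg (sub_nonneg.2 (min_le_min_right 1 (by linarith))),
        abs_of_nonneg (sub_nonneg.2 (max_le_max_right 0 (by linarith))),
        abs_of_nonneg (sub_nonneg.2 hst)]
      rcases min_cases (2 * s) 1 with ⟨a, a'⟩ | ⟨a, a'⟩ <;>
      rcases min_cases (2 * t) 1 with ⟨b, b'⟩ | ⟨b, b'⟩ <;>
      rcases max_cases (2 * s - 1) 0 with ⟨c, c'⟩ | ⟨c, c'⟩ <;>
      rcases max_cases (2 * t - 1) 0 with ⟨d, d'⟩ | ⟨d, d'⟩ <;>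
      rw [a, b, c, d] <;> linarith
    intro s t
    rcases le_total t s with h | h
    · exact main s t h
    · have := main t s h
      rwa [abs_sub_comm, abs_sub_comm (max _ _), abs_sub_comm t s] at this
  have hlip : LipschitzWith 2 γ := by
    apply LipschitzWith.of_dist_le_mul
    intro s t
    rw [dist_eq_norm, Real.dist_eq]
    have e : γ s - γ t = (min (2 * s) 1 - min (2 * t) 1) • (q - p) +
        (max (2 * s - 1) 0 - max (2 * t - 1) 0) • (r - q) := by
      simp only [hγ, sub_smul]; abel
    rw [e]
    refine (norm_add_le _ _).trans ?_
    rw [norm_smul, norm_smul, Real.norm_eq_abs, Real.norm_eq_abs]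
    have k := key s t
    have i1 := mul_le_mul_of_nonneg_left n1 (abs_nonneg (min (2 * s) 1 - min (2 * t) 1))
    have i2 := mul_le_mul_of_nonneg_left n2 (abs_nonneg (max (2 * s - 1) 0 - max (2 * t - 1) 0))
    simp only [NNReal.coe_ofNat]
    linarith
  have hvar : eVariationOn γ (Icc 0 1) ≤ 2 := by
    have a := (hlip.lipschitzOnWith (s := univ)).comp_eVariationOn_le (g := (id : ℝ → ℝ))
      (s := Icc (0 : ℝ) 1) (mapsTo_univ _ _)
    have b := (monotone_id.monotoneOn (Icc (0 : ℝ) 1)).eVariationOn_eq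
      (a := 0) (b := 1) (by simp) (by simp)
    simp only [inter_self, id, sub_zero, ENNReal.ofReal_one] at b
    refine a.trans ?_
    calc _ ≤ ((2 : NNReal) : ℝ≥0∞) * 1 := by gcongr; exact b.le
      _ = 2 := by simp
  unfold geodesicDist
  refine iInf_le_of_le γ (iInf_le_of_le hlip.continuous.continuousOn (iInf_le_of_le ?_
    (iInf_le_of_le ?_ (iInf_le_of_le ?_ hvar))))
  · simp [hγ]
  · simp only [hγ]; norm_num
  · rintro t ⟨t0, t1⟩
    rcases le_total (2 * t) 1 with h | h
    · apply h1
      rw [segment_eq_image']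
      refine ⟨2 * t, ⟨by linarith, h⟩, ?_⟩
      simp only [hγ]
      rw [min_eq_left h, max_eq_right (by linarith)]; simp
    · apply h2
      rw [segment_eq_image']
      refine ⟨2 * t - 1, ⟨by linarith, by linarith⟩, ?_⟩
      simp only [hγ]
      rw [min_eq_right h, max_eq_left (by linarith)]; simp

/-- The region between two graphs. -/
def band (a b : ℝ) (f g : ℝ → ℝ) : Set Plane :=
  {p | a ≤ p 0 ∧ p 0 ≤ b ∧ f (p 0) ≤ p 1 ∧ p 1 ≤ g (p 0)}

/-- The open region between two graphs. -/
def bandO (a b : ℝ) (f g : ℝ → ℝ) : Set Plane :=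
  {p | a < p 0 ∧ p 0 < b ∧ f (p 0) < p 1 ∧ p 1 < g (p 0)}

section Band
variable {a b : ℝ} {f g : ℝ → ℝ}

/-- Parametrization of the band. -/
def par (f g : ℝ → ℝ) (z : ℝ × ℝ) : Plane := pt z.1 ((1 - z.2) * f z.1 + z.2 * g z.1)

lemma par_cont (hf : Continuous f) (hg : Continuous g) : Continuous (par f g) := by
  unfold par pt
  refine (PiLp.continuous_toLp 2 _).comp ?_
  refine continuous_pi fun i => ?_
  fin_cases i
  · simp; fun_prop
  · simp; fun_prop

lemma le_of_mem (hab : a < b) (ha : f a = g a) (hb : f b = g b) (hfg : ∀ x, a < x → x < b → f x < g x) {x : ℝ} (h1 : a ≤ x) (h2 : x ≤ b) : f x ≤ g x := by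
  rcases h1.eq_or_lt with rfl | h1
  · exact ha.le
  rcases h2.eq_or_lt with rfl | h2
  · exact hb.le
  exact (hfg x h1 h2).le

lemma par_image (hab : a < b) (ha : f a = g a) (hb : f b = g b) (hfg : ∀ x, a < x → x < b → f x < g x) : par f g '' (Icc a b ×ˢ Icc 0 1) = band a b f g := by
  ext p
  constructor
  · rintro ⟨⟨x, t⟩, ⟨⟨h1, h2⟩, h3, h4⟩, rfl⟩
    simp only at h1 h2 h3 h4
    have := le_of_mem hab ha hb hfg h1 h2
    refine ⟨by simpa [par], by simpa [par], ?_, ?_⟩ <;> simp only [par, pt_zero, pt_one]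
    · nlinarith
    · nlinarith
  · rintro ⟨h1, h2, h3, h4⟩
    rcases (h3.trans h4).eq_or_lt with h | h
    · refine ⟨(p 0, 0), ⟨⟨h1, h2⟩, by simp⟩, ?_⟩
      symm; apply pt_eq
      · rfl
      · simp; linarith
    · have h' : 0 < g (p 0) - f (p 0) := by linarith
      refine ⟨(p 0, (p 1 - f (p 0)) / (g (p 0) - f (p 0))), ⟨⟨h1, h2⟩, ?_, ?_⟩, ?_⟩
      · exact div_nonneg (by linarith) h'.le
      · rw [div_le_one h']; linarith
      · symm; apply pt_eq
        · rfl
        · field_simp; ring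

lemma band_compact (hab : a < b) (hf : Continuous f) (hg : Continuous g) (ha : f a = g a) (hb : f b = g b) (hfg : ∀ x, a < x → x < b → f x < g x) : IsCompact (band a b f g) := by
  rw [← par_image hab ha hb hfg]
  exact (isCompact_Icc.prod isCompact_Icc).image (par_cont hf hg)

lemma band_connected (hab : a < b) (hf : Continuous f) (hg : Continuous g) (ha : f a = g a) (hb : f b = g b) (hfg : ∀ x, a < x → x < b → f x < g x) : IsConnected (band a b f g) := by
  rw [← par_image hab ha hb hfg]
  exact ((isConnected_Icc hab.le).prod (isConnected_Icc zero_le_one)).image _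
    (par_cont hf hg).continuousOn

lemma bandO_open (hf : Continuous f) (hg : Continuous g) : IsOpen (bandO a b f g) := by
  have c0 : Continuous fun p : Plane => p 0 := by fun_prop
  have c1 : Continuous fun p : Plane => p 1 := by fun_prop
  exact (isOpen_lt continuous_const c0).inter ((isOpen_lt c0 continuous_const).inter
    ((isOpen_lt (hf.comp c0) c1).inter (isOpen_lt c1 (hg.comp c0))))

lemma bandO_sub : bandO a b f g ⊆ band a b f g :=
  fun _ h => ⟨h.1.le, h.2.1.le, h.2.2.1.le, h.2.2.2.le⟩

lemma bandO_interior (hf : Continuous f) (hg : Continuous g) : bandO a b f g ⊆ interior (band a b f g) :=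
  interior_maximal bandO_sub (bandO_open hf hg)

lemma band_regular (hab : a < b) (hf : Continuous f) (hg : Continuous g) (ha : f a = g a) (hb : f b = g b) (hfg : ∀ x, a < x → x < b → f x < g x) : band a b f g = closure (interior (band a b f g)) := by
  apply Subset.antisymm
  · refine Subset.trans ?_ (closure_mono (bandO_interior hf hg))
    rw [← par_image hab ha hb hfg, ← closure_Ioo hab.ne, ← closure_Ioo (zero_ne_one' ℝ),
      ← closure_prod_eq]
    refine (image_closure_subset_closure_image (par_cont hf hg)).trans (closure_mono ?_)
    rintro _ ⟨⟨x, t⟩, ⟨⟨h1, h2⟩, h3, h4⟩, rfl⟩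
    simp only at h1 h2 h3 h4
    have := hfg x h1 h2
    refine ⟨by simpa [par], by simpa [par], ?_, ?_⟩ <;> simp only [par, pt_zero, pt_one]
    · nlinarith
    · nlinarith
  · exact closure_minimal interior_subset (band_compact hab hf hg ha hb hfg).isClosed

lemma shift_cont (p : Plane) : Continuous fun e : ℝ => pt (p 0) (p 1 + e) := by
  unfold pt
  refine (PiLp.continuous_toLp 2 _).comp ?_
  refine continuous_pi fun i => ?_
  fin_cases i
  · simp; fun_prop
  · simp; fun_prop

lemma shift_mem {S : Set Plane} {p : Plane} (hp : p ∈ interior S) :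
    ∃ e : ℝ, 0 < e ∧ pt (p 0) (p 1 + e) ∈ S ∧ pt (p 0) (p 1 - e) ∈ S := by
  have ho := isOpen_interior.preimage (shift_cont p) (t := interior S)
  have h0 : (0 : ℝ) ∈ (fun e : ℝ => pt (p 0) (p 1 + e)) ⁻¹' interior S := by
    have : pt (p 0) (p 1 + 0) = p := by symm; apply pt_eq <;> simp
    simpa only [mem_preimage, this] using hp
  obtain ⟨d, hd, hs⟩ := Metric.isOpen_iff.1 ho 0 h0
  refine ⟨d / 2, by linarith, ?_, ?_⟩
  · have : d / 2 ∈ ball (0 : ℝ) d := by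
      rw [Metric.mem_ball, Real.dist_eq, abs_lt]; constructor <;> linarith
    exact interior_subset (hs this)
  · have : -(d / 2) ∈ ball (0 : ℝ) d := by
      rw [Metric.mem_ball, Real.dist_eq, abs_lt]; constructor <;> linarith
    have := interior_subset (hs this)
    simpa only [sub_eq_add_neg] using this

lemma band_frontier (hab : a < b) (hf : Continuous f) (hg : Continuous g) (ha : f a = g a) (hb : f b = g b) (hfg : ∀ x, a < x → x < b → f x < g x) : frontier (band a b f g) =
    {p | a ≤ p 0 ∧ p 0 ≤ b ∧ (p 1 = f (p 0) ∨ p 1 = g (p 0))} := by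
  rw [(band_compact hab hf hg ha hb hfg).isClosed.frontier_eq]
  ext p
  constructor
  · rintro ⟨⟨h1, h2, h3, h4⟩, hn⟩
    refine ⟨h1, h2, ?_⟩
    by_contra hc
    push Not at hc
    apply hn
    apply bandO_interior hf hg
    refine ⟨lt_of_le_of_ne h1 ?_, lt_of_le_of_ne h2 ?_, lt_of_le_of_ne h3 (Ne.symm hc.1),
      lt_of_le_of_ne h4 hc.2⟩
    · intro h; rw [← h] at h3 h4 hc; exact hc.1 (by linarith)
    · intro h; rw [h] at h3 h4 hc; exact hc.1 (by linarith)
  · rintro ⟨h1, h2, h3⟩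
    have := le_of_mem hab ha hb hfg h1 h2
    refine ⟨⟨h1, h2, ?_, ?_⟩, ?_⟩
    · rcases h3 with h | h <;> linarith
    · rcases h3 with h | h <;> linarith
    · intro hi
      obtain ⟨e, he, ⟨_, _, _, m1⟩, ⟨_, _, m2, _⟩⟩ := shift_mem hi
      simp only [pt_zero, pt_one] at m1 m2
      rcases h3 with h | h <;> linarith

end Band

/-- Slope of the long lower edge. -/
def rho (N : ℕ) : ℝ := (34 + 13 * N) / (40 + 26 * N)

lemma rho_eq (N : ℕ) : rho N * (40 / 26 + N) = 34 / 26 + N / 2 := by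
  unfold rho
  have : (0 : ℝ) < 40 + 26 * N := by positivity
  field_simp
  ring

lemma rho_lower (N : ℕ) : 1 / 2 ≤ rho N := by
  unfold rho
  have : (0 : ℝ) < 40 + 26 * N := by positivity
  rw [le_div_iff₀ this]; linarith

lemma rho_upper {N : ℕ} (hN : 1 ≤ N) : rho N ≤ 47 / 66 := by
  unfold rho
  have : (0 : ℝ) < 40 + 26 * N := by positivity
  have h : (1 : ℝ) ≤ N := by exact_mod_cast hN
  rw [div_le_iff₀ this]; linarith

/-- Lower boundary function. -/
def lo (N : ℕ) (x : ℝ) : ℝ :=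
  if x ≤ -1 / 2 then 5 / 12 * (x + 1 / 2)
  else if x ≤ -3 / 26 then -12 / 5 * (x + 1 / 2) else -12 / 13 + rho N * (x + 3 / 26)

/-- Upper boundary function. -/
def up (x : ℝ) : ℝ :=
  if x ≤ 3 / 26 then -5 / 13 + 17 / 20 * (x + 37 / 26)
  else if x ≤ 1 / 2 then -12 / 5 * (x - 1 / 2)
  else if x ≤ 37 / 26 then 5 / 12 * (x - 1 / 2) else 5 / 13 + (x - 37 / 26) / 2

lemma lo_cont (N : ℕ) : Continuous (lo N) := by
  unfold lo
  refine Continuous.if_le (by fun_prop) (Continuous.if_le (by fun_prop) (by fun_prop)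
    continuous_id continuous_const ?_) continuous_id continuous_const ?_
  · intro x hx; subst hx; norm_num
  · intro x hx; subst hx; norm_num

lemma up_cont : Continuous up := by
  unfold up
  refine Continuous.if_le (by fun_prop) (Continuous.if_le (by fun_prop) (Continuous.if_le
    (by fun_prop) (by fun_prop) continuous_id continuous_const ?_)
    continuous_id continuous_const ?_) continuous_id continuous_const ?_
  · intro x hx; subst hx; norm_num
  · intro x hx; subst hx; norm_num
  · intro x hx; subst hx; norm_num

lemma loC {N : ℕ} {x : ℝ} (h : x ≤ -1 / 2) : lo N x = 5 / 12 * (x + 1 / 2) := by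
  simp only [lo, if_pos h]

lemma loB {N : ℕ} {x : ℝ} (h : -1 / 2 ≤ x) (h' : x ≤ -3 / 26) :
    lo N x = -12 / 5 * (x + 1 / 2) := by
  rcases h.eq_or_lt with rfl | h
  · rw [loC le_rfl]; norm_num
  · simp only [lo, if_neg (not_le.2 h), if_pos h']

lemma loA {N : ℕ} {x : ℝ} (h : -3 / 26 ≤ x) :
    lo N x = -12 / 13 + rho N * (x + 3 / 26) := by
  rcases h.eq_or_lt with rfl | h
  · rw [loB (by norm_num) le_rfl]; norm_num
  · simp only [lo, if_neg (not_le.2 h), if_neg (not_le.2 (show -1 / 2 < x by linarith))]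

lemma upD {x : ℝ} (h : x ≤ 3 / 26) : up x = -5 / 13 + 17 / 20 * (x + 37 / 26) := by
  simp only [up, if_pos h]

lemma upE {x : ℝ} (h : 3 / 26 ≤ x) (h' : x ≤ 1 / 2) : up x = -12 / 5 * (x - 1 / 2) := by
  rcases h.eq_or_lt with rfl | h
  · rw [upD le_rfl]; norm_num
  · simp only [up, if_neg (not_le.2 h), if_pos h']

lemma upF {x : ℝ} (h : 1 / 2 ≤ x) (h' : x ≤ 37 / 26) : up x = 5 / 12 * (x - 1 / 2) := by
  rcases h.eq_or_lt with rfl | h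
  · rw [upE (by norm_num) le_rfl]; norm_num
  · simp only [up, if_neg (not_le.2 h), if_pos h', if_neg (not_le.2 (show 3 / 26 < x by linarith))]

lemma upS {x : ℝ} (h : 37 / 26 ≤ x) : up x = 5 / 13 + (x - 37 / 26) / 2 := by
  rcases h.eq_or_lt with rfl | h
  · rw [upF (by norm_num) le_rfl]; norm_num
  · simp only [up, if_neg (not_le.2 h), if_neg (not_le.2 (show 3 / 26 < x by linarith)),
      if_neg (not_le.2 (show 1 / 2 < x by linarith))]

lemma lo_le_A {N : ℕ} (hN : 1 ≤ N) {x : ℝ} (h : -3 / 26 ≤ x) :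
    lo N x ≤ -12 / 13 + 47 / 66 * (x + 3 / 26) := by
  rw [loA h]
  have := mul_le_mul_of_nonneg_right (rho_upper hN) (show 0 ≤ x + 3 / 26 by linarith)
  linarith

lemma lo_lt_up {N : ℕ} (hN : 1 ≤ N) (x : ℝ) (h1 : -37 / 26 < x) (h2 : x < 37 / 26 + N) :
    lo N x < up x := by
  rcases le_total x (-3 / 26) with a | a
  · rw [upD (by linarith)]
    rcases le_total x (-1 / 2) with b | b
    · rw [loC b]; linarith
    · rw [loB b a]; linarith
  · have hA := lo_le_A hN a
    rcases le_total x (3 / 26) with b | b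
    · rw [upD b]; linarith
    rcases le_total x (1 / 2) with c | c
    · rw [upE b c]; linarith
    rcases le_total x (37 / 26) with d | d
    · rw [upF c d]; linarith
    · rw [upS d, loA a]
      have e := rho_eq N
      have r := rho_lower N
      have hr : 1 / 2 < rho N := by
        rcases r.eq_or_lt with r | r
        · rw [← r] at e; linarith
        · exact r
      nlinarith [mul_pos (sub_pos.2 hr) (sub_pos.2 h2)]

/-- The region of the polygon. -/
def reg (N : ℕ) : Set Plane := band (-37 / 26) (37 / 26 + N) (lo N) up

lemma reg_ab (N : ℕ) : (-37 / 26 : ℝ) < 37 / 26 + N := by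
  have : (0 : ℝ) ≤ N := by positivity
  linarith

lemma reg_a (N : ℕ) : lo N (-37 / 26) = up (-37 / 26) := by
  rw [loC (by norm_num), upD (by norm_num)]; norm_num

lemma reg_b (N : ℕ) : lo N (37 / 26 + N) = up (37 / 26 + N) := by
  have : (0 : ℝ) ≤ N := by positivity
  rw [loA (by linarith), upS (by linarith)]
  have := rho_eq N
  linarith

/-- The sequence of vertices. -/
def v (N k : ℕ) : Plane :=
  if k ≤ N then pt (37 / 26 + k) (5 / 13 + k / 2)
  else if k = N + 1 then pt (-3 / 26) (-12 / 13)
  else if k = N + 2 then pt (-1 / 2) 0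
  else if k = N + 3 then pt (-37 / 26) (-5 / 13)
  else if k = N + 4 then pt (3 / 26) (12 / 13)
  else if k = N + 5 then pt (1 / 2) 0
  else pt (37 / 26) (5 / 13)

lemma v0 {N k : ℕ} (h : k ≤ N) : v N k = pt (37 / 26 + k) (5 / 13 + k / 2) := by simp [v, h]
lemma v1 (N : ℕ) : v N (N + 1) = pt (-3 / 26) (-12 / 13) := by simp [v]
lemma v2 (N : ℕ) : v N (N + 2) = pt (-1 / 2) 0 := by simp [v]
lemma v3 (N : ℕ) : v N (N + 3) = pt (-37 / 26) (-5 / 13) := by simp [v]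
lemma v4 (N : ℕ) : v N (N + 4) = pt (3 / 26) (12 / 13) := by simp [v]
lemma v5 (N : ℕ) : v N (N + 5) = pt (1 / 2) 0 := by simp [v]
lemma v6 (N : ℕ) : v N (N + 6) = pt (37 / 26) (5 / 13) := by simp [v]
lemma vz (N : ℕ) : v N 0 = pt (37 / 26) (5 / 13) := by simp [v]

lemma cases_lt {N k : ℕ} (h : k < N + 6) : k < N ∨ k = N ∨ k = N + 1 ∨ k = N + 2 ∨ k = N + 3 ∨
    k = N + 4 ∨ k = N + 5 := by omega

/-- The edges. -/
def edge (N k : ℕ) : Set Plane := segment ℝ (v N k) (v N (k + 1))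

lemma edge0 {N k : ℕ} (h : k < N) {p : Plane} : p ∈ edge N k ↔
    ∃ c : ℝ, k ≤ c ∧ c ≤ k + 1 ∧ p 0 = 37 / 26 + c ∧ p 1 = 5 / 13 + c / 2 := by
  rw [edge, v0 h.le, v0 (show k + 1 ≤ N by omega), mem_seg]
  push_cast
  simp only [pt_zero, pt_one]
  constructor
  · rintro ⟨t, h0, h1, e0, e1⟩
    exact ⟨k + t, by linarith, by linarith, by linarith, by linarith⟩
  · rintro ⟨c, h0, h1, e0, e1⟩
    exact ⟨c - k, by linarith, by linarith, by linarith, by linarith⟩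

lemma edgeA {N : ℕ} {p : Plane} : p ∈ edge N N ↔
    ∃ t T : ℝ, T = t * N ∧ 0 ≤ t ∧ t ≤ 1 ∧
      p 0 = -3 / 26 + 40 / 26 * t + T ∧ p 1 = -12 / 13 + 34 / 26 * t + T / 2 := by
  rw [edge, v0 le_rfl, v1, mem_seg]
  simp only [pt_zero, pt_one]
  constructor
  · rintro ⟨t, h0, h1, e0, e1⟩
    exact ⟨1 - t, _, rfl, by linarith, by linarith, by linarith, by linarith⟩
  · rintro ⟨t, T, rfl, h0, h1, e0, e1⟩
    exact ⟨1 - t, by linarith, by linarith, by linarith, by linarith⟩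

lemma edgeB {N : ℕ} {p : Plane} : p ∈ edge N (N + 1) ↔
    -1 / 2 ≤ p 0 ∧ p 0 ≤ -3 / 26 ∧ p 1 = -12 / 5 * (p 0 + 1 / 2) := by
  rw [edge, v1, v2, mem_seg]
  simp only [pt_zero, pt_one]
  constructor
  · rintro ⟨t, h0, h1, e0, e1⟩
    exact ⟨by linarith, by linarith, by linarith⟩
  · rintro ⟨h0, h1, e⟩
    exact ⟨(-3 / 26 - p 0) * (26 / 10), by linarith, by linarith, by linarith, by linarith⟩

lemma edgeC {N : ℕ} {p : Plane} : p ∈ edge N (N + 2) ↔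
    -37 / 26 ≤ p 0 ∧ p 0 ≤ -1 / 2 ∧ p 1 = 5 / 12 * (p 0 + 1 / 2) := by
  rw [edge, v2, v3, mem_seg]
  simp only [pt_zero, pt_one]
  constructor
  · rintro ⟨t, h0, h1, e0, e1⟩
    exact ⟨by linarith, by linarith, by linarith⟩
  · rintro ⟨h0, h1, e⟩
    exact ⟨(-1 / 2 - p 0) * (26 / 24), by linarith, by linarith, by linarith, by linarith⟩

lemma edgeD {N : ℕ} {p : Plane} : p ∈ edge N (N + 3) ↔
    -37 / 26 ≤ p 0 ∧ p 0 ≤ 3 / 26 ∧ p 1 = -5 / 13 + 17 / 20 * (p 0 + 37 / 26) := by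
  rw [edge, v3, v4, mem_seg]
  simp only [pt_zero, pt_one]
  constructor
  · rintro ⟨t, h0, h1, e0, e1⟩
    exact ⟨by linarith, by linarith, by linarith⟩
  · rintro ⟨h0, h1, e⟩
    exact ⟨(p 0 + 37 / 26) * (26 / 40), by linarith, by linarith, by linarith, by linarith⟩

lemma edgeE {N : ℕ} {p : Plane} : p ∈ edge N (N + 4) ↔
    3 / 26 ≤ p 0 ∧ p 0 ≤ 1 / 2 ∧ p 1 = -12 / 5 * (p 0 - 1 / 2) := by
  rw [edge, v4, v5, mem_seg]
  simp only [pt_zero, pt_one]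
  constructor
  · rintro ⟨t, h0, h1, e0, e1⟩
    exact ⟨by linarith, by linarith, by linarith⟩
  · rintro ⟨h0, h1, e⟩
    exact ⟨(p 0 - 3 / 26) * (26 / 10), by linarith, by linarith, by linarith, by linarith⟩

lemma edgeF {N : ℕ} {p : Plane} : p ∈ edge N (N + 5) ↔
    1 / 2 ≤ p 0 ∧ p 0 ≤ 37 / 26 ∧ p 1 = 5 / 12 * (p 0 - 1 / 2) := by
  rw [edge, v5, v6, mem_seg]
  simp only [pt_zero, pt_one]
  constructor
  · rintro ⟨t, h0, h1, e0, e1⟩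
    exact ⟨by linarith, by linarith, by linarith⟩
  · rintro ⟨h0, h1, e⟩
    exact ⟨(p 0 - 1 / 2) * (26 / 24), by linarith, by linarith, by linarith, by linarith⟩

lemma frontier_reg {N : ℕ} (hN : 1 ≤ N) {p : Plane} :
    p ∈ frontier (reg N) ↔ ∃ k < N + 6, p ∈ edge N k := by
  rw [reg, band_frontier (reg_ab N) (lo_cont N) up_cont (reg_a N) (reg_b N) (lo_lt_up hN)]
  have hN' : (1 : ℝ) ≤ N := by exact_mod_cast hN
  constructor
  · rintro ⟨h1, h2, h | h⟩
    · rcases le_total (p 0) (-1 / 2) with a | a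
      · rw [loC a] at h
        exact ⟨N + 2, by omega, edgeC.2 ⟨h1, a, h⟩⟩
      rcases le_total (p 0) (-3 / 26) with b | b
      · rw [loB a b] at h
        exact ⟨N + 1, by omega, edgeB.2 ⟨a, b, h⟩⟩
      · rw [loA b] at h
        have hW : (0 : ℝ) < 40 / 26 + N := by linarith
        refine ⟨N, by omega, edgeA.2 ⟨(p 0 + 3 / 26) / (40 / 26 + N), _, rfl, ?_, ?_, ?_, ?_⟩⟩
        · exact div_nonneg (by linarith) hW.le
        · rw [div_le_one hW]; linarith
        · have : (p 0 + 3 / 26) / (40 / 26 + N) * (40 / 26 + N) = p 0 + 3 / 26 :=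
            div_mul_cancel₀ _ hW.ne'
          linarith
        · have e := rho_eq N
          have : (p 0 + 3 / 26) / (40 / 26 + N) * (40 / 26 + N) = p 0 + 3 / 26 :=
            div_mul_cancel₀ _ hW.ne'
          have e2 : rho N * (p 0 + 3 / 26) =
              (p 0 + 3 / 26) / (40 / 26 + N) * (34 / 26 + N / 2) := by
            rw [← e]
            calc _ = rho N * ((p 0 + 3 / 26) / (40 / 26 + N) * (40 / 26 + N)) := by rw [this]
              _ = _ := by ring
          rw [h, e2]; ring
    · rcases le_total (p 0) (3 / 26) with a | a
      · rw [upD a] at h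
        exact ⟨N + 3, by omega, edgeD.2 ⟨h1, a, h⟩⟩
      rcases le_total (p 0) (1 / 2) with b | b
      · rw [upE a b] at h
        exact ⟨N + 4, by omega, edgeE.2 ⟨a, b, h⟩⟩
      rcases le_total (p 0) (37 / 26) with c | c
      · rw [upF b c] at h
        exact ⟨N + 5, by omega, edgeF.2 ⟨b, c, h⟩⟩
      · rw [upS c] at h
        rcases h2.eq_or_lt with d | d
        · obtain ⟨M, rfl⟩ : ∃ M, N = M + 1 := ⟨N - 1, by omega⟩
          push_cast at d
          exact ⟨M, by omega, (edge0 (by omega)).2 ⟨p 0 - 37 / 26, by linarith, by linarith,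
            by linarith, by linarith⟩⟩
        · have hx : 0 ≤ p 0 - 37 / 26 := by linarith
          have hk : ⌊p 0 - 37 / 26⌋₊ < N := by
            rw [Nat.floor_lt hx]; linarith
          exact ⟨⌊p 0 - 37 / 26⌋₊, by omega, (edge0 hk).2 ⟨p 0 - 37 / 26, Nat.floor_le hx,
            (Nat.lt_floor_add_one _).le, by linarith, by linarith⟩⟩
  · rintro ⟨k, hk, hp⟩
    show -37 / 26 ≤ p 0 ∧ p 0 ≤ 37 / 26 + N ∧ (p 1 = lo N (p 0) ∨ p 1 = up (p 0))
    rcases cases_lt hk with h | rfl | rfl | rfl | rfl | rfl | rfl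
    · obtain ⟨c, c1, c2, e0, e1⟩ := (edge0 h).1 hp
      have : (k : ℝ) + 1 ≤ N := by exact_mod_cast h
      have : (0 : ℝ) ≤ k := by positivity
      refine ⟨by linarith, by linarith, Or.inr ?_⟩
      rw [upS (by linarith)]; linarith
    · obtain ⟨t, T, rfl, t0, t1, e0, e1⟩ := edgeA.1 hp
      have : 0 ≤ t * k := by positivity
      refine ⟨by linarith, by nlinarith, Or.inl ?_⟩
      rw [loA (by linarith), e0, e1]
      linear_combination (-t) * rho_eq k
    · obtain ⟨a, b, c⟩ := edgeB.1 hp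
      refine ⟨by linarith, by linarith, Or.inl ?_⟩
      rw [loB a b, c]
    · obtain ⟨a, b, c⟩ := edgeC.1 hp
      refine ⟨by linarith, by linarith, Or.inl ?_⟩
      rw [loC b, c]
    · obtain ⟨a, b, c⟩ := edgeD.1 hp
      refine ⟨by linarith, by linarith, Or.inr ?_⟩
      rw [upD b, c]
    · obtain ⟨a, b, c⟩ := edgeE.1 hp
      refine ⟨by linarith, by linarith, Or.inr ?_⟩
      rw [upE a b, c]
    · obtain ⟨a, b, c⟩ := edgeF.1 hp
      refine ⟨by linarith, by linarith, Or.inr ?_⟩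
      rw [upF a b, c]

/-- Two different edges meet only if they are neighbours, and then in the common vertex. -/
lemma edge_inter {N : ℕ} (hN : 1 ≤ N) {k l : ℕ} (hkl : k < l) (hl : l < N + 6) {p : Plane}
    (hk : p ∈ edge N k) (hp : p ∈ edge N l) :
    (l = k + 1 ∧ p = v N l) ∨ (k = 0 ∧ l = N + 5 ∧ p = v N 0) := by
  have hN' : (1 : ℝ) ≤ N := by exact_mod_cast hN
  rcases cases_lt (hkl.trans hl) with h | rfl | rfl | rfl | rfl | rfl | rfl
  · obtain ⟨c, c1, c2, e0, e1⟩ := (edge0 h).1 hk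
    have hk0 : (0 : ℝ) ≤ k := by positivity
    have hkN : (k : ℝ) + 1 ≤ N := by exact_mod_cast h
    rcases cases_lt hl with h' | rfl | rfl | rfl | rfl | rfl | rfl
    · obtain ⟨c', c1', c2', e0', e1'⟩ := (edge0 h').1 hp
      have hle : (k : ℝ) + 1 ≤ l := by exact_mod_cast hkl
      have : l ≤ k + 1 := by
        have : (l : ℝ) ≤ k + 1 := by linarith
        exact_mod_cast this
      refine Or.inl ⟨by omega, ?_⟩
      rw [v0 h'.le]
      exact pt_eq (by linarith) (by linarith)
    · obtain ⟨t, T, hT, t0, t1, e0', e1'⟩ := edgeA.1 hp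
      have ht : t = 1 := by linarith
      subst ht
      have hl' : (l : ℝ) ≤ k + 1 := by linarith
      have : l ≤ k + 1 := by exact_mod_cast hl'
      refine Or.inl ⟨by omega, ?_⟩
      rw [v0 le_rfl]
      exact pt_eq (by linarith) (by linarith)
    · obtain ⟨a', b', e'⟩ := edgeB.1 hp
      linarith
    · obtain ⟨a', b', e'⟩ := edgeC.1 hp
      linarith
    · obtain ⟨a', b', e'⟩ := edgeD.1 hp
      linarith
    · obtain ⟨a', b', e'⟩ := edgeE.1 hp
      linarith
    · obtain ⟨a', b', e'⟩ := edgeF.1 hp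
      have : (k : ℝ) = 0 := by linarith
      refine Or.inr ⟨by exact_mod_cast this, rfl, ?_⟩
      rw [vz]
      exact pt_eq (by linarith) (by linarith)
  · obtain ⟨t, T, hT, t0, t1, e0, e1⟩ := edgeA.1 hk
    have hT' : t ≤ T := by rw [hT]; nlinarith
    rcases cases_lt hl with h' | rfl | rfl | rfl | rfl | rfl | rfl
    · omega
    · omega
    · obtain ⟨a', b', e'⟩ := edgeB.1 hp
      refine Or.inl ⟨rfl, ?_⟩
      rw [v1]
      exact pt_eq (by linarith) (by linarith)
    · obtain ⟨a', b', e'⟩ := edgeC.1 hp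
      linarith
    · obtain ⟨a', b', e'⟩ := edgeD.1 hp
      linarith
    · obtain ⟨a', b', e'⟩ := edgeE.1 hp
      linarith
    · obtain ⟨a', b', e'⟩ := edgeF.1 hp
      linarith
  all_goals
    rcases cases_lt hl with h' | rfl | rfl | rfl | rfl | rfl | rfl <;> try omega
  · have h1 := edgeB.1 hk
    have h2 := edgeC.1 hp
    refine Or.inl ⟨rfl, ?_⟩
    rw [v2]
    exact pt_eq (by linarith) (by linarith)
  · have h1 := edgeB.1 hk
    have h2 := edgeD.1 hp
    linarith
  · have h1 := edgeB.1 hk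
    have h2 := edgeE.1 hp
    linarith
  · have h1 := edgeB.1 hk
    have h2 := edgeF.1 hp
    linarith
  · have h1 := edgeC.1 hk
    have h2 := edgeD.1 hp
    refine Or.inl ⟨rfl, ?_⟩
    rw [v3]
    exact pt_eq (by linarith) (by linarith)
  · have h1 := edgeC.1 hk
    have h2 := edgeE.1 hp
    linarith
  · have h1 := edgeC.1 hk
    have h2 := edgeF.1 hp
    linarith
  · have h1 := edgeD.1 hk
    have h2 := edgeE.1 hp
    refine Or.inl ⟨rfl, ?_⟩
    rw [v4]
    exact pt_eq (by linarith) (by linarith)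
  · have h1 := edgeD.1 hk
    have h2 := edgeF.1 hp
    linarith
  · have h1 := edgeE.1 hk
    have h2 := edgeF.1 hp
    refine Or.inl ⟨rfl, ?_⟩
    rw [v5]
    exact pt_eq (by linarith) (by linarith)

/-- Different vertices have Euclidean distance at least one. -/
lemma v_sep {N k l : ℕ} (hkl : k < l) (hl : l < N + 6) :
    1 ≤ (v N k 0 - v N l 0) ^ 2 + (v N k 1 - v N l 1) ^ 2 := by
  rcases cases_lt (hkl.trans hl) with h | rfl | rfl | rfl | rfl | rfl | rfl
  · rw [v0 h.le]
    have hk0 : (0 : ℝ) ≤ k := by positivity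
    rcases cases_lt hl with h' | rfl | rfl | rfl | rfl | rfl | rfl
    · rw [v0 h'.le]
      have hle : (k : ℝ) + 1 ≤ l := by exact_mod_cast hkl
      simp only [pt_zero, pt_one]; nlinarith
    · rw [v0 le_rfl]
      have hle : (k : ℝ) + 1 ≤ l := by exact_mod_cast hkl
      simp only [pt_zero, pt_one]; nlinarith
    · rw [v1]; simp only [pt_zero, pt_one]; nlinarith
    · rw [v2]; simp only [pt_zero, pt_one]; nlinarith
    · rw [v3]; simp only [pt_zero, pt_one]; nlinarith
    · rw [v4]; simp only [pt_zero, pt_one]; nlinarith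
    · rw [v5]; simp only [pt_zero, pt_one]; nlinarith
  · rw [v0 le_rfl]
    have hk0 : (0 : ℝ) ≤ k := by positivity
    rcases cases_lt hl with h' | rfl | rfl | rfl | rfl | rfl | rfl
    · omega
    · omega
    · rw [v1]; simp only [pt_zero, pt_one]; nlinarith
    · rw [v2]; simp only [pt_zero, pt_one]; nlinarith
    · rw [v3]; simp only [pt_zero, pt_one]; nlinarith
    · rw [v4]; simp only [pt_zero, pt_one]; nlinarith
    · rw [v5]; simp only [pt_zero, pt_one]; nlinarith
  all_goals
    rcases cases_lt hl with h' | rfl | rfl | rfl | rfl | rfl | rfl <;> try omega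
  all_goals
    simp only [v1, v2, v3, v4, v5, pt_zero, pt_one]
    norm_num

lemma v_sep' {N k l : ℕ} (hkl : k ≠ l) (hk : k < N + 6) (hl : l < N + 6) :
    1 ≤ (v N k 0 - v N l 0) ^ 2 + (v N k 1 - v N l 1) ^ 2 := by
  rcases lt_or_gt_of_ne hkl with h | h
  · exact v_sep h hl
  · have := v_sep h hk
    linarith

lemma val_succ {N : ℕ} (i : ZMod (N + 6)) :
    (i.val + 1 < N + 6 ∧ (i + 1).val = i.val + 1) ∨ (i.val = N + 5 ∧ (i + 1).val = 0) := by
  have h := ZMod.val_lt i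
  have e : (i + 1).val = (i.val + 1) % (N + 6) := by
    rw [ZMod.val_add, ZMod.val_one'' (by omega)]
  rcases Nat.lt_or_ge (i.val + 1) (N + 6) with h' | h'
  · left; rw [e, Nat.mod_eq_of_lt h']; exact ⟨h', rfl⟩
  · right
    have : i.val + 1 = N + 6 := by omega
    rw [e, this]; exact ⟨by omega, by simp⟩

lemma v_succ {N : ℕ} (i : ZMod (N + 6)) : v N (i + 1).val = v N (i.val + 1) := by
  rcases val_succ i with ⟨_, h⟩ | ⟨h, h'⟩
  · rw [h]
  · rw [h, h', vz, v6]

lemma left_mem {N k : ℕ} : v N k ∈ edge N k := left_mem_segment ℝ _ _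
lemma right_mem {N k : ℕ} : v N (k + 1) ∈ edge N k := right_mem_segment ℝ _ _

/-- The polygon. -/
def poly (N : ℕ) (hN : 1 ≤ N) : SimplePolygon where
  n := N + 6
  three_le := by omega
  vertex := fun i => v N i.val
  carrier := reg N
  isCompact := band_compact (reg_ab N) (lo_cont N) up_cont (reg_a N) (reg_b N) (lo_lt_up hN)
  isConnected := band_connected (reg_ab N) (lo_cont N) up_cont (reg_a N) (reg_b N) (lo_lt_up hN)
  regular := band_regular (reg_ab N) (lo_cont N) up_cont (reg_a N) (reg_b N) (lo_lt_up hN)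
  frontier_eq := by
    ext p
    rw [frontier_reg hN, mem_iUnion]
    constructor
    · rintro ⟨k, hk, hp⟩
      refine ⟨(k : ZMod (N + 6)), ?_⟩
      rw [v_succ, ZMod.val_natCast_of_lt hk]
      exact hp
    · rintro ⟨i, hp⟩
      rw [v_succ] at hp
      exact ⟨i.val, ZMod.val_lt i, hp⟩
  vertex_injective := by
    intro i j hij
    by_contra hne
    have := v_sep' (N := N) (fun h => hne (ZMod.val_injective _ h)) (ZMod.val_lt i) (ZMod.val_lt j)
    simp only at hij
    rw [hij] at this
    norm_num at this
  edges_adjacent := by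
    intro i
    have e2 : i + 2 = i + 1 + 1 := by ring
    have h1 : segment ℝ (v N i.val) (v N (i + 1).val) = edge N i.val := by rw [v_succ]; rfl
    have h2 : segment ℝ (v N (i + 1).val) (v N (i + 2).val) = edge N (i + 1).val := by
      rw [e2, v_succ (i + 1)]; rfl
    simp only [h1, h2]
    apply Subset.antisymm
    · rintro p ⟨ha, hb⟩
      rcases val_succ i with ⟨h, h'⟩ | ⟨h, h'⟩
      · rw [h'] at hb ⊢
        rcases edge_inter hN (Nat.lt_succ_self _) h ha hb with ⟨_, e⟩ | ⟨_, e, _⟩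
        · exact e
        · omega
      · rw [h'] at hb ⊢
        rw [h] at ha
        rcases edge_inter hN (by omega) (by omega) hb ha with ⟨e, _⟩ | ⟨_, _, e⟩
        · omega
        · exact e
    · rintro p rfl
      refine ⟨?_, left_mem⟩
      rw [v_succ]; exact right_mem
  edges_disjoint := by
    intro i j hij h1 h2
    have e1 : segment ℝ (v N i.val) (v N (i + 1).val) = edge N i.val := by rw [v_succ]; rfl
    have e2 : segment ℝ (v N j.val) (v N (j + 1).val) = edge N j.val := by rw [v_succ]; rfl
    simp only [e1, e2]
    rw [Set.disjoint_left]
    intro p hp hq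
    have n0 : i.val ≠ j.val := fun h => hij (ZMod.val_injective _ h)
    have n1 : (i + 1).val ≠ j.val := fun h => h1 (ZMod.val_injective _ h)
    have n2 : (j + 1).val ≠ i.val := fun h => h2 (ZMod.val_injective _ h)
    have li := ZMod.val_lt i
    have lj := ZMod.val_lt j
    have si := val_succ i
    have sj := val_succ j
    rcases lt_or_gt_of_ne n0 with h | h
    · rcases edge_inter hN h lj hp hq with ⟨e, _⟩ | ⟨e, e', _⟩ <;> omega
    · rcases edge_inter hN h li hq hp with ⟨e, _⟩ | ⟨e, e', _⟩ <;> omega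

/-- Visibility across the abscissa `x`. -/
lemma sees_at {N : ℕ} {a b : Plane} (h : segment ℝ a b ⊆ reg N) (hab : a 0 < b 0) {x : ℝ}
    (h1 : a 0 ≤ x) (h2 : x ≤ b 0) :
    lo N x * (b 0 - a 0) ≤ a 1 * (b 0 - a 0) + (x - a 0) * (b 1 - a 1) ∧
    a 1 * (b 0 - a 0) + (x - a 0) * (b 1 - a 1) ≤ up x * (b 0 - a 0) := by
  have hd : 0 < b 0 - a 0 := sub_pos.2 hab
  have e : (x - a 0) / (b 0 - a 0) * (b 0 - a 0) = x - a 0 := div_mul_cancel₀ _ hd.ne'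
  have hm : pt x (a 1 + (x - a 0) / (b 0 - a 0) * (b 1 - a 1)) ∈ segment ℝ a b := by
    rw [mem_seg]
    refine ⟨(x - a 0) / (b 0 - a 0), div_nonneg (by linarith) hd.le, ?_, ?_, ?_⟩
    · rw [div_le_one hd]; linarith
    · rw [pt_zero, e]; ring
    · rw [pt_one]
  obtain ⟨_, _, h3, h4⟩ := h hm
  simp only [pt_zero, pt_one] at h3 h4
  have e2 : (a 1 + (x - a 0) / (b 0 - a 0) * (b 1 - a 1)) * (b 0 - a 0) =
      a 1 * (b 0 - a 0) + (x - a 0) * (b 1 - a 1) := by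
    linear_combination (b 1 - a 1) * e
  rw [← e2]
  exact ⟨mul_le_mul_of_nonneg_right h3 hd.le, mul_le_mul_of_nonneg_right h4 hd.le⟩

lemma lo_neg_half (N : ℕ) : lo N (-1 / 2) = 0 := by rw [loC le_rfl]; norm_num
lemma up_half : up (1 / 2) = 0 := by rw [upF le_rfl (by norm_num)]; norm_num
lemma up_t : up (37 / 26) = 5 / 13 := by rw [upS le_rfl]; norm_num

lemma cases_le {N k : ℕ} (h : k < N + 6) : k ≤ N ∨ k = N + 1 ∨ k = N + 2 ∨ k = N + 3 ∨
    k = N + 4 ∨ k = N + 5 := by omega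

lemma sees_c {N k : ℕ} (hk : k < N + 6) (h : Sees (reg N) (v N k) (pt 0 0)) :
    k = N + 1 ∨ k = N + 2 ∨ k = N + 4 ∨ k = N + 5 := by
  unfold Sees at h
  rcases cases_le hk with a | rfl | rfl | rfl | rfl | rfl
  · exfalso
    have hk0 : (0 : ℝ) ≤ k := by positivity
    rw [segment_symm, v0 a] at h
    have := (sees_at h (x := 1 / 2) (by simp only [pt_zero]; linarith)
      (by simp only [pt_zero]; linarith) (by simp only [pt_zero]; linarith)).2
    rw [up_half] at this
    simp only [pt_zero, pt_one] at this
    linarith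
  · simp
  · simp
  · exfalso
    rw [v3] at h
    have := (sees_at h (x := -1 / 2) (by simp only [pt_zero]; norm_num)
      (by simp only [pt_zero]; norm_num) (by simp only [pt_zero]; norm_num)).1
    rw [lo_neg_half] at this
    simp only [pt_zero, pt_one] at this
    norm_num at this
  · simp
  · simp

lemma sees_p {N k : ℕ} (hk : k < N + 6) (h : Sees (reg N) (v N k) (pt (25 / 26) (5 / 26))) :
    k = 0 ∨ k = N + 1 ∨ k = N + 5 := by
  unfold Sees at h
  rcases cases_le hk with a | rfl | rfl | rfl | rfl | rfl
  · rcases Nat.eq_zero_or_pos k with k0 | k0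
    · exact Or.inl k0
    exfalso
    have hk0 : (1 : ℝ) ≤ k := by exact_mod_cast k0
    rw [segment_symm, v0 a] at h
    have := (sees_at h (x := 37 / 26) (by simp only [pt_zero]; linarith)
      (by simp only [pt_zero]; linarith) (by simp only [pt_zero]; linarith)).2
    rw [up_t] at this
    simp only [pt_zero, pt_one] at this
    linarith
  · simp
  · exfalso
    rw [v2] at h
    have := (sees_at h (x := 1 / 2) (by simp only [pt_zero]; norm_num)
      (by simp only [pt_zero]; norm_num) (by simp only [pt_zero]; norm_num)).2
    rw [up_half] at this
    simp only [pt_zero, pt_one] at this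
    norm_num at this
  · exfalso
    rw [v3] at h
    have := (sees_at h (x := -1 / 2) (by simp only [pt_zero]; norm_num)
      (by simp only [pt_zero]; norm_num) (by simp only [pt_zero]; norm_num)).1
    rw [lo_neg_half] at this
    simp only [pt_zero, pt_one] at this
    norm_num at this
  · exfalso
    rw [v4] at h
    have := (sees_at h (x := 1 / 2) (by simp only [pt_zero]; norm_num)
      (by simp only [pt_zero]; norm_num) (by simp only [pt_zero]; norm_num)).2
    rw [up_half] at this
    simp only [pt_zero, pt_one] at this
    norm_num at this
  · simp

lemma sees_q {N k : ℕ} (hk : k < N + 6) (h : Sees (reg N) (v N k) (pt (-25 / 26) (-5 / 26))) :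
    k = N + 2 ∨ k = N + 3 ∨ k = N + 4 := by
  unfold Sees at h
  rw [segment_symm] at h
  rcases cases_le hk with a | rfl | rfl | rfl | rfl | rfl
  · exfalso
    have hk0 : (0 : ℝ) ≤ k := by positivity
    rw [v0 a] at h
    have := (sees_at h (x := 1 / 2) (by simp only [pt_zero]; linarith)
      (by simp only [pt_zero]; linarith) (by simp only [pt_zero]; linarith)).2
    rw [up_half] at this
    simp only [pt_zero, pt_one] at this
    linarith
  · exfalso
    rw [v1] at h
    have := (sees_at h (x := -1 / 2) (by simp only [pt_zero]; norm_num)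
      (by simp only [pt_zero]; norm_num) (by simp only [pt_zero]; norm_num)).1
    rw [lo_neg_half] at this
    simp only [pt_zero, pt_one] at this
    norm_num at this
  · simp
  · simp
  · simp
  · exfalso
    rw [v5] at h
    have := (sees_at h (x := -1 / 2) (by simp only [pt_zero]; norm_num)
      (by simp only [pt_zero]; norm_num) (by simp only [pt_zero]; norm_num)).1
    rw [lo_neg_half] at this
    simp only [pt_zero, pt_one] at this
    norm_num at this

/-- Points of the central quadrilateral belong to the region. -/
lemma central {N : ℕ} (hN : 1 ≤ N) {p : Plane} (h1 : -1 / 2 ≤ p 0) (h2 : p 0 ≤ 1 / 2)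
    (a1 : -12 / 5 * (p 0 + 1 / 2) ≤ p 1) (a2 : p 1 ≤ -12 / 5 * (p 0 - 1 / 2))
    (a3 : -12 / 13 + 3 / 2 * (p 0 + 3 / 26) ≤ p 1)
    (a4 : p 1 ≤ 12 / 13 + 3 / 2 * (p 0 - 3 / 26)) : p ∈ reg N := by
  have hN' : (1 : ℝ) ≤ N := by exact_mod_cast hN
  refine ⟨by linarith, by linarith, ?_, ?_⟩
  · rcases le_total (p 0) (-3 / 26) with b | b
    · rw [loB h1 b]; exact a1
    · have := lo_le_A hN b
      linarith
  · rcases le_total (p 0) (3 / 26) with b | b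
    · rw [upD b]; linarith
    · rw [upE b h2]; exact a2

lemma ray {N : ℕ} (hN : 1 ≤ N) {k : ℕ} (hk : k = N + 1 ∨ k = N + 2 ∨ k = N + 4 ∨ k = N + 5) :
    segment ℝ (v N k) (pt 0 0) ⊆ reg N := by
  intro p hp
  rw [mem_seg] at hp
  rcases hk with rfl | rfl | rfl | rfl
  · rw [v1] at hp
    obtain ⟨t, t0, t1, e0, e1⟩ := hp
    simp only [pt_zero, pt_one] at e0 e1
    apply central hN <;> linarith
  · rw [v2] at hp
    obtain ⟨t, t0, t1, e0, e1⟩ := hp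
    simp only [pt_zero, pt_one] at e0 e1
    apply central hN <;> linarith
  · rw [v4] at hp
    obtain ⟨t, t0, t1, e0, e1⟩ := hp
    simp only [pt_zero, pt_one] at e0 e1
    apply central hN <;> linarith
  · rw [v5] at hp
    obtain ⟨t, t0, t1, e0, e1⟩ := hp
    simp only [pt_zero, pt_one] at e0 e1
    apply central hN <;> linarith

lemma edge_sub {N : ℕ} (hN : 1 ≤ N) {k : ℕ} (hk : k < N + 6) : edge N k ⊆ reg N := by
  intro p hp
  have h : p ∈ frontier (reg N) := (frontier_reg hN).2 ⟨k, hk, hp⟩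
  exact (poly N hN).isCompact.isClosed.frontier_subset h

lemma geod_hh {N : ℕ} (hN : 1 ≤ N) {k l : ℕ} (hk : k = N + 1 ∨ k = N + 2 ∨ k = N + 4 ∨ k = N + 5)
    (hl : l = N + 1 ∨ l = N + 2 ∨ l = N + 4 ∨ l = N + 5) :
    geodesicDist (reg N) (v N k) (v N l) ≤ 2 := by
  refine geod_le_two (ray hN hk) (by rw [segment_symm]; exact ray hN hl) ?_ ?_
  · rcases hk with rfl | rfl | rfl | rfl <;> simp only [v1, v2, v4, v5, pt_zero, pt_one] <;>
      norm_num
  · rcases hl with rfl | rfl | rfl | rfl <;> simp only [v1, v2, v4, v5, pt_zero, pt_one] <;>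
      norm_num

lemma diag_sub {N : ℕ} (hN : 1 ≤ N) : segment ℝ (v N (N + 2)) (v N (N + 5)) ⊆ reg N := by
  intro p hp
  rw [mem_seg, v2, v5] at hp
  obtain ⟨t, t0, t1, e0, e1⟩ := hp
  simp only [pt_zero, pt_one] at e0 e1
  apply central hN <;> linarith

lemma geod_ht2 {N : ℕ} (hN : 1 ≤ N) {k : ℕ} (hk : k = N + 1 ∨ k = N + 5) :
    geodesicDist (reg N) (v N k) (v N (N + 3)) ≤ 2 := by
  refine geod_le_two (q := v N (N + 2)) ?_ (edge_sub hN (k := N + 2) (by omega)) ?_ ?_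
  · rcases hk with rfl | rfl
    · exact edge_sub hN (k := N + 1) (by omega)
    · rw [segment_symm]; exact diag_sub hN
  · rcases hk with rfl | rfl <;> simp only [v1, v2, v5, pt_zero, pt_one] <;> norm_num
  · simp only [v2, v3, pt_zero, pt_one]; norm_num

lemma geod_ht1 {N : ℕ} (hN : 1 ≤ N) {k : ℕ} (hk : k = N + 2 ∨ k = N + 4) :
    geodesicDist (reg N) (v N k) (v N 0) ≤ 2 := by
  refine geod_le_two (q := v N (N + 5)) ?_ ?_ ?_ ?_
  · rcases hk with rfl | rfl
    · exact diag_sub hN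
    · exact edge_sub hN (k := N + 4) (by omega)
  · have := edge_sub hN (k := N + 5) (by omega)
    rwa [edge, v6, ← vz N] at this
  · rcases hk with rfl | rfl <;> simp only [v2, v4, v5, pt_zero, pt_one] <;> norm_num
  · simp only [v5, vz, pt_zero, pt_one]; norm_num

lemma c_mem {N : ℕ} (hN : 1 ≤ N) : pt 0 0 ∈ reg N :=
  ray hN (Or.inl rfl) (right_mem_segment ℝ _ _)

lemma p_mem {N : ℕ} (hN : 1 ≤ N) : pt (25 / 26) (5 / 26) ∈ reg N :=
  edge_sub hN (k := N + 5) (by omega)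
    (edgeF.2 ⟨by rw [pt_zero]; norm_num, by rw [pt_zero]; norm_num, by
      rw [pt_zero, pt_one]; norm_num⟩)

lemma q_mem {N : ℕ} (hN : 1 ≤ N) : pt (-25 / 26) (-5 / 26) ∈ reg N :=
  edge_sub hN (k := N + 2) (by omega)
    (edgeC.2 ⟨by rw [pt_zero]; norm_num, by rw [pt_zero]; norm_num, by
      rw [pt_zero, pt_one]; norm_num⟩)

lemma v_ne {N k l : ℕ} (hkl : k ≠ l) (hk : k < N + 6) (hl : l < N + 6) : v N k ≠ v N l := by
  intro h
  have := v_sep' hkl hk hl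
  rw [h] at this
  norm_num at this

lemma guards {N : ℕ} (hN : 1 ≤ N) {G : Set Plane} (hr : ∀ g ∈ G, ∃ k < N + 6, g = v N k)
    (hs : ∀ x ∈ reg N, ∃ g ∈ G, Sees (reg N) g x) :
    ∃ g ∈ G, ∃ h ∈ G, g ≠ h ∧ geodesicDist (reg N) g h ≤ 2 := by
  obtain ⟨g, hg, sg⟩ := hs _ (c_mem hN)
  obtain ⟨k, hk, rfl⟩ := hr g hg
  have ck := sees_c hk sg
  have key : (k = N + 1 ∨ k = N + 5) ∨ (k = N + 2 ∨ k = N + 4) := by tauto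
  rcases key with h | h
  · obtain ⟨g', hg', sg'⟩ := hs _ (q_mem hN)
    obtain ⟨l, hl, rfl⟩ := hr g' hg'
    have cl := sees_q hl sg'
    refine ⟨_, hg, _, hg', v_ne (by omega) hk hl, ?_⟩
    rcases cl with e | e | e
    · exact geod_hh hN ck (by omega)
    · rw [e]; exact geod_ht2 hN h
    · exact geod_hh hN ck (by omega)
  · obtain ⟨g', hg', sg'⟩ := hs _ (p_mem hN)
    obtain ⟨l, hl, rfl⟩ := hr g' hg'
    have cl := sees_p hl sg'
    refine ⟨_, hg, _, hg', v_ne (by omega) hk hl, ?_⟩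
    rcases cl with e | e | e
    · rw [e]; exact geod_ht1 hN h
    · exact geod_hh hN ck (by omega)
    · exact geod_hh hN ck (by omega)

end ZigZag

/-- For every `m` there is a simple polygon with at least `m`
vertices, pairwise geodesic vertex distance at least `1`, such that every
vertex guard set contains two distinct guards at geodesic distance at
most `2`. -/
theorem exists_large_polygon_dispersion_le_two (m : ℕ) :
    ∃ P : SimplePolygon, m ≤ P.n ∧
      (∀ i j : ZMod P.n, i ≠ j →
        1 ≤ geodesicDist P.carrier (P.vertex i) (P.vertex j)) ∧
      ∀ G : Set Plane, P.IsVertexGuardSet G →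
        ∃ g ∈ G, ∃ h ∈ G, g ≠ h ∧ geodesicDist P.carrier g h ≤ 2 := by
  refine ⟨ZigZag.poly (m + 1) (by omega), ?_, ?_, ?_⟩
  · show m ≤ m + 1 + 6
    omega
  · intro i j hij
    change ZMod (m + 1 + 6) at i j
    exact ZigZag.one_le_geod (ZigZag.v_sep' (fun h => hij (ZMod.val_injective _ h))
      (ZMod.val_lt i) (ZMod.val_lt j))
  · rintro G ⟨hr, -, hs⟩
    refine ZigZag.guards (N := m + 1) (by omega) ?_ hs
    intro g hg
    obtain ⟨i, rfl⟩ := hr hg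
    change ZMod (m + 1 + 6) at i
    exact ⟨i.val, ZMod.val_lt i, rfl⟩
end
end

section
/- Let P = (v1, v2, v3, v4, v5, v6, v7) be a simple polygon in the Euclidean plane with exactly seven vertices, labeled in counterclockwise order along the boundary, satisfying: (1) δ(vi, vj) ≥ 1 for all i ≠ j; (2) δ(v1, v5) < 2; and (3) the vertices v2, v4, and v7 are reflex (interior angle strictly greater than 180°). Then the geodesic distance between v3 and v6 satisfies δ(v3, v6) ≥ 2. -/
open Set Metric
open scoped ENNReal

noncomputable section

/-! ### Geodesic distance -/

lemma geo_le_edist {P : Set Plane} {p q : Plane} (h : segment ℝ p q ⊆ P) :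
    geodesicDist P p q ≤ edist p q := by
  have hv : eVariationOn (AffineMap.lineMap p q : ℝ → Plane) (Icc 0 1) ≤ edist p q := by
    have h1 := LipschitzOnWith.comp_eVariationOn_le (f := (AffineMap.lineMap p q : ℝ → Plane))
      ((lipschitzWith_lineMap p q).lipschitzOnWith (s := univ)) (g := (id : ℝ → ℝ))
      (s := Icc 0 1) (mapsTo_univ _ _)
    have h2 : eVariationOn (id : ℝ → ℝ) (Icc 0 1) = 1 := by
      have := MonotoneOn.eVariationOn_eq (f := (id : ℝ → ℝ)) (s := univ) (a := 0) (b := 1)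
        (monotone_id.monotoneOn _) (mem_univ _) (mem_univ _)
      simpa only [univ_inter, id, sub_zero, ENNReal.ofReal_one] using this
    rw [h2, mul_one] at h1
    rw [edist_nndist]
    exact h1
  refine le_trans ?_ hv
  refine iInf_le_of_le (AffineMap.lineMap p q : ℝ → Plane) ?_
  refine iInf_le_of_le (AffineMap.lineMap_continuous.continuousOn) ?_
  refine iInf_le_of_le (by simp) ?_
  refine iInf_le_of_le (by simp) ?_
  refine iInf_le_of_le ?_ le_rfl
  intro t ht
  apply h
  rw [segment_eq_image_lineMap]
  exact ⟨t, ht, rfl⟩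

lemma geo_le_path {P : Set Plane} {γ : ℝ → Plane} {a b : ℝ} (hab : a ≤ b)
    (hc : ContinuousOn γ (Icc a b)) (hm : MapsTo γ (Icc a b) P) :
    geodesicDist P (γ a) (γ b) ≤ eVariationOn γ (Icc a b) := by
  have hmaps : MapsTo (fun t : ℝ => a + t * (b - a)) (Icc 0 1) (Icc a b) := by
    rintro t ⟨h0, h1⟩
    constructor <;> nlinarith
  have hmono : MonotoneOn (fun t : ℝ => a + t * (b - a)) (Icc 0 1) := by
    intro s _ t _ hst
    have : s * (b - a) ≤ t * (b - a) := mul_le_mul_of_nonneg_right hst (by linarith)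
    simpa using this
  have hv := eVariationOn.comp_le_of_monotoneOn γ _ hmono hmaps
  refine le_trans ?_ hv
  refine iInf_le_of_le (γ ∘ fun t : ℝ => a + t * (b - a)) ?_
  refine iInf_le_of_le (hc.comp (by fun_prop) hmaps) ?_
  refine iInf_le_of_le (by simp) ?_
  refine iInf_le_of_le (by simp) ?_
  exact iInf_le_of_le (hm.comp hmaps) le_rfl

lemma edist_le_geo {P : Set Plane} {p q : Plane} : edist p q ≤ geodesicDist P p q := by
  refine le_iInf fun γ => le_iInf fun _ => le_iInf fun h0 => le_iInf fun h1 => le_iInf fun _ => ?_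
  rw [← h0, ← h1]
  exact eVariationOn.edist_le γ (by simp) (by simp)

lemma geo_lt_iff {P : Set Plane} {p q : Plane} {L : ℝ≥0∞} : geodesicDist P p q < L ↔
    ∃ γ : ℝ → Plane, ContinuousOn γ (Icc 0 1) ∧ γ 0 = p ∧ γ 1 = q ∧ MapsTo γ (Icc 0 1) P ∧
      eVariationOn γ (Icc 0 1) < L := by
  simp only [geodesicDist, iInf_lt_iff, exists_prop]

lemma geo_triangle {P : Set Plane} (p q r : Plane) :
    geodesicDist P p r ≤ geodesicDist P p q + geodesicDist P q r := by
  rcases eq_or_ne (geodesicDist P p q) ⊤ with h | h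
  · simp [h]
  rcases eq_or_ne (geodesicDist P q r) ⊤ with h' | h'
  · simp [h']
  refine ENNReal.le_of_forall_pos_le_add fun ε hε _ => ?_
  have hε2 : (ε / 2 : ℝ≥0∞) ≠ 0 := by
    simp [hε.ne']
  obtain ⟨γ₁, c1, s1, e1, m1, l1⟩ := geo_lt_iff.1 (ENNReal.lt_add_right h hε2)
  obtain ⟨γ₂, c2, s2, e2, m2, l2⟩ := geo_lt_iff.1 (ENNReal.lt_add_right h' hε2)
  set γ : ℝ → Plane := fun t => if t ≤ 1 then γ₁ t else γ₂ (t - 1) with hγ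
  have eq1 : EqOn γ γ₁ (Icc 0 1) := fun t ht => by simp [hγ, ht.2]
  have eq2 : EqOn γ (γ₂ ∘ fun t => t - 1) (Icc 1 2) := fun t ht => by
    rcases eq_or_lt_of_le ht.1 with h1 | h1
    · subst h1; simp [hγ, e1, s2]
    · simp [hγ, h1]
  have mp : MapsTo (fun t : ℝ => t - 1) (Icc 1 2) (Icc 0 1) := fun t ht => by
    constructor <;> linarith [ht.1, ht.2]
  have un : Icc (0:ℝ) 2 = Icc 0 1 ∪ Icc 1 2 := by
    rw [Icc_union_Icc_eq_Icc] <;> norm_num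
  have cont : ContinuousOn γ (Icc 0 2) := by
    rw [un]
    refine ContinuousOn.union_of_isClosed (c1.congr eq1) ?_ isClosed_Icc isClosed_Icc
    exact (c2.comp (by fun_prop) mp).congr eq2
  have maps : MapsTo γ (Icc 0 2) P := by
    rw [un]
    refine MapsTo.union (m1.congr eq1.symm) ((m2.comp mp).congr eq2.symm)
  have hl := geo_le_path (by norm_num) cont maps
  have hadd := eVariationOn.Icc_add_Icc γ (s := univ) (a := 0) (b := 1) (c := 2)
    (by norm_num) (by norm_num) (mem_univ _)
  simp only [univ_inter] at hadd
  rw [← hadd, eVariationOn.eq_of_eqOn eq1, eVariationOn.eq_of_eqOn eq2] at hl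
  have hmono : MonotoneOn (fun t : ℝ => t - 1) (Icc 1 2) := fun s _ t _ h => by simpa using h
  have hv := eVariationOn.comp_le_of_monotoneOn γ₂ _ hmono mp
  have hγ0 : γ 0 = p := by simp [hγ, s1]
  have hγ2 : γ 2 = r := by
    have : γ 2 = _ := eq2 (by norm_num : (2:ℝ) ∈ Icc (1:ℝ) 2)
    rw [this]; norm_num [e2]
  rw [hγ0, hγ2] at hl
  refine hl.trans ((add_le_add l1.le (hv.trans l2.le)).trans ?_)
  have : (ε:ℝ≥0∞) = ε/2 + ε/2 := (ENNReal.add_halves _).symm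
  conv_rhs => rw [this]
  apply le_of_eq; ring

/-! ### Cross product and coordinates -/

/-- planar crs product -/
def crs (a b : Plane) : ℝ := a 0 * b 1 - a 1 * b 0

lemma crs_add_left (a b c : Plane) : crs (a + b) c = crs a c + crs b c := by
  simp [crs]; ring
lemma crs_add_right (a b c : Plane) : crs a (b + c) = crs a b + crs a c := by
  simp [crs]; ring
lemma crs_sub_left (a b c : Plane) : crs (a - b) c = crs a c - crs b c := by
  simp [crs]; ring
lemma crs_sub_right (a b c : Plane) : crs a (b - c) = crs a b - crs a c := by
  simp [crs]; ring
lemma crs_smul_left (t : ℝ) (a c : Plane) : crs (t • a) c = t * crs a c := by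
  simp [crs]; ring
lemma crs_smul_right (t : ℝ) (a c : Plane) : crs a (t • c) = t * crs a c := by
  simp [crs]; ring
lemma crs_self (a : Plane) : crs a a = 0 := by simp [crs]; ring
lemma crs_comm (a b : Plane) : crs a b = - crs b a := by simp [crs]; ring

@[fun_prop]
lemma crs_continuous {X : Type*} [TopologicalSpace X] {f g : X → Plane} (hf : Continuous f)
    (hg : Continuous g) : Continuous fun x => crs (f x) (g x) := by
  unfold crs; fun_prop

lemma plane_ext {a b : Plane} (h0 : a 0 = b 0) (h1 : a 1 = b 1) : a = b := by
  ext i; fin_cases i <;> assumption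

lemma exists_smul_of_crs_eq_zero {a b : Plane} (ha : a ≠ 0) (h : crs a b = 0) :
    ∃ t : ℝ, b = t • a := by
  have h' : a 0 * b 1 = a 1 * b 0 := by simpa [crs, sub_eq_zero] using h
  by_cases h0 : a 0 = 0
  · have h1 : a 1 ≠ 0 := fun h1 => ha (plane_ext (by simpa using h0) (by simpa using h1))
    refine ⟨b 1 / a 1, plane_ext ?_ ?_⟩
    · have : b 0 = 0 := by
        rw [h0, zero_mul] at h'
        rcases mul_eq_zero.1 h'.symm with h | h
        · exact absurd h h1
        · exact h
      simp [h0, this]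
    · simp; field_simp
  · refine ⟨b 0 / a 0, plane_ext ?_ ?_⟩
    · simp; field_simp
    · simp; field_simp; linarith

/-- first affine coordinate in the frame `(b; e₁, e₂)` -/
def cX (b e₁ e₂ z : Plane) : ℝ := crs (z - b) e₂ / crs e₁ e₂
/-- second affine coordinate in the frame `(b; e₁, e₂)` -/
def cY (b e₁ e₂ z : Plane) : ℝ := crs e₁ (z - b) / crs e₁ e₂

lemma eq_coords {b e₁ e₂ : Plane} (h : crs e₁ e₂ ≠ 0) (z : Plane) :
    z = b + cX b e₁ e₂ z • e₁ + cY b e₁ e₂ z • e₂ := by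
  have h' : e₁ 0 * e₂ 1 - e₁ 1 * e₂ 0 ≠ 0 := h
  apply plane_ext <;> simp only [cX, cY, crs, PiLp.add_apply, PiLp.sub_apply, PiLp.smul_apply,
    smul_eq_mul] <;> rw [div_mul_eq_mul_div, div_mul_eq_mul_div, add_assoc, ← add_div,
    ← sub_eq_iff_eq_add', eq_div_iff h'] <;> ring

lemma cX_mk {b e₁ e₂ : Plane} (h : crs e₁ e₂ ≠ 0) (x y : ℝ) :
    cX b e₁ e₂ (b + x • e₁ + y • e₂) = x := by
  rw [cX, div_eq_iff h]
  have : b + x • e₁ + y • e₂ - b = x • e₁ + y • e₂ := by abel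
  rw [this, crs_add_left, crs_smul_left, crs_smul_left, crs_self]; ring

lemma cY_mk {b e₁ e₂ : Plane} (h : crs e₁ e₂ ≠ 0) (x y : ℝ) :
    cY b e₁ e₂ (b + x • e₁ + y • e₂) = y := by
  rw [cY, div_eq_iff h]
  have : b + x • e₁ + y • e₂ - b = x • e₁ + y • e₂ := by abel
  rw [this, crs_add_right, crs_smul_right, crs_smul_right, crs_self]; ring

@[fun_prop]
lemma cX_continuous (b e₁ e₂ : Plane) : Continuous (cX b e₁ e₂) := by
  unfold cX; fun_prop
@[fun_prop]
lemma cY_continuous (b e₁ e₂ : Plane) : Continuous (cY b e₁ e₂) := by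
  unfold cY; fun_prop

lemma cX_line (b e₁ e₂ p q : Plane) (s : ℝ) :
    cX b e₁ e₂ (p + s • (q - p)) = (1 - s) * cX b e₁ e₂ p + s * cX b e₁ e₂ q := by
  simp only [cX, crs]; simp; ring
lemma cY_line (b e₁ e₂ p q : Plane) (s : ℝ) :
    cY b e₁ e₂ (p + s • (q - p)) = (1 - s) * cY b e₁ e₂ p + s * cY b e₁ e₂ q := by
  simp only [cY, crs]; simp; ring

lemma mem_seg_iff {p q z : Plane} : z ∈ segment ℝ p q ↔ ∃ s : ℝ, 0 ≤ s ∧ s ≤ 1 ∧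
    z = p + s • (q - p) := by
  rw [segment_eq_image']
  constructor
  · rintro ⟨s, ⟨h0, h1⟩, rfl⟩; exact ⟨s, h0, h1, rfl⟩
  · rintro ⟨s, h0, h1, rfl⟩; exact ⟨s, ⟨h0, h1⟩, rfl⟩

lemma isClosed_seg (p q : Plane) : IsClosed (segment ℝ p q) := by
  rw [segment_eq_image']
  exact (isCompact_Icc.image (by fun_prop)).isClosed

/-! ### Connectedness and frontier -/

lemma preconn_subset_interior {S P : Set Plane} (hS : IsPreconnected S)
    (hd : ∀ z ∈ S, z ∉ frontier P) {z : Plane} (hz : z ∈ S) (hzP : z ∈ P) : S ⊆ interior P := by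
  refine hS.subset_left_of_subset_union isOpen_interior
    (isClosed_closure (s := P)).isOpen_compl ?_ ?_ ?_
  · exact disjoint_left.2 fun x h1 h2 => h2 (subset_closure (interior_subset h1))
  · intro x hx
    by_cases h : x ∈ interior P
    · exact Or.inl h
    · exact Or.inr fun hc => hd x hx ⟨hc, h⟩
  · refine ⟨z, hz, ?_⟩
    by_contra h
    exact hd z hz ⟨subset_closure hzP, h⟩

/-- A segment from a point of `O` to a point outside hits the frontier of `O`. -/
lemma exit_point {O : Set Plane} (hO : IsOpen O) {q u : Plane} (hq : q ∈ O) (hu : u ∉ O) :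
    ∃ s : ℝ, 0 < s ∧ s ≤ 1 ∧ q + s • (u - q) ∈ frontier O := by
  by_contra! hcon
  have hpre : IsPreconnected (segment ℝ q u) := (convex_segment q u).isPreconnected
  have : segment ℝ q u ⊆ interior O := by
    refine preconn_subset_interior hpre ?_ (left_mem_segment ℝ q u) hq
    intro z hz
    obtain ⟨s, h0, h1, rfl⟩ := mem_seg_iff.1 hz
    rcases h0.eq_or_lt with h | h
    · subst h
      simp only [zero_smul, add_zero]
      intro hf
      exact hf.2 (by rwa [hO.interior_eq])
    · exact hcon s h h1
  exact hu (interior_subset (this (right_mem_segment ℝ q u)))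


/-! ### Local structure of polygons -/

/-- functions which are affine along segments -/
def AffLike (f : Plane → ℝ) : Prop :=
  ∀ p q : Plane, ∀ s : ℝ, f (p + s • (q - p)) = (1 - s) * f p + s * f q

lemma AffLike.neg {f : Plane → ℝ} (hf : AffLike f) : AffLike (fun z => - f z) := by
  intro p q s
  simp only [hf p q s]; ring

lemma convex_of_line {S : Set Plane} (h : ∀ p ∈ S, ∀ q ∈ S, ∀ s : ℝ, 0 ≤ s → s ≤ 1 →
    p + s • (q - p) ∈ S) : Convex ℝ S := by
  rw [convex_iff_segment_subset]
  intro p hp q hq z hz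
  obtain ⟨s, h0, h1, rfl⟩ := mem_seg_iff.1 hz
  exact h p hp q hq s h0 h1

lemma AffLike.convex_pos {f : Plane → ℝ} (hf : AffLike f) : Convex ℝ {z | 0 < f z} := by
  refine convex_of_line fun p hp q hq s h0 h1 => ?_
  simp only [mem_ofPred_eq] at *
  rw [hf]
  rcases h0.eq_or_lt with h | h
  · subst h; simpa using hp
  · have := mul_pos h hq
    have := mul_nonneg (sub_nonneg.2 h1) hp.le
    linarith

lemma AffLike.convex_neg {f : Plane → ℝ} (hf : AffLike f) : Convex ℝ {z | f z < 0} := by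
  simpa using hf.neg.convex_pos

lemma affLike_cX (b e₁ e₂ : Plane) : AffLike (cX b e₁ e₂) := cX_line b e₁ e₂
lemma affLike_cY (b e₁ e₂ : Plane) : AffLike (cY b e₁ e₂) := cY_line b e₁ e₂
lemma affLike_crs (e p : Plane) : AffLike (fun z => crs e (z - p)) := by
  intro a b s
  simp [crs]; ring

namespace SimplePolygon
variable (P : SimplePolygon)

/-- the `i`-th edge -/
def edge (i : ZMod P.n) : Set Plane := segment ℝ (P.vertex i) (P.vertex (i + 1))

lemma neZero : NeZero P.n := ⟨by have := P.three_le; omega⟩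
lemma fin : Finite (ZMod P.n) := by
  have := P.neZero; infer_instance
lemma one_ne : (1 : ZMod P.n) ≠ 0 := by
  have : Fact (1 < P.n) := ⟨by have := P.three_le; omega⟩
  exact one_ne_zero

lemma vertex_ne (i : ZMod P.n) : P.vertex i ≠ P.vertex (i + 1) := by
  intro h
  have := P.vertex_injective h
  exact P.one_ne (by simpa using this)

lemma isClosed_edge (i : ZMod P.n) : IsClosed (P.edge i) := isClosed_seg _ _

lemma mem_frontier {z : Plane} : z ∈ frontier P.carrier ↔ ∃ i, z ∈ P.edge i := by
  rw [P.frontier_eq]; simp [edge]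

lemma isClosed : IsClosed P.carrier := P.isCompact.isClosed

lemma edge_subset_frontier (i : ZMod P.n) : P.edge i ⊆ frontier P.carrier :=
  fun _ hz => P.mem_frontier.2 ⟨i, hz⟩

lemma frontier_subset : frontier P.carrier ⊆ P.carrier := P.isClosed.frontier_subset

lemma edge_subset (i : ZMod P.n) : P.edge i ⊆ P.carrier :=
  (P.edge_subset_frontier i).trans P.frontier_subset

lemma left_mem_edge (i : ZMod P.n) : P.vertex i ∈ P.edge i := left_mem_segment ℝ _ _
lemma right_mem_edge (i : ZMod P.n) : P.vertex (i + 1) ∈ P.edge i := right_mem_segment ℝ _ _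

lemma adjacent (i : ZMod P.n) {z : Plane} (h1 : z ∈ P.edge i) (h2 : z ∈ P.edge (i + 1)) :
    z = P.vertex (i + 1) := by
  have := P.edges_adjacent i
  have h : z ∈ ({P.vertex (i + 1)} : Set Plane) := by
    rw [← this]
    refine ⟨h1, ?_⟩
    have e : i + 2 = i + 1 + 1 := by ring
    rw [e]; exact h2
  exact h

lemma edge_inter {i j : ZMod P.n} (hij : i ≠ j) {z : Plane} (hi : z ∈ P.edge i)
    (hj : z ∈ P.edge j) : (i + 1 = j ∧ z = P.vertex j) ∨ (j + 1 = i ∧ z = P.vertex i) := by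
  by_cases h1 : i + 1 = j
  · subst h1; exact Or.inl ⟨rfl, P.adjacent i hi hj⟩
  by_cases h2 : j + 1 = i
  · subst h2; exact Or.inr ⟨rfl, P.adjacent j hj hi⟩
  exact absurd hj (disjoint_left.1 (P.edges_disjoint i j hij h1 h2) hi)

lemma vertex_mem_edge {k i : ZMod P.n} (h : P.vertex k ∈ P.edge i) : k = i ∨ k = i + 1 := by
  by_contra! hc
  rcases P.edge_inter hc.1 (P.left_mem_edge k) h with ⟨h1, h2⟩ | ⟨h1, h2⟩
  · exact hc.1 (P.vertex_injective h2)
  · exact hc.2 h1.symm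

lemma eventually_edge (p : Plane) : ∀ᶠ z in nhds p, ∀ j, z ∈ P.edge j → p ∈ P.edge j := by
  have := P.fin
  rw [Filter.eventually_all]
  intro j
  by_cases h : p ∈ P.edge j
  · exact Filter.Eventually.of_forall fun _ _ => h
  · filter_upwards [(P.isClosed_edge j).isOpen_compl.mem_nhds h] with z hz hz'
    exact absurd hz' hz

lemma seg_cone (u w p : Plane) (huw : u ≠ w) (hp : p ∈ segment ℝ u w) :
    ∀ᶠ z in nhds p, ∀ s : ℝ, 0 < s → s ≤ 1 → p + s • (z - p) ∈ segment ℝ u w →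
      z ∈ segment ℝ u w := by
  obtain ⟨t, t0, t1, rfl⟩ := mem_seg_iff.1 hp
  set p := u + t • (w - u) with hpdef
  have hn : 0 < ‖w - u‖ := norm_pos_iff.2 (sub_ne_zero.2 huw.symm)
  have key : ∀ c : ℝ, 0 < c → ∀ᶠ z in nhds p, ∀ κ : ℝ, z - p = κ • (w - u) → |κ| < c := by
    intro c hc
    filter_upwards [Metric.ball_mem_nhds p (mul_pos hc hn)] with z hz κ hκ
    rw [mem_ball, dist_eq_norm, hκ, norm_smul, Real.norm_eq_abs] at hz
    exact lt_of_mul_lt_mul_right hz hn.le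
  have k1 : ∀ᶠ z in nhds p, ∀ κ : ℝ, z - p = κ • (w - u) → t < 1 → |κ| < 1 - t := by
    by_cases h : t < 1
    · filter_upwards [key (1 - t) (by linarith)] with z hz κ hκ _ using hz κ hκ
    · exact Filter.Eventually.of_forall fun _ _ _ h' => absurd h' h
  have k2 : ∀ᶠ z in nhds p, ∀ κ : ℝ, z - p = κ • (w - u) → 0 < t → |κ| < t := by
    by_cases h : 0 < t
    · filter_upwards [key t h] with z hz κ hκ _ using hz κ hκ
    · exact Filter.Eventually.of_forall fun _ _ _ h' => absurd h' h
  filter_upwards [k1, k2] with z hz1 hz2 s s0 s1 hs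
  obtain ⟨t', t0', t1', ht'⟩ := mem_seg_iff.1 hs
  have hκ : z - p = ((t' - t) / s) • (w - u) := by
    have : s • (z - p) = (t' - t) • (w - u) := by
      have : s • (z - p) = (u + t' • (w - u)) - p := by rw [← ht']; abel
      rw [this, hpdef, sub_smul]; abel
    rw [div_eq_inv_mul, mul_smul, ← this, smul_smul, inv_mul_cancel₀ s0.ne', one_smul]
  set κ := (t' - t) / s with hκd
  have hsk : s * κ = t' - t := by rw [hκd]; field_simp
  refine mem_seg_iff.2 ⟨t + κ, ?_, ?_, ?_⟩
  · rcases t0.eq_or_lt with h | h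
    · by_contra hcon
      nlinarith
    · have := hz2 κ hκ h
      linarith [(abs_lt.1 this).1]
  · rcases t1.eq_or_lt with h | h
    · by_contra hcon
      nlinarith
    · have := hz1 κ hκ h
      linarith [(abs_lt.1 this).2]
  · rw [add_smul, ← hκ, hpdef]; abel

lemma local_star {p : Plane} (hp : p ∈ P.carrier) :
    ∀ᶠ z in nhds p, z ∈ P.carrier → segment ℝ p z ⊆ P.carrier := by
  have := P.fin
  have h1 : ∀ᶠ z in nhds p, ∀ j, p ∈ P.edge j → ∀ s : ℝ, 0 < s → s ≤ 1 →
      p + s • (z - p) ∈ P.edge j → z ∈ P.edge j := by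
    rw [Filter.eventually_all]
    intro j
    by_cases h : p ∈ P.edge j
    · filter_upwards [seg_cone _ _ p (P.vertex_ne j) h] with z hz _ using hz
    · exact Filter.Eventually.of_forall fun _ h' => absurd h' h
  obtain ⟨r, r0, hr⟩ := Metric.eventually_nhds_iff_ball.1 (h1.and (P.eventually_edge p))
  refine Metric.eventually_nhds_iff_ball.2 ⟨r, r0, fun z hz hzP => ?_⟩
  by_cases hzf : z ∈ frontier P.carrier
  · obtain ⟨j, hj⟩ := P.mem_frontier.1 hzf
    have hpj := (hr z hz).2 j hj
    exact ((convex_segment _ _).segment_subset hpj hj).trans (P.edge_subset j)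
  · set S : Set Plane := (fun s : ℝ => p + s • (z - p)) '' Ioc 0 1 with hS
    have hpre : IsPreconnected S :=
      (isPreconnected_Ioc).image _ (by fun_prop)
    have hsub : S ⊆ interior P.carrier := by
      refine preconn_subset_interior hpre ?_ (z := z) ⟨1, by simp, by simp⟩ hzP
      rintro _ ⟨s, ⟨s0, s1⟩, rfl⟩ hf
      obtain ⟨j, hj⟩ := P.mem_frontier.1 hf
      have hb : p + s • (z - p) ∈ ball p r := by
        rw [mem_ball, dist_eq_norm] at *
        rw [add_sub_cancel_left, norm_smul, Real.norm_eq_abs, abs_of_pos s0]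
        nlinarith [norm_nonneg (z - p)]
      have hpj := (hr _ hb).2 j hj
      exact hzf (P.mem_frontier.2 ⟨j, (hr z hz).1 j hpj s s0 s1 hj⟩)
    intro y hy
    obtain ⟨s, s0, s1, rfl⟩ := mem_seg_iff.1 hy
    rcases s0.eq_or_lt with h | h
    · subst h; simpa using hp
    · exact interior_subset (hsub ⟨s, ⟨h, s1⟩, rfl⟩)

lemma two_side_aux {p : Plane} (hp : p ∈ frontier P.carrier) {r : ℝ} (r0 : 0 < r)
    {A₁ A₂ : Set Plane} (c₁ : IsPreconnected A₁) (c₂ : IsPreconnected A₂)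
    (h : ball p r \ frontier P.carrier = A₁ ∪ A₂) (hne : (A₁ ∩ interior P.carrier).Nonempty) :
    ball p r ∩ interior P.carrier = A₁ ∧ ball p r ∩ P.carrierᶜ = A₂ := by
  have d₁ : ∀ z ∈ A₁, z ∈ ball p r ∧ z ∉ frontier P.carrier := fun z hz => by
    have : z ∈ A₁ ∪ A₂ := Or.inl hz
    rwa [← h] at this
  have d₂ : ∀ z ∈ A₂, z ∈ ball p r ∧ z ∉ frontier P.carrier := fun z hz => by
    have : z ∈ A₁ ∪ A₂ := Or.inr hz
    rwa [← h] at this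
  obtain ⟨x, hx1, hx2⟩ := hne
  have s1 : A₁ ⊆ interior P.carrier :=
    preconn_subset_interior c₁ (fun z hz => (d₁ z hz).2) hx1 (interior_subset hx2)
  have s2 : ∀ z ∈ A₂, z ∉ P.carrier := by
    intro z hz hzP
    have s2 : A₂ ⊆ interior P.carrier :=
      preconn_subset_interior c₂ (fun z hz => (d₂ z hz).2) hz hzP
    have hball : ball p r ⊆ P.carrier := by
      intro y hy
      by_cases hyf : y ∈ frontier P.carrier
      · exact P.frontier_subset hyf
      · have : y ∈ A₁ ∪ A₂ := by rw [← h]; exact ⟨hy, hyf⟩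
        rcases this with h | h
        · exact interior_subset (s1 h)
        · exact interior_subset (s2 h)
    exact hp.2 (mem_interior_iff_mem_nhds.2 (Filter.mem_of_superset (ball_mem_nhds p r0) hball))
  constructor
  · ext z
    refine ⟨fun hz => ?_, fun hz => ⟨(d₁ z hz).1, s1 hz⟩⟩
    have : z ∈ A₁ ∪ A₂ := by rw [← h]; exact ⟨hz.1, fun hf => hf.2 hz.2⟩
    exact this.resolve_right fun h2 => s2 z h2 (interior_subset hz.2)
  · ext z
    refine ⟨fun hz => ?_, fun hz => ⟨(d₂ z hz).1, s2 z hz⟩⟩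
    have : z ∈ A₁ ∪ A₂ := by rw [← h]; exact ⟨hz.1, fun hf => hz.2 (P.frontier_subset hf)⟩
    exact this.resolve_left fun h2 => hz.2 (interior_subset (s1 h2))

lemma two_side {p : Plane} (hp : p ∈ frontier P.carrier) {r : ℝ} (r0 : 0 < r)
    {A₁ A₂ : Set Plane} (c₁ : IsPreconnected A₁) (c₂ : IsPreconnected A₂)
    (h : ball p r \ frontier P.carrier = A₁ ∪ A₂) :
    (ball p r ∩ interior P.carrier = A₁ ∧ ball p r ∩ P.carrierᶜ = A₂) ∨
    (ball p r ∩ interior P.carrier = A₂ ∧ ball p r ∩ P.carrierᶜ = A₁) := by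
  have hpc : p ∈ closure (interior P.carrier) := by
    rw [← P.regular]; exact P.frontier_subset hp
  obtain ⟨x, hx, hd⟩ := Metric.mem_closure_iff.1 hpc r r0
  have hxm : x ∈ A₁ ∪ A₂ := by
    rw [← h]
    exact ⟨by rwa [mem_ball, dist_comm], fun hf => hf.2 hx⟩
  rcases hxm with hx1 | hx1
  · exact Or.inl (P.two_side_aux hp r0 c₁ c₂ h ⟨x, hx1, hx⟩)
  · exact Or.inr (P.two_side_aux hp r0 c₂ c₁ (by rw [h, union_comm]) ⟨x, hx1, hx⟩)

/-- Both sides of a pair of (opposite) rays: a non-vertex boundary point. -/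
lemma line_split (p e : Plane) {r : ℝ}
    (hf : ∀ z ∈ ball p r, z ∈ frontier P.carrier ↔ crs e (z - p) = 0) :
    IsPreconnected (ball p r ∩ {z | 0 < crs e (z - p)}) ∧
    IsPreconnected (ball p r ∩ {z | crs e (z - p) < 0}) ∧
    ball p r \ frontier P.carrier =
      (ball p r ∩ {z | 0 < crs e (z - p)}) ∪ (ball p r ∩ {z | crs e (z - p) < 0}) := by
  refine ⟨((convex_ball p r).inter (affLike_crs e p).convex_pos).isPreconnected,
    ((convex_ball p r).inter (affLike_crs e p).convex_neg).isPreconnected, ?_⟩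
  ext z
  simp only [mem_sdiff, mem_union, mem_inter_iff, mem_ofPred_eq]
  constructor
  · rintro ⟨h1, h2⟩
    rw [hf z h1] at h2
    rcases lt_or_gt_of_ne h2 with h | h
    · exact Or.inr ⟨h1, h⟩
    · exact Or.inl ⟨h1, h⟩
  · rintro (⟨h1, h2⟩ | ⟨h1, h2⟩)
    · exact ⟨h1, fun h => h2.ne' ((hf z h1).1 h)⟩
    · exact ⟨h1, fun h => h2.ne ((hf z h1).1 h)⟩

/-- near a nonvertex point of edge `i`, the frontier is a line -/
lemma frontier_near {p : Plane} {i : ZMod P.n} (hp : p ∈ P.edge i) (hv : ∀ k, p ≠ P.vertex k) :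
    ∀ᶠ z in nhds p, z ∈ frontier P.carrier ↔
      crs (P.vertex (i + 1) - P.vertex i) (z - p) = 0 := by
  obtain ⟨t, t0, t1, hpt⟩ := mem_seg_iff.1 hp
  set u := P.vertex i with hu
  set w := P.vertex (i + 1) with hw
  have hn : 0 < ‖w - u‖ := norm_pos_iff.2 (sub_ne_zero.2 (P.vertex_ne i).symm)
  have t0' : 0 < t := t0.lt_of_ne fun h => hv i (by rw [hpt, ← h]; simp [hu])
  have t1' : t < 1 := t1.lt_of_ne fun h => hv (i + 1) (by rw [hpt, h]; simp [hw])
  have hc : 0 < min t (1 - t) := lt_min t0' (by linarith)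
  filter_upwards [P.eventually_edge p, Metric.ball_mem_nhds p (mul_pos hc hn)] with z hz hzb
  constructor
  · intro hzf
    obtain ⟨j, hj⟩ := P.mem_frontier.1 hzf
    have hij : i = j := by
      by_contra hij
      rcases P.edge_inter hij hp (hz j hj) with h | h
      · exact hv _ h.2
      · exact hv _ h.2
    subst hij
    obtain ⟨t', _, _, hzt⟩ := mem_seg_iff.1 hj
    have : z - p = (t' - t) • (w - u) := by rw [hzt, hpt, sub_smul]; abel
    rw [this, crs_smul_right, crs_self, mul_zero]
  · intro h
    obtain ⟨κ, hκ⟩ := exists_smul_of_crs_eq_zero (sub_ne_zero.2 (P.vertex_ne i).symm) h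
    rw [mem_ball, dist_eq_norm, hκ, norm_smul, Real.norm_eq_abs] at hzb
    have hk := lt_of_mul_lt_mul_right hzb hn.le
    have hk1 := abs_lt.1 (hk.trans_le (min_le_left _ _))
    have hk2 := abs_lt.1 (hk.trans_le (min_le_right _ _))
    refine P.edge_subset_frontier i (mem_seg_iff.2 ⟨t + κ, by linarith, by linarith, ?_⟩)
    rw [add_smul, ← add_assoc, ← hu, ← hw, ← hpt]
    change z - p = κ • (w - u) at hκ
    rw [← hκ]; abel

/-- half-disc structure near a non-vertex boundary point -/
lemma half_disc {p : Plane} {i : ZMod P.n} (hp : p ∈ P.edge i) (hv : ∀ k, p ≠ P.vertex k) :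
    ∃ σ : ℝ, σ ≠ 0 ∧ (∀ᶠ z in nhds p, z ∈ P.carrier ↔
      0 ≤ σ * crs (P.vertex (i + 1) - P.vertex i) (z - p)) ∧
      (∀ᶠ z in nhds p, z ∈ interior P.carrier ↔
      0 < σ * crs (P.vertex (i + 1) - P.vertex i) (z - p)) := by
  obtain ⟨r, r0, hr⟩ := Metric.eventually_nhds_iff_ball.1 (P.frontier_near hp hv)
  obtain ⟨c1, c2, hun⟩ := P.line_split p _ hr
  set e := P.vertex (i + 1) - P.vertex i
  have hb : ∀ᶠ z in nhds p, z ∈ ball p r := ball_mem_nhds p r0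
  rcases P.two_side (P.edge_subset_frontier i hp) r0 c1 c2 hun with ⟨h1, h2⟩ | ⟨h1, h2⟩
  · refine ⟨1, one_ne_zero, ?_, ?_⟩
    · filter_upwards [hb] with z hz
      have a2 := Set.ext_iff.1 h2 z
      simp only [mem_inter_iff, hz, true_and, mem_compl_iff, mem_ofPred_eq] at a2
      rw [one_mul, ← not_lt, ← a2, not_not]
    · filter_upwards [hb] with z hz
      have a2 := Set.ext_iff.1 h1 z
      simp only [mem_inter_iff, hz, true_and, mem_ofPred_eq] at a2
      rw [one_mul, a2]
  · refine ⟨-1, by norm_num, ?_, ?_⟩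
    · filter_upwards [hb] with z hz
      have a2 := Set.ext_iff.1 h2 z
      simp only [mem_inter_iff, hz, true_and, mem_compl_iff, mem_ofPred_eq] at a2
      rw [neg_one_mul, Left.nonneg_neg_iff, ← not_lt, ← a2, not_not]
    · filter_upwards [hb] with z hz
      have a2 := Set.ext_iff.1 h1 z
      simp only [mem_inter_iff, hz, true_and, mem_ofPred_eq] at a2
      rw [neg_one_mul, neg_pos, a2]

end SimplePolygon


/-- open triangle with apex `b` and sides `e₁, e₂` -/
def otri (b e₁ e₂ : Plane) : Set Plane :=
  {z | 0 < cX b e₁ e₂ z ∧ 0 < cY b e₁ e₂ z ∧ cX b e₁ e₂ z + cY b e₁ e₂ z < 1}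

lemma isOpen_otri (b e₁ e₂ : Plane) : IsOpen (otri b e₁ e₂) := by
  exact (isOpen_lt continuous_const (cX_continuous b e₁ e₂)).inter
    ((isOpen_lt continuous_const (cY_continuous b e₁ e₂)).inter
      (isOpen_lt ((cX_continuous b e₁ e₂).add (cY_continuous b e₁ e₂)) continuous_const))

lemma convex_otri (b e₁ e₂ : Plane) : Convex ℝ (otri b e₁ e₂) := by
  have h3 : AffLike (fun z => 1 - cX b e₁ e₂ z - cY b e₁ e₂ z) := by
    intro p q s
    simp only [cX_line, cY_line]; ring
  have := ((affLike_cX b e₁ e₂).convex_pos).inter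
    (((affLike_cY b e₁ e₂).convex_pos).inter h3.convex_pos)
  convert this using 1
  ext z
  simp only [otri, mem_inter_iff, mem_ofPred_eq]
  constructor
  · rintro ⟨a, b, c⟩; exact ⟨a, b, by linarith⟩
  · rintro ⟨a, b, c⟩; exact ⟨a, b, by linarith⟩

lemma closure_otri_subset (b e₁ e₂ : Plane) : closure (otri b e₁ e₂) ⊆
    {z | 0 ≤ cX b e₁ e₂ z ∧ 0 ≤ cY b e₁ e₂ z ∧ cX b e₁ e₂ z + cY b e₁ e₂ z ≤ 1} := by
  refine closure_minimal ?_ ?_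
  · rintro z ⟨a, b, c⟩; exact ⟨a.le, b.le, c.le⟩
  · exact (isClosed_le continuous_const (cX_continuous b e₁ e₂)).inter
      ((isClosed_le continuous_const (cY_continuous b e₁ e₂)).inter
        (isClosed_le ((cX_continuous b e₁ e₂).add (cY_continuous b e₁ e₂)) continuous_const))

/-- points of the closed triangle are limits of points of the open one -/
lemma mem_closure_otri {b e₁ e₂ : Plane} (hD : crs e₁ e₂ ≠ 0) {z : Plane}
    (hx : 0 ≤ cX b e₁ e₂ z) (hy : 0 ≤ cY b e₁ e₂ z) (hs : cX b e₁ e₂ z + cY b e₁ e₂ z ≤ 1) :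
    z ∈ closure (otri b e₁ e₂) := by
  set c := b + (1/3 : ℝ) • e₁ + (1/3 : ℝ) • e₂ with hc
  have cx : cX b e₁ e₂ c = 1/3 := cX_mk hD _ _
  have cy : cY b e₁ e₂ c = 1/3 := cY_mk hD _ _
  have ht : Filter.Tendsto (fun s : ℝ => z + s • (c - z)) (nhdsWithin 0 (Ioi 0)) (nhds z) := by
    have : Continuous (fun s : ℝ => z + s • (c - z)) := by fun_prop
    have := this.tendsto 0
    simp only [zero_smul, add_zero] at this
    exact this.mono_left nhdsWithin_le_nhds
  refine mem_closure_of_tendsto ht ?_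
  filter_upwards [Ioo_mem_nhdsGT (show (0:ℝ) < 1 by norm_num)] with s hs'
  obtain ⟨s0, s1⟩ := hs'
  refine ⟨?_, ?_, ?_⟩
  · rw [cX_line, cx]; nlinarith
  · rw [cY_line, cy]; nlinarith
  · rw [cX_line, cY_line, cx, cy]; nlinarith

/-- a small nonnegative step along a direction is eventually near -/
lemma eventually_step (p d : Plane) {Q : Plane → Prop} (h : ∀ᶠ z in nhds p, Q z) :
    ∃ ε : ℝ, 0 < ε ∧ ε < 1 ∧ ∀ t : ℝ, |t| ≤ ε → Q (p + t • d) := by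
  have hc : Continuous (fun s : ℝ => p + s • d) := by fun_prop
  have := hc.tendsto 0
  simp only [zero_smul, add_zero] at this
  obtain ⟨ε, e0, he⟩ := Metric.eventually_nhds_iff_ball.1 (this.eventually h)
  refine ⟨min (ε / 2) (1/2), by positivity, by
    have := min_le_right (ε/2) (1/2 : ℝ); linarith, fun t ht => he t ?_⟩
  have := min_le_left (ε/2) (1/2 : ℝ)
  rw [mem_ball, Real.dist_eq, sub_zero]; linarith

namespace SimplePolygon
variable (P : SimplePolygon)

/-- a direction pointing (weakly) into `P` at a half-disc point -/
lemma dir_nonneg {p d : Plane} {i : ZMod P.n} {σ : ℝ}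
    (h : ∀ᶠ z in nhds p, z ∈ P.carrier ↔
      0 ≤ σ * crs (P.vertex (i + 1) - P.vertex i) (z - p))
    {c : ℝ} (hc : 0 < c) (hd : ∀ t : ℝ, 0 ≤ t → t ≤ c → p + t • d ∈ P.carrier) :
    0 ≤ σ * crs (P.vertex (i + 1) - P.vertex i) d := by
  obtain ⟨ε, e0, -, he⟩ := eventually_step p d h
  have hm : 0 < min ε c := lt_min e0 hc
  have := (he (min ε c) (by rw [abs_of_pos hm]; exact min_le_left _ _)).1
    (hd _ hm.le (min_le_right _ _))
  rw [add_sub_cancel_left, crs_smul_right] at this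
  by_contra! hcon
  nlinarith

/-- No vertex in a triangle (apart from the side `[a,c]`), the other two sides in `P`:
then the third side is in `P`. -/
lemma triangle_lemma {b e₁ e₂ : Plane} (hD : crs e₁ e₂ ≠ 0)
    (h1 : ∀ t : ℝ, 0 ≤ t → t ≤ 1 → b + t • e₁ ∈ P.carrier)
    (h2 : ∀ t : ℝ, 0 ≤ t → t ≤ 1 → b + t • e₂ ∈ P.carrier)
    (hv : ∀ k, ∀ x y : ℝ, 0 ≤ x → 0 ≤ y → x + y < 1 → P.vertex k ≠ b + x • e₁ + y • e₂) :
    closure (otri b e₁ e₂) ⊆ P.carrier := by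
  set X := cX b e₁ e₂ with hX
  set Y := cY b e₁ e₂ with hY
  have hv' : ∀ z, 0 ≤ X z → 0 ≤ Y z → X z + Y z < 1 → ∀ k, z ≠ P.vertex k := by
    intro z hx hy hs k hz
    exact hv k _ _ hx hy hs (by rw [← hz]; exact eq_coords hD z)
  have hbv : ∀ k, b ≠ P.vertex k := fun k h => hv k 0 0 le_rfl le_rfl (by norm_num) (by simp [h])
  have hzero : ∀ (i : ZMod P.n) (σ : ℝ), σ ≠ 0 →
      σ * crs (P.vertex (i + 1) - P.vertex i) e₁ = 0 →
      σ * crs (P.vertex (i + 1) - P.vertex i) e₂ = 0 → False := by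
    intro i σ hσ ha hb
    have ha' := (mul_eq_zero.1 ha).resolve_left hσ
    have hb' := (mul_eq_zero.1 hb).resolve_left hσ
    obtain ⟨k1, hk1⟩ := exists_smul_of_crs_eq_zero (sub_ne_zero.2 (P.vertex_ne i).symm) ha'
    rw [hk1, crs_smul_left] at hD
    exact hD (by rw [hb', mul_zero])
  -- the frontier does not meet the open triangle
  have hfr : ∀ q ∈ otri b e₁ e₂, q ∉ frontier P.carrier := by
    intro q hq hqf
    obtain ⟨i, hi⟩ := P.mem_frontier.1 hqf
    have hq' := hq
    obtain ⟨qx, qy, qs⟩ := hq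
    have hqv := hv' q qx.le qy.le qs
    have key : ∀ u : Plane, (∃ k, u = P.vertex k) →
        (u = P.vertex i ∨ u = P.vertex (i + 1)) → ∃ s : ℝ, 0 < s ∧
        X (q + s • (u - q)) + Y (q + s • (u - q)) = 1 := by
      rintro u ⟨k, hk⟩ hu
      have huO : u ∉ otri b e₁ e₂ := fun h => hv' u h.1.le h.2.1.le h.2.2 k hk
      obtain ⟨s, s0, s1, hs⟩ := exit_point (isOpen_otri _ _ _) hq' huO
      refine ⟨s, s0, ?_⟩
      have hcl := closure_otri_subset _ _ _ hs.1
      have hnO : q + s • (u - q) ∉ otri b e₁ e₂ := by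
        have := hs.2; rwa [(isOpen_otri _ _ _).interior_eq] at this
      set z := q + s • (u - q) with hz
      obtain ⟨zx, zy, zs⟩ := hcl
      change 0 ≤ X z at zx
      change 0 ≤ Y z at zy
      change X z + Y z ≤ 1 at zs
      by_contra hne
      have zs' : X z + Y z < 1 := lt_of_le_of_ne zs hne
      have hzv := hv' z zx zy zs'
      have hui : u ∈ P.edge i := by
        rcases hu with h | h
        · rw [h]; exact P.left_mem_edge i
        · rw [h]; exact P.right_mem_edge i
      have hze : z ∈ P.edge i := by
        have : segment ℝ q u ⊆ P.edge i := (convex_segment _ _).segment_subset hi hui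
        exact this (mem_seg_iff.2 ⟨s, s0.le, s1, rfl⟩)
      obtain ⟨σ, hσ, hd, -⟩ := P.half_disc hze hzv
      set e := P.vertex (i + 1) - P.vertex i with he
      -- the edge direction
      have hqz : crs e (q - z) = 0 := by
        obtain ⟨t, _, _, ht⟩ := mem_seg_iff.1 hi
        obtain ⟨t', _, _, ht'⟩ := mem_seg_iff.1 hze
        have : q - z = (t - t') • e := by rw [ht, ht', he, sub_smul]; abel
        rw [this, crs_smul_right, crs_self, mul_zero]
      have hcq : q - z = (X q - X z) • e₁ + (Y q - Y z) • e₂ := by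
        have a1 := eq_coords (b := b) hD q
        have a2 := eq_coords (b := b) hD z
        conv_lhs => rw [a1, a2]
        simp only [sub_smul, hX, hY]; abel
      rw [hcq, crs_add_right, crs_smul_right, crs_smul_right] at hqz
      have hzc := eq_coords (b := b) hD z
      change z = b + X z • e₁ + Y z • e₂ at hzc
      have hor : X z = 0 ∨ Y z = 0 := by
        by_contra! hh
        exact hnO ⟨lt_of_le_of_ne zx hh.1.symm, lt_of_le_of_ne zy hh.2.symm, zs'⟩
      by_cases hX0 : X z = 0
      · by_cases hY0 : Y z = 0
        · -- z = b
          have hzb : z = b := by rw [hzc, hX0, hY0]; simp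
          have n1 := P.dir_nonneg (d := e₁) hd one_pos (by rw [hzb]; exact h1)
          have n2 := P.dir_nonneg (d := e₂) hd one_pos (by rw [hzb]; exact h2)
          rw [hX0, hY0, sub_zero, sub_zero] at hqz
          change 0 < X q at qx
          change 0 < Y q at qy
          have hsum : X q * (σ * crs e e₁) + Y q * (σ * crs e e₂) = 0 := by
            linear_combination σ * hqz
          have m1 := mul_nonneg qx.le n1
          have m2 := mul_nonneg qy.le n2
          refine hzero i σ hσ ?_ ?_
          · have : X q * (σ * crs e e₁) = 0 := by linarith
            exact (mul_eq_zero.1 this).resolve_left qx.ne'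
          · have : Y q * (σ * crs e e₂) = 0 := by linarith
            exact (mul_eq_zero.1 this).resolve_left qy.ne'
        · -- z on the side e₂
          have yp : 0 < Y z := lt_of_le_of_ne zy (Ne.symm hY0)
          have hzb : z = b + Y z • e₂ := by conv_lhs => rw [hzc, hX0]; simp
          have y1 : Y z < 1 := by linarith
          have n1 := P.dir_nonneg (d := e₂) hd (c := 1 - Y z) (by linarith) (by
            intro t t0 t1
            have : z + t • e₂ = b + (Y z + t) • e₂ := by
              conv_lhs => rw [hzb]
              rw [add_smul, add_assoc]
            rw [this]; exact h2 _ (by linarith) (by linarith))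
          have n2 := P.dir_nonneg (d := -e₂) hd (c := Y z) yp (by
            intro t t0 t1
            have : z + t • -e₂ = b + (Y z - t) • e₂ := by
              conv_lhs => rw [hzb]
              rw [sub_smul, smul_neg]; abel
            rw [this]; exact h2 _ (by linarith) (by linarith))
          rw [← neg_one_smul ℝ e₂, crs_smul_right] at n2
          have n0 : σ * crs e e₂ = 0 := by linarith
          have n0' := (mul_eq_zero.1 n0).resolve_left hσ
          rw [n0', mul_zero, add_zero, hX0, sub_zero] at hqz
          have := (mul_eq_zero.1 hqz).resolve_left (ne_of_gt qx)
          exact hzero i σ hσ (by rw [this, mul_zero]) n0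
      · have hY0 : Y z = 0 := hor.resolve_left hX0
        have xp : 0 < X z := lt_of_le_of_ne zx (Ne.symm hX0)
        have hzb : z = b + X z • e₁ := by conv_lhs => rw [hzc, hY0]; simp
        have y1 : X z < 1 := by linarith
        have n1 := P.dir_nonneg (d := e₁) hd (c := 1 - X z) (by linarith) (by
          intro t t0 t1
          have : z + t • e₁ = b + (X z + t) • e₁ := by
            conv_lhs => rw [hzb]
            rw [add_smul, add_assoc]
          rw [this]; exact h1 _ (by linarith) (by linarith))
        have n2 := P.dir_nonneg (d := -e₁) hd (c := X z) xp (by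
          intro t t0 t1
          have : z + t • -e₁ = b + (X z - t) • e₁ := by
            conv_lhs => rw [hzb]
            rw [sub_smul, smul_neg]; abel
          rw [this]; exact h1 _ (by linarith) (by linarith))
        rw [← neg_one_smul ℝ e₁, crs_smul_right] at n2
        have n0 : σ * crs e e₁ = 0 := by linarith
        have n0' := (mul_eq_zero.1 n0).resolve_left hσ
        rw [n0', mul_zero, zero_add, hY0, sub_zero] at hqz
        have := (mul_eq_zero.1 hqz).resolve_left (ne_of_gt qy)
        exact hzero i σ hσ n0 (by rw [this, mul_zero])
    obtain ⟨s, s0, hs⟩ := key _ ⟨i, rfl⟩ (Or.inl rfl)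
    obtain ⟨s', s0', hs'⟩ := key _ ⟨i + 1, rfl⟩ (Or.inr rfl)
    obtain ⟨t, t0, t1, ht⟩ := mem_seg_iff.1 hi
    have hXq := cX_line b e₁ e₂ (P.vertex i) (P.vertex (i + 1)) t
    have hYq := cY_line b e₁ e₂ (P.vertex i) (P.vertex (i + 1)) t
    rw [← ht] at hXq hYq
    rw [hX, hY, cX_line, cY_line] at hs hs'
    generalize cX b e₁ e₂ (P.vertex i) = xu at *
    generalize cX b e₁ e₂ (P.vertex (i + 1)) = xw at *
    generalize cY b e₁ e₂ (P.vertex i) = yu at *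
    generalize cY b e₁ e₂ (P.vertex (i + 1)) = yw at *
    change X q + Y q < 1 at qs
    have hA : s * ((xu + yu) - (X q + Y q)) = 1 - (X q + Y q) := by linear_combination hs
    have hB : s' * ((xw + yw) - (X q + Y q)) = 1 - (X q + Y q) := by linear_combination hs'
    have hA' : 0 < (xu + yu) - (X q + Y q) := by
      by_contra! hh; nlinarith
    have hB' : 0 < (xw + yw) - (X q + Y q) := by
      by_contra! hh; nlinarith
    have hC : (1 - t) * ((xu + yu) - (X q + Y q)) + t * ((xw + yw) - (X q + Y q)) = 0 := by
      linear_combination - hXq - hYq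
    have m1 := mul_nonneg (sub_nonneg.2 t1) hA'.le
    have m2 := mul_nonneg t0 hB'.le
    have z1 : (1 - t) = 0 := by
      have : (1 - t) * ((xu + yu) - (X q + Y q)) = 0 := by linarith
      exact (mul_eq_zero.1 this).resolve_right hA'.ne'
    have z2 : t = 0 := by
      have : t * ((xw + yw) - (X q + Y q)) = 0 := by linarith
      exact (mul_eq_zero.1 this).resolve_right hB'.ne'
    linarith
  -- the open triangle meets P near b
  have hbP : b ∈ P.carrier := by simpa using h1 0 le_rfl zero_le_one
  have hmeet : ∃ z ∈ otri b e₁ e₂, z ∈ P.carrier := by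
    have hev : ∃ ε : ℝ, 0 < ε ∧ ε < 1 ∧ ∀ t : ℝ, |t| ≤ ε → 0 ≤ t →
        b + t • (e₁ + e₂) ∈ P.carrier := by
      by_cases hbi : b ∈ interior P.carrier
      · obtain ⟨ε, e0, e1, he⟩ := eventually_step b (e₁ + e₂) (mem_interior_iff_mem_nhds.1 hbi)
        exact ⟨ε, e0, e1, fun t ht _ => he t ht⟩
      · have hbf : b ∈ frontier P.carrier := ⟨subset_closure hbP, hbi⟩
        obtain ⟨i, hi⟩ := P.mem_frontier.1 hbf
        obtain ⟨σ, hσ, hd, -⟩ := P.half_disc hi hbv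
        have n1 := P.dir_nonneg (d := e₁) hd one_pos h1
        have n2 := P.dir_nonneg (d := e₂) hd one_pos h2
        obtain ⟨ε, e0, e1, he⟩ := eventually_step b (e₁ + e₂) hd
        refine ⟨ε, e0, e1, fun t ht t0 => (he t ht).2 ?_⟩
        rw [add_sub_cancel_left, crs_smul_right, crs_add_right]
        have := mul_nonneg t0 (add_nonneg n1 n2)
        linarith
    obtain ⟨ε, e0, e1, he⟩ := hev
    refine ⟨_, ?_, he (ε / 2) (by rw [abs_of_pos] <;> linarith) (by linarith)⟩
    have hform : b + (ε / 2) • (e₁ + e₂) = b + (ε / 2) • e₁ + (ε / 2) • e₂ := by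
      rw [smul_add, add_assoc]
    rw [hform]
    refine ⟨?_, ?_, ?_⟩
    · rw [cX_mk hD]; linarith
    · rw [cY_mk hD]; linarith
    · rw [cX_mk hD, cY_mk hD]; linarith
  obtain ⟨z, hz, hzP⟩ := hmeet
  exact closure_minimal ((preconn_subset_interior (convex_otri _ _ _).isPreconnected hfr hz
    hzP).trans interior_subset) P.isClosed

end SimplePolygon


lemma edist_seg {a w y : Plane} (h : w ∈ segment ℝ a y) : edist a w + edist w y = edist a y := by
  rw [edist_dist, edist_dist, edist_dist, ← ENNReal.ofReal_add dist_nonneg dist_nonneg,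
    dist_add_dist_of_mem_segment h]

lemma vertex_far {a y v : Plane} (hv : v ∉ segment ℝ a y) :
    ∀ᶠ z in nhds y, ∀ x t : ℝ, 0 ≤ x → 0 ≤ t → x + t < 1 → v ≠ y + x • (a - y) + t • (z - y) := by
  obtain ⟨r, r0, hr⟩ := Metric.isOpen_iff.1 (isClosed_seg a y).isOpen_compl v hv
  filter_upwards [ball_mem_nhds y r0] with z hz x t x0 t0 hxt heq
  have h1 : y + x • (a - y) ∈ segment ℝ a y := by
    rw [segment_symm]; exact mem_seg_iff.2 ⟨x, x0, by linarith, rfl⟩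
  refine hr ?_ h1
  rw [mem_ball, dist_eq_norm] at *
  have : y + x • (a - y) - v = -(t • (z - y)) := by rw [heq]; abel
  rw [this, norm_neg, norm_smul, Real.norm_eq_abs, abs_of_nonneg t0]
  nlinarith [norm_nonneg (z - y)]

namespace SimplePolygon
variable (P : SimplePolygon)

lemma no_mid (hsep : ∀ i j : ZMod P.n, i ≠ j →
      1 ≤ geodesicDist P.carrier (P.vertex i) (P.vertex j)) {i j k : ZMod P.n}
    (hki : k ≠ i) (hkj : k ≠ j) {A B : ℝ≥0∞}
    (hA : geodesicDist P.carrier (P.vertex i) (P.vertex k) ≤ A)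
    (hB : geodesicDist P.carrier (P.vertex k) (P.vertex j) ≤ B) (h : A + B < 2) : False := by
  have h1 := (hsep i k hki.symm).trans hA
  have h2 := (hsep k j hkj).trans hB
  have := add_le_add h1 h2
  rw [one_add_one_eq_two] at this
  exact absurd h (not_lt.2 this)

lemma chord (hsep : ∀ i j : ZMod P.n, i ≠ j →
      1 ≤ geodesicDist P.carrier (P.vertex i) (P.vertex j)) {i j : ZMod P.n}
    (hd : geodesicDist P.carrier (P.vertex i) (P.vertex j) < 2) :
    segment ℝ (P.vertex i) (P.vertex j) ⊆ P.carrier := by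
  have := P.fin
  by_contra hcon
  obtain ⟨γ, hγ, g0, g1, hm, hL⟩ := geo_lt_iff.1 hd
  set a := P.vertex i with ha
  set S : Set ℝ := {t | ∀ s ∈ Icc (0:ℝ) 1, a + s • (γ t - a) ∈ P.carrier} with hS
  have hSiff : ∀ t, t ∈ S ↔ segment ℝ a (γ t) ⊆ P.carrier := by
    intro t
    constructor
    · intro h z hz
      obtain ⟨s, s0, s1, rfl⟩ := mem_seg_iff.1 hz
      exact h s ⟨s0, s1⟩
    · intro h s hs
      exact h (mem_seg_iff.2 ⟨s, hs.1, hs.2, rfl⟩)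
  have hclosed : IsClosed (S ∩ Icc 0 1) := by
    have : S ∩ Icc 0 1 = ⋂ s ∈ Icc (0:ℝ) 1,
        (Icc (0:ℝ) 1 ∩ (fun t => a + s • (γ t - a)) ⁻¹' P.carrier) := by
      ext t
      simp only [hS, mem_inter_iff, mem_iInter, mem_preimage, mem_ofPred_eq]
      constructor
      · rintro ⟨h1, h2⟩ s hs; exact ⟨h2, h1 s hs⟩
      · intro h; exact ⟨fun s hs => (h s hs).2, (h 0 (by simp)).1⟩
    rw [this]
    refine isClosed_biInter fun s _ => ?_
    refine ContinuousOn.preimage_isClosed_of_isClosed ?_ isClosed_Icc P.isClosed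
    exact continuousOn_const.add ((hγ.sub continuousOn_const).const_smul s)
  have h0 : (0:ℝ) ∈ S := by
    intro s _
    rw [g0]; simp only [sub_self, smul_zero, add_zero]
    exact P.edge_subset i (P.left_mem_edge i)
  have hmain : Icc (0:ℝ) 1 ⊆ S := by
    refine hclosed.Icc_subset_of_forall_exists_gt h0 ?_
    rintro t0 ⟨ht0S, ht0, ht1⟩ t' ht'
    set y := γ t0 with hy
    have hyS := (hSiff t0).1 ht0S
    have hyP : y ∈ P.carrier := hm ⟨ht0, ht1.le⟩
    -- no vertices on [a,y] other than a
    have hnov : ∀ k, P.vertex k ∈ segment ℝ a y → k = i := by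
      intro k hk
      by_contra hki
      by_cases hkj : k = j
      · subst hkj
        exact hcon (((convex_segment a y).segment_subset (left_mem_segment ℝ _ _) hk).trans hyS)
      have e1 : geodesicDist P.carrier a (P.vertex k) ≤ edist a (P.vertex k) :=
        geo_le_edist (((convex_segment a y).segment_subset (left_mem_segment ℝ _ _) hk).trans hyS)
      have e2 : geodesicDist P.carrier (P.vertex k) y ≤ edist (P.vertex k) y :=
        geo_le_edist (((convex_segment a y).segment_subset hk (right_mem_segment ℝ _ _)).trans hyS)
      have e3 : geodesicDist P.carrier y (P.vertex j) ≤ eVariationOn γ (Icc t0 1) := by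
        rw [← g1]
        exact geo_le_path ht1.le (hγ.mono (Icc_subset_Icc_left ht0))
          (hm.mono_left (Icc_subset_Icc_left ht0))
      have e4 : edist a y ≤ eVariationOn γ (Icc 0 t0) := by
        rw [← g0]; exact eVariationOn.edist_le γ (by simp [ht0]) (by simp [ht0])
      refine P.no_mid hsep hki hkj e1 ((geo_triangle _ y _).trans (add_le_add e2 e3)) ?_
      rw [← add_assoc, edist_seg hk]
      refine lt_of_le_of_lt (add_le_add_left e4 _) ?_
      have := eVariationOn.Icc_add_Icc γ (s := univ) ht0 ht1.le (mem_univ _)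
      simp only [univ_inter] at this
      rwa [this]
    have hev : ∀ᶠ z in nhds y, z ∈ P.carrier → segment ℝ a z ⊆ P.carrier := by
      have hfar : ∀ᶠ z in nhds y, ∀ k, k ≠ i → ∀ x t : ℝ, 0 ≤ x → 0 ≤ t → x + t < 1 →
          P.vertex k ≠ y + x • (a - y) + t • (z - y) := by
        rw [Filter.eventually_all]
        intro k
        by_cases hk : k = i
        · exact Filter.Eventually.of_forall fun _ h => absurd hk h
        · filter_upwards [vertex_far (a := a) (y := y) (v := P.vertex k)
            (fun h => hk (hnov k h))] with z hz _ using hz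
      filter_upwards [hfar, P.local_star hyP] with z hz hst hzP
      have hyz := hst hzP
      by_cases hD : crs (a - y) (z - y) = 0
      · by_cases hay : a = y
        · rw [hay]; exact hyz
        obtain ⟨t, ht⟩ := exists_smul_of_crs_eq_zero (sub_ne_zero.2 hay) hD
        have hz' : z = y + t • (a - y) := by rw [← ht]; abel
        intro q hq
        obtain ⟨s, s0, s1, hqs⟩ := mem_seg_iff.1 hq
        have hq' : q = y + (1 - s + s * t) • (a - y) := by
          rw [hqs, hz']
          apply plane_ext <;> simp <;> ring
        by_cases hc : 0 ≤ 1 - s + s * t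
        · by_cases hc1 : 1 - s + s * t ≤ 1
          · refine hyS ?_
            rw [segment_symm]; exact mem_seg_iff.2 ⟨_, hc, hc1, hq'⟩
          · have hst1 : s < s * t := by linarith
            have spos : 0 < s := by
              rcases s0.eq_or_lt with h | h
              · rw [← h] at hst1; simp at hst1
              · exact h
            have t1 : 1 < t := by nlinarith
            refine hyz (mem_seg_iff.2 ⟨(1 - s + s * t) / t, by positivity, ?_, ?_⟩)
            · rw [div_le_one (by linarith)]; nlinarith
            · rw [ht, smul_smul, div_mul_cancel₀ _ (by linarith)]; exact hq'
        · push Not at hc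
          have tneg : t < 0 := by
            by_contra! h
            have := mul_nonneg s0 h
            linarith
          refine hyz (mem_seg_iff.2 ⟨(1 - s + s * t) / t, ?_, ?_, ?_⟩)
          · exact div_nonneg_of_nonpos hc.le tneg.le
          · rw [div_le_one_of_neg tneg]; nlinarith
          · rw [ht, smul_smul, div_mul_cancel₀ _ tneg.ne]; exact hq'
      · have hsub := P.triangle_lemma (b := y) hD (by
          intro t t0 t1
          refine hyS ?_
          rw [segment_symm]; exact mem_seg_iff.2 ⟨t, t0, t1, rfl⟩) (by
          intro t t0 t1
          exact hyz (mem_seg_iff.2 ⟨t, t0, t1, rfl⟩)) (by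
          intro k x t x0 t0 hxt heq
          by_cases hk : k = i
          · subst hk
            have hX := cX_mk (b := y) hD x t
            rw [← heq] at hX
            have hX1 := cX_mk (b := y) hD 1 0
            have : y + (1:ℝ) • (a - y) + (0:ℝ) • (z - y) = a := by simp
            rw [this] at hX1
            have : x = 1 := hX.symm.trans hX1
            linarith
          · exact hz k hk x t x0 t0 hxt heq)
        intro q hq
        obtain ⟨s, s0, s1, hqs⟩ := mem_seg_iff.1 hq
        have hq' : q = y + (1 - s) • (a - y) + s • (z - y) := by
          rw [hqs]; apply plane_ext <;> simp <;> ring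
        refine hsub (mem_closure_otri hD ?_ ?_ ?_)
        · rw [hq', cX_mk hD]; linarith
        · rw [hq', cY_mk hD]; linarith
        · rw [hq', cX_mk hD, cY_mk hD]; linarith
    have hcont : Filter.Tendsto γ (nhdsWithin t0 (Icc 0 1)) (nhds y) := hγ t0 ⟨ht0, ht1.le⟩
    have hcont' : Filter.Tendsto γ (nhdsWithin t0 (Ioi t0)) (nhds y) := by
      refine hcont.mono_left ?_
      rw [← nhdsWithin_Ioo_eq_nhdsGT ht1]
      exact nhdsWithin_mono _ fun x hx => ⟨ht0.trans hx.1.le, hx.2.le⟩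
    have hmin : t0 < min 1 t' := lt_min ht1 ht'
    obtain ⟨t, htS, htI⟩ := ((hcont'.eventually hev).and
      (Ioc_mem_nhdsGT hmin)).exists
    refine ⟨t, (hSiff t).2 (htS (hm ⟨ht0.trans htI.1.le, htI.2.trans (min_le_left _ _)⟩)),
      htI.1, htI.2.trans (min_le_right _ _)⟩
  have := (hSiff 1).1 (hmain (by simp))
  rw [g1] at this
  exact hcon this

lemma chord_no_vertex (hsep : ∀ i j : ZMod P.n, i ≠ j →
      1 ≤ geodesicDist P.carrier (P.vertex i) (P.vertex j)) {i j : ZMod P.n}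
    (hd : geodesicDist P.carrier (P.vertex i) (P.vertex j) < 2) {k : ZMod P.n}
    (hk : P.vertex k ∈ segment ℝ (P.vertex i) (P.vertex j)) : k = i ∨ k = j := by
  by_contra! hc
  have hs := P.chord hsep hd
  have e1 := geo_le_edist (((convex_segment _ _).segment_subset (left_mem_segment ℝ _ _) hk).trans hs)
  have e2 := geo_le_edist (((convex_segment _ _).segment_subset hk (right_mem_segment ℝ _ _)).trans hs)
  refine P.no_mid hsep hc.1 hc.2 e1 e2 ?_
  rw [edist_seg hk]
  exact lt_of_le_of_lt edist_le_geo hd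

/-- L5 -/
lemma chord_interior {i j : ZMod P.n} (hs : segment ℝ (P.vertex i) (P.vertex j) ⊆ P.carrier)
    (hv : ∀ k, P.vertex k ∈ segment ℝ (P.vertex i) (P.vertex j) → k = i ∨ k = j)
    (hij : i ≠ j) (h1 : i + 1 ≠ j) (h2 : j + 1 ≠ i) {t : ℝ} (t0 : 0 < t) (t1 : t < 1) :
    P.vertex i + t • (P.vertex j - P.vertex i) ∈ interior P.carrier := by
  set A := P.vertex i with hA
  set B := P.vertex j with hB
  set q := A + t • (B - A) with hq
  have hqs : q ∈ segment ℝ A B := mem_seg_iff.2 ⟨t, t0.le, t1.le, rfl⟩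
  have hAB : B - A ≠ 0 := sub_ne_zero.2 fun h => hij (P.vertex_injective h.symm)
  by_contra hqi
  have hqf : q ∈ frontier P.carrier := ⟨subset_closure (hs hqs), hqi⟩
  obtain ⟨m, hm⟩ := P.mem_frontier.1 hqf
  have hqv : ∀ k, q ≠ P.vertex k := by
    intro k hk
    rcases hv k (hk ▸ hqs) with h | h
    · subst h
      have : t • (B - A) = 0 := by
        have : t • (B - A) = q - A := by rw [hq]; abel
        rw [this, hk, hA, sub_self]
      exact (smul_ne_zero t0.ne' hAB) this
    · subst h
      have : (1 - t) • (B - A) = 0 := by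
        have : (1 - t) • (B - A) = B - q := by rw [hq, sub_smul, one_smul]; abel
        rw [this, hk, hB, sub_self]
      exact (smul_ne_zero (by linarith) hAB) this
  obtain ⟨σ, hσ, hd, -⟩ := P.half_disc hm hqv
  have n1 := P.dir_nonneg (d := B - A) hd (c := 1 - t) (by linarith) (by
    intro s s0 s1
    refine hs (mem_seg_iff.2 ⟨t + s, by linarith, by linarith, ?_⟩)
    rw [hq, add_smul]; abel)
  have n2 := P.dir_nonneg (d := -(B - A)) hd (c := t) t0 (by
    intro s s0 s1
    refine hs (mem_seg_iff.2 ⟨t - s, by linarith, by linarith, ?_⟩)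
    rw [hq, sub_smul, smul_neg]; abel)
  rw [← neg_one_smul ℝ (B - A), crs_smul_right] at n2
  have n0 : σ * crs (P.vertex (m + 1) - P.vertex m) (B - A) = 0 := by linarith
  have n0' := (mul_eq_zero.1 n0).resolve_left hσ
  have hne : P.vertex (m + 1) - P.vertex m ≠ 0 := sub_ne_zero.2 (P.vertex_ne m).symm
  obtain ⟨κ, hκ⟩ := exists_smul_of_crs_eq_zero hne n0'
  obtain ⟨s, s0, s1, hs'⟩ := mem_seg_iff.1 hm
  have hκ0 : κ ≠ 0 := by rintro rfl; rw [zero_smul] at hκ; exact hAB hκ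
  set u := P.vertex m with hu
  set w := P.vertex (m + 1) with hw
  -- endpoints of the edge on the line through A, B ; parameters
  have hu' : u = A + (t - s / κ) • (B - A) := by
    have : (s / κ) • (B - A) = s • (w - u) := by rw [hκ, smul_smul, div_mul_cancel₀ _ hκ0]
    rw [sub_smul, this]
    have : s • (w - u) = q - u := by rw [hs']; abel
    rw [this, hq]; abel
  have hw' : w = A + (t + (1 - s) / κ) • (B - A) := by
    have : ((1 - s) / κ) • (B - A) = (1 - s) • (w - u) := by
      rw [hκ, smul_smul, div_mul_cancel₀ _ hκ0]
    rw [add_smul, this]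
    have : (1 - s) • (w - u) = w - q := by rw [hs', sub_smul, one_smul]; abel
    rw [this, hq]; abel
  have hs0 : 0 < s := s0.lt_of_ne fun h => hqv m (by rw [hs', ← h]; simp [hu])
  have hs1 : s < 1 := s1.lt_of_ne fun h => hqv (m + 1) (by rw [hs', h]; simp [hw])
  -- A and B are on the edge
  set α := t - s / κ with hα
  set β := t + (1 - s) / κ with hβ
  have hin : ∀ x y : ℝ, ∀ k k' : ZMod P.n, P.vertex k = A + x • (B - A) → 
      P.vertex k' = A + y • (B - A) → (x < t) → t < y → (x ≤ 0 ∨ x = 0) ∧ (1 ≤ y) := by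
    intro x y k k' hx hy hxt hty
    constructor
    · left
      by_contra! h
      rcases hv k (mem_seg_iff.2 ⟨x, h.le, by linarith, hx⟩) with h' | h'
      · subst h'
        have : x • (B - A) = 0 := by
          have : x • (B - A) = P.vertex k - A := by rw [hx]; abel
          rw [this, hA, sub_self]
        exact smul_ne_zero h.ne' hAB this
      · subst h'
        have : (1 - x) • (B - A) = 0 := by
          have : (1 - x) • (B - A) = B - P.vertex k := by rw [hx, sub_smul, one_smul]; abel
          rw [this, hB, sub_self]
        exact smul_ne_zero (by linarith) hAB this
    · by_contra! h
      rcases hv k' (mem_seg_iff.2 ⟨y, by linarith, h.le, hy⟩) with h' | h'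
      · subst h'
        have : y • (B - A) = 0 := by
          have : y • (B - A) = P.vertex k' - A := by rw [hy]; abel
          rw [this, hA, sub_self]
        exact smul_ne_zero (by linarith) hAB this
      · subst h'
        have : (1 - y) • (B - A) = 0 := by
          have : (1 - y) • (B - A) = B - P.vertex k' := by rw [hy, sub_smul, one_smul]; abel
          rw [this, hB, sub_self]
        exact smul_ne_zero (by linarith) hAB this
  -- a segment on the line containing parameters 0 and 1
  have hseg : ∀ x y : ℝ, x ≤ 0 → 1 ≤ y → ∀ c : ℝ, 0 ≤ c → c ≤ 1 →
      A + c • (B - A) ∈ segment ℝ (A + x • (B - A)) (A + y • (B - A)) := by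
    intro x y hx hy c c0 c1
    refine mem_seg_iff.2 ⟨(c - x) / (y - x), div_nonneg (by linarith) (by linarith), ?_, ?_⟩
    · rw [div_le_one (by linarith)]; linarith
    · have : A + y • (B - A) - (A + x • (B - A)) = (y - x) • (B - A) := by rw [sub_smul]; abel
      rw [this, smul_smul, div_mul_cancel₀ _ (by linarith : y - x ≠ 0), sub_smul]; abel
  have hboth : ∀ c : ℝ, 0 ≤ c → c ≤ 1 → A + c • (B - A) ∈ P.edge m := by
    intro c c0 c1
    rcases lt_or_gt_of_ne hκ0 with hk | hk
    · have a1 : t < α := by have := div_neg_of_pos_of_neg hs0 hk; linarith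
      have a2 : β < t := by have := div_neg_of_pos_of_neg (sub_pos.2 hs1) hk; linarith
      obtain ⟨b1, b2⟩ := hin β α (m + 1) m hw' hu' a2 a1
      have := hseg β α (by rcases b1 with h | h <;> linarith) b2 c c0 c1
      rw [← hw', ← hu', segment_symm] at this
      exact this
    · have a1 : α < t := by have := div_pos hs0 hk; linarith
      have a2 : t < β := by have := div_pos (sub_pos.2 hs1) hk; linarith
      obtain ⟨b1, b2⟩ := hin α β m (m + 1) hu' hw' a1 a2
      have := hseg α β (by rcases b1 with h | h <;> linarith) b2 c c0 c1
      rw [← hw', ← hu'] at this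
      exact this
  have hAe : P.vertex i ∈ P.edge m := by simpa using hboth 0 le_rfl zero_le_one
  have hBe : P.vertex j ∈ P.edge m := by simpa using hboth 1 zero_le_one le_rfl
  rcases P.vertex_mem_edge hAe with h | h <;> rcases P.vertex_mem_edge hBe with h' | h'
  · exact hij (h.trans h'.symm)
  · exact h1 (by rw [h, h'])
  · exact h2 (by rw [h, h'])
  · exact hij (h.trans h'.symm)

end SimplePolygon


/-- half-open and open segments -/
def sIoc (p q : Plane) : Set Plane := (fun s : ℝ => p + s • (q - p)) '' Ioc 0 1
def sIco (p q : Plane) : Set Plane := (fun s : ℝ => p + s • (q - p)) '' Ico 0 1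
def sIoo (p q : Plane) : Set Plane := (fun s : ℝ => p + s • (q - p)) '' Ioo 0 1

lemma sIoc_preconn (p q : Plane) : IsPreconnected (sIoc p q) :=
  isPreconnected_Ioc.image _ (by fun_prop)
lemma sIco_preconn (p q : Plane) : IsPreconnected (sIco p q) :=
  isPreconnected_Ico.image _ (by fun_prop)
lemma seg_preconn (p q : Plane) : IsPreconnected (segment ℝ p q) :=
  (convex_segment p q).isPreconnected
lemma sIoc_subset (p q : Plane) : sIoc p q ⊆ segment ℝ p q := by
  rintro _ ⟨s, hs, rfl⟩; exact mem_seg_iff.2 ⟨s, hs.1.le, hs.2, rfl⟩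
lemma sIco_subset (p q : Plane) : sIco p q ⊆ segment ℝ p q := by
  rintro _ ⟨s, hs, rfl⟩; exact mem_seg_iff.2 ⟨s, hs.1, hs.2.le, rfl⟩
lemma sIoc_ne {p q z : Plane} (hpq : p ≠ q) (hz : z ∈ sIoc p q) : z ≠ p := by
  obtain ⟨s, hs, rfl⟩ := hz
  intro h
  exact smul_ne_zero hs.1.ne' (sub_ne_zero.2 hpq.symm) (by simpa using h)
lemma sIco_ne {p q z : Plane} (hpq : p ≠ q) (hz : z ∈ sIco p q) : z ≠ q := by
  obtain ⟨s, hs, rfl⟩ := hz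
  intro h
  refine smul_ne_zero (r := 1 - s) (by have := hs.2; linarith) (sub_ne_zero.2 hpq.symm) ?_
  have : (1 - s) • (q - p) = q - (p + s • (q - p)) := by rw [sub_smul, one_smul]; abel
  rw [this]; exact sub_eq_zero.2 h.symm
lemma mem_sIoc {p q z : Plane} (hz : z ∈ segment ℝ p q) (h : z ≠ p) : z ∈ sIoc p q := by
  obtain ⟨s, s0, s1, rfl⟩ := mem_seg_iff.1 hz
  refine ⟨s, ⟨s0.lt_of_ne fun h' => h ?_, s1⟩, rfl⟩
  rw [← h']; simp
lemma mem_sIco {p q z : Plane} (hz : z ∈ segment ℝ p q) (h : z ≠ q) : z ∈ sIco p q := by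
  obtain ⟨s, s0, s1, rfl⟩ := mem_seg_iff.1 hz
  refine ⟨s, ⟨s0, s1.lt_of_ne fun h' => h ?_⟩, rfl⟩
  rw [h']; simp

lemma idx7 {n : ℕ} (hn : n = 7) (i j : ZMod n) : j = i - 1 ∨ j = i ∨ j = i + 1 ∨ j = i + 2 ∨
    j = i + 3 ∨ j = i + 4 ∨ j = i + 5 := by
  subst hn; revert i j; decide
lemma ne7 {n : ℕ} (hn : n = 7) (i : ZMod n) : i + 1 ≠ i - 1 ∧ i - 1 ≠ i + 1 + 1 ∧ i - 1 ≠ i ∧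
   i + 1 ≠ i ∧ i + 1 + 1 ≠ i - 1 ∧ i + 5 + 1 = i - 1 ∧ i + 2 ≠ i - 1 ∧ i + 2 ≠ i ∧
    i + 3 ≠ i - 1 ∧ i + 3 ≠ i ∧ i + 4 ≠ i - 1 ∧ i + 4 ≠ i ∧ i + 5 ≠ i - 1 ∧ i + 5 ≠ i ∧
    i + 1 + 1 = i + 2 ∧ i + 2 + 1 = i + 3 ∧ i + 3 + 1 = i + 4 ∧ i + 4 + 1 = i + 5 ∧
    i + 1 ≠ i + 2 ∧ i + 1 ≠ i + 3 ∧ i + 1 ≠ i + 4 ∧ i + 1 ≠ i + 5 ∧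
    i + 1 ≠ i + 3 + 1 ∧ i + 1 ≠ i + 2 + 1 ∧ i + 1 ≠ i + 4 + 1 ∧ i + 1 ≠ i + 5 + 1 := by
  subst hn; revert i; decide

namespace SimplePolygon
variable (P : SimplePolygon)

lemma ear (hn : P.n = 7) {i : ZMod P.n}
    (hs : segment ℝ (P.vertex (i - 1)) (P.vertex (i + 1)) ⊆ P.carrier)
    (hv : ∀ k, P.vertex k ∈ segment ℝ (P.vertex (i - 1)) (P.vertex (i + 1)) →
      k = i - 1 ∨ k = i + 1) : ¬ P.IsReflexAt i := by
  obtain ⟨n1, n2, n3, n4, n5, n6, n7, n8, n9, n10, n11, n12, n13, n14, n15, n16, n17, n18, n19,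
    n20, n21, n22, n23, n24, n25, n26⟩ := ne7 hn i
  set A := P.vertex (i - 1) with hA
  set B := P.vertex (i + 1) with hB
  set M := P.vertex i with hM
  have eA : P.edge (i - 1) = segment ℝ A M := by
    rw [edge, sub_add_cancel]
  have eB : P.edge i = segment ℝ M B := rfl
  have hAM : A - M ≠ 0 := sub_ne_zero.2 fun h => n3 (P.vertex_injective h)
  have hBM : B - M ≠ 0 := sub_ne_zero.2 fun h => n4 (P.vertex_injective h)
  -- non-collinear
  have hD : crs (A - M) (B - M) ≠ 0 := by
    intro h0
    obtain ⟨t, ht⟩ := exists_smul_of_crs_eq_zero hAM h0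
    rcases lt_trichotomy t 0 with h | h | h
    · have : P.vertex i ∈ segment ℝ A B := by
        have e : B - A = (t - 1) • (A - M) := by
          rw [sub_smul, one_smul, ← ht]; abel
        refine mem_seg_iff.2 ⟨1 / (1 - t), by
          apply div_nonneg <;> linarith, by rw [div_le_one] <;> linarith, ?_⟩
        rw [e, smul_smul]
        have : 1 / (1 - t) * (t - 1) = -1 := by
          have : (1 - t) ≠ 0 := by linarith
          field_simp; ring
        rw [this, neg_one_smul]; abel
      rcases hv i this with h | h
      · exact n3 h.symm
      · exact n4 h.symm
    · rw [h, zero_smul] at ht; exact hBM ht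
    · rcases le_total t 1 with h1 | h1
      · have : P.vertex (i + 1) ∈ P.edge (i - 1) := by
          rw [eA, segment_symm]
          refine mem_seg_iff.2 ⟨t, h.le, h1, ?_⟩
          rw [← ht, ← hB]; abel
        rcases P.vertex_mem_edge this with h | h
        · exact n1 h
        · rw [sub_add_cancel] at h; exact n4 h
      · have : P.vertex (i - 1) ∈ P.edge i := by
          rw [eB]
          refine mem_seg_iff.2 ⟨1 / t, by positivity, by rw [div_le_one] <;> linarith, ?_⟩
          rw [ht, smul_smul, one_div_mul_cancel h.ne', one_smul, ← hA]; abel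
        rcases P.vertex_mem_edge this with h | h
        · exact n3 h
        · exact n1 h.symm
  set O := otri M (A - M) (B - M) with hO
  have hOo : IsOpen O := isOpen_otri _ _ _
  set X := cX M (A - M) (B - M) with hX
  set Y := cY M (A - M) (B - M) with hY
  have hXY : ∀ z, z = M + X z • (A - M) + Y z • (B - M) := fun z => eq_coords hD z
  -- midpoint of chord
  set m := A + (1/2 : ℝ) • (B - A) with hm
  have hmI : m ∈ interior P.carrier :=
    P.chord_interior hs hv n1.symm (by rw [sub_add_cancel]; exact n4.symm) n5
      (by norm_num) (by norm_num)
  have hm' : m = M + (1/2 : ℝ) • (A - M) + (1/2 : ℝ) • (B - M) := by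
    apply plane_ext <;> simp [hm] <;> ring
  have mX : X m = 1/2 := by rw [hm']; exact cX_mk hD _ _
  have mY : Y m = 1/2 := by rw [hm']; exact cY_mk hD _ _
  -- frontier of O
  have hfrO : ∀ z ∈ frontier P.carrier, z ∈ frontier O → z ∈ P.edge (i - 1) ∨ z ∈ P.edge i := by
    intro z hzP hz
    obtain ⟨zx, zy, zs⟩ := closure_otri_subset _ _ _ hz.1
    change 0 ≤ X z at zx
    change 0 ≤ Y z at zy
    change X z + Y z ≤ 1 at zs
    have hzO : z ∉ O := by have := hz.2; rwa [hOo.interior_eq] at this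
    have hz' := hXY z
    rcases zx.eq_or_lt with hx | hx
    · right
      rw [eB]; refine mem_seg_iff.2 ⟨Y z, zy, by linarith, ?_⟩
      conv_lhs => rw [hz', ← hx]
      simp
    rcases zy.eq_or_lt with hy | hy
    · left
      rw [eA, segment_symm]; refine mem_seg_iff.2 ⟨X z, zx, by linarith, ?_⟩
      conv_lhs => rw [hz', ← hy]
      simp
    have hs1 : X z + Y z = 1 := by
      by_contra h
      exact hzO ⟨hx, hy, lt_of_le_of_ne zs h⟩
    exfalso
    refine hzP.2 ?_
    have : z = A + (Y z) • (B - A) := by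
      conv_lhs => rw [hz']
      have : X z = 1 - Y z := by linarith
      rw [this]
      apply plane_ext <;> simp <;> ring
    rw [this]
    exact P.chord_interior hs hv n1.symm (by rw [sub_add_cancel]; exact n4.symm) n5
      hy (by linarith)
  -- the remaining arc
  set Γ : Set Plane := sIoc (P.vertex (i + 1)) (P.vertex (i + 1 + 1)) ∪ (P.edge (i + 2) ∪
    (P.edge (i + 3) ∪ (P.edge (i + 4) ∪ sIco (P.vertex (i + 5)) (P.vertex (i + 5 + 1))))) with hΓ
  have right_mem : ∀ j, P.vertex (j + 1) ∈ P.edge j := P.right_mem_edge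
  have hΓc : IsPreconnected Γ := by
    refine IsPreconnected.union (P.vertex (i + 2)) ?_ (Or.inl (P.left_mem_edge _))
      (sIoc_preconn _ _) ?_
    · refine ⟨1, by simp, ?_⟩
      simp [n15]
    refine IsPreconnected.union (P.vertex (i + 3)) ?_ (Or.inl (P.left_mem_edge _))
      (seg_preconn _ _) ?_
    · rw [← n16]; exact right_mem _
    refine IsPreconnected.union (P.vertex (i + 4)) ?_ (Or.inl (P.left_mem_edge _))
      (seg_preconn _ _) ?_
    · rw [← n17]; exact right_mem _
    refine IsPreconnected.union (P.vertex (i + 5)) ?_ ?_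
      (seg_preconn _ _) (sIco_preconn _ _)
    · rw [← n18]; exact right_mem _
    · refine ⟨0, by simp, by simp⟩
  have hΓj : ∀ z ∈ Γ, ∃ j, z ∈ P.edge j ∧ j ≠ i - 1 ∧ j ≠ i ∧ (z = A → False) ∧
      (z = B → False) := by
    have hBv : ∀ j, i + 1 ≠ j → i + 1 ≠ j + 1 → P.vertex (i + 1) ∉ P.edge j := by
      intro j h1 h2 h3
      rcases P.vertex_mem_edge h3 with h | h
      · exact h1 h
      · exact h2 h
    have hAv : ∀ j, j ≠ i - 1 → j + 1 ≠ i - 1 → P.vertex (i - 1) ∉ P.edge j := by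
      intro j h1 h2 h3
      rcases P.vertex_mem_edge h3 with h | h
      · exact h1 h.symm
      · exact h2 h.symm
    have n2' : i + 2 + 1 ≠ i - 1 := by rw [n16]; exact n9
    have n3' : i + 3 + 1 ≠ i - 1 := by rw [n17]; exact n11
    have n4' : i + 4 + 1 ≠ i - 1 := by rw [n18]; exact n13
    rintro z (hz | hz | hz | hz | hz)
    · have h := sIoc_subset _ _ hz
      exact ⟨i + 1, h, n1, n4, fun h' => hAv (i + 1) n1 n5 (by rw [← hA, ← h']; exact h),
        fun h' => sIoc_ne (P.vertex_ne _) hz h'⟩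
    · exact ⟨i + 2, hz, n7, n8, fun h' => hAv _ n7 n2' (by rw [← hA, ← h']; exact hz),
        fun h' => hBv _ n19 n24 (by rw [← hB, ← h']; exact hz)⟩
    · exact ⟨i + 3, hz, n9, n10, fun h' => hAv _ n9 n3' (by rw [← hA, ← h']; exact hz),
        fun h' => hBv _ n20 n23 (by rw [← hB, ← h']; exact hz)⟩
    · exact ⟨i + 4, hz, n11, n12, fun h' => hAv _ n11 n4' (by rw [← hA, ← h']; exact hz),
        fun h' => hBv _ n21 n25 (by rw [← hB, ← h']; exact hz)⟩
    · have h := sIco_subset _ _ hz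
      refine ⟨i + 5, h, n13, n14, fun h' => sIco_ne (P.vertex_ne _) hz (by rw [h', hA, n6]),
        fun h' => hBv _ n22 n26 (by rw [← hB, ← h']; exact h)⟩
  have hcover : ∀ z ∈ frontier P.carrier, z ∈ Γ ∨ z ∈ P.edge (i - 1) ∨ z ∈ P.edge i := by
    intro z hz
    by_cases hzA : z = A
    · right; left; rw [hzA]; exact P.left_mem_edge _
    by_cases hzB : z = B
    · right; right; rw [hzB]; exact P.right_mem_edge _
    obtain ⟨j, hj⟩ := P.mem_frontier.1 hz
    rcases idx7 hn i j with h | h | h | h | h | h | h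
    · subst h; exact Or.inr (Or.inl hj)
    · subst h; exact Or.inr (Or.inr hj)
    · subst h; exact Or.inl (Or.inl (mem_sIoc hj hzB))
    · subst h; exact Or.inl (Or.inr (Or.inl hj))
    · subst h; exact Or.inl (Or.inr (Or.inr (Or.inl hj)))
    · subst h; exact Or.inl (Or.inr (Or.inr (Or.inr (Or.inl hj))))
    · subst h; exact Or.inl (Or.inr (Or.inr (Or.inr (Or.inr (mem_sIco hj (by rw [n6]; exact hzA))))))
  have hΓdis : ∀ z ∈ Γ, z ∉ frontier O := by
    intro z hz hzO
    obtain ⟨j, hj, j1, j2, hzA, hzB⟩ := hΓj z hz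
    rcases hfrO z (P.edge_subset_frontier j hj) hzO with h | h
    · rcases P.edge_inter j1 hj h with ⟨_, h2⟩ | ⟨h1, h2⟩
      · exact hzA h2
      · rw [sub_add_cancel] at h1; exact j2 h1.symm
    · rcases P.edge_inter j2 hj h with ⟨h1, h2⟩ | ⟨h1, h2⟩
      · exact j1 (eq_sub_of_add_eq h1)
      · rw [← h1] at h2; exact hzB h2
  have hclO : ∀ z, 0 ≤ X z → 0 ≤ Y z → X z + Y z ≤ 1 → z ∈ closure O :=
    fun z h1 h2 h3 => mem_closure_otri hD h1 h2 h3
  have hedgeXY : ∀ z, z ∈ P.edge (i - 1) ∨ z ∈ P.edge i → z ∈ closure O ∧ z ∉ O := by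
    rintro z (h | h)
    · rw [eA, segment_symm] at h
      obtain ⟨s, s0, s1, hz⟩ := mem_seg_iff.1 h
      have hz' : z = M + s • (A - M) + (0:ℝ) • (B - M) := by rw [hz]; simp
      have x1 : X z = s := by rw [hz']; exact cX_mk hD _ _
      have y1 : Y z = 0 := by rw [hz']; exact cY_mk hD _ _
      refine ⟨hclO z (by linarith) (by linarith) (by linarith), fun h => ?_⟩
      have := h.2.1
      change 0 < Y z at this
      linarith
    · rw [eB] at h
      obtain ⟨s, s0, s1, hz⟩ := mem_seg_iff.1 h
      have hz' : z = M + (0:ℝ) • (A - M) + s • (B - M) := by rw [hz]; simp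
      have x1 : X z = 0 := by rw [hz']; exact cX_mk hD _ _
      have y1 : Y z = s := by rw [hz']; exact cY_mk hD _ _
      refine ⟨hclO z (by linarith) (by linarith) (by linarith), fun h => ?_⟩
      have := h.1
      change 0 < X z at this
      linarith
  have hmcl : m ∈ closure O := hclO m (by linarith) (by linarith) (by linarith)
  by_cases hmeet : ∃ z ∈ Γ, z ∈ O
  · exfalso
    obtain ⟨z0, hz0, hz0O⟩ := hmeet
    have hsub := preconn_subset_interior hΓc hΓdis hz0 hz0O
    have hfr : ∀ z ∈ frontier P.carrier, X z + Y z ≤ 1 := by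
      intro z hz
      have : z ∈ closure O := by
        rcases hcover z hz with h | h
        · exact subset_closure (interior_subset (hsub h))
        · exact (hedgeXY z h).1
      exact (closure_otri_subset _ _ _ this).2.2
    obtain ⟨z, hzP, hz⟩ := P.isCompact.exists_isMaxOn ⟨m, interior_subset hmI⟩
      ((cX_continuous M (A - M) (B - M)).add (cY_continuous M (A - M) (B - M))).continuousOn
    have hmax : ∀ w ∈ P.carrier, X w + Y w ≤ X z + Y z := fun w hw => hz hw
    have hgrow : ∀ w ∈ interior P.carrier, 0 < X w + Y w → X w + Y w < X z + Y z := by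
      intro w hw hpos
      obtain ⟨ε, e0, e1, he⟩ := eventually_step w (w - M) (mem_interior_iff_mem_nhds.1 hw)
      have := hmax _ (he ε (by rw [abs_of_pos e0]))
      have e : w + ε • (w - M) = M + (1 + ε) • (w - M) := by rw [add_smul, one_smul]; abel
      have h0 : X M = 0 := by
        have := cX_mk (b := M) hD 0 0
        simpa using this
      have h0' : Y M = 0 := by
        have := cY_mk (b := M) hD 0 0
        simpa using this
      rw [e, hX, hY, cX_line, cY_line, ← hX, ← hY, h0, h0'] at this
      have := mul_pos e0 hpos
      linarith
    have h1 := hgrow m hmI (by linarith)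
    by_cases hzi : z ∈ interior P.carrier
    · have := hgrow z hzi (by linarith); linarith
    · have := hfr z ⟨subset_closure hzP, hzi⟩; linarith
  · push Not at hmeet
    have hOf : ∀ z ∈ O, z ∉ frontier P.carrier := by
      intro z hz hf
      rcases hcover z hf with h | h
      · exact hmeet z h hz
      · exact (hedgeXY z h).2 hz
    obtain ⟨z0, h1, h2⟩ := mem_closure_iff.1 hmcl _ isOpen_interior hmI
    have hOP := preconn_subset_interior (convex_otri _ _ _).isPreconnected hOf h2 (interior_subset h1)
    have hcl : closure O ⊆ P.carrier := closure_minimal (hOP.trans interior_subset) P.isClosed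
    rintro ⟨δ, δ0, hδ⟩
    obtain ⟨ε, e0, e1, he⟩ := eventually_step M (A - M) (ball_mem_nhds M δ0)
    obtain ⟨ε', e0', e1', he'⟩ := eventually_step M (B - M) (ball_mem_nhds M δ0)
    refine hδ (M + ε • (A - M)) ?_ (M + ε' • (B - M)) ?_ ?_ ?_ ?_ ?_ ?_
    · rw [segment_symm]; exact mem_seg_iff.2 ⟨ε, e0.le, e1.le, rfl⟩
    · exact mem_seg_iff.2 ⟨ε', e0'.le, e1'.le, rfl⟩
    · intro h; rw [← hM] at h; exact smul_ne_zero e0.ne' hAM (by simpa using h)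
    · intro h; rw [← hM] at h; exact smul_ne_zero e0'.ne' hBM (by simpa using h)
    · exact he ε (by rw [abs_of_pos e0])
    · exact he' ε' (by rw [abs_of_pos e0'])
    · intro q hq
      obtain ⟨s, s0, s1, hq'⟩ := mem_seg_iff.1 hq
      have hq2 : q = M + ((1 - s) * ε) • (A - M) + (s * ε') • (B - M) := by
        rw [hq']; apply plane_ext <;> simp <;> ring
      have x1 : X q = (1 - s) * ε := by rw [hq2]; exact cX_mk hD _ _
      have y1 : Y q = s * ε' := by rw [hq2]; exact cY_mk hD _ _
      have a1 : 0 ≤ (1 - s) * ε := mul_nonneg (by linarith) e0.le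
      have a2 : 0 ≤ s * ε' := mul_nonneg s0 e0'.le
      refine hcl (hclO q (by rw [x1]; exact a1) (by rw [y1]; exact a2) ?_)
      rw [x1, y1]; nlinarith

end SimplePolygon


namespace SimplePolygon
variable (P : SimplePolygon)

/-- collinear adjacent edges are opposite -/
lemma opposite {i : ZMod P.n} {t : ℝ} (hne : i + 1 ≠ i - 1)
    (ht : P.vertex (i + 1) - P.vertex i = t • (P.vertex (i - 1) - P.vertex i)) : t < 0 := by
  have n3 : i - 1 ≠ i := by
    intro h; exact P.one_ne (by simpa using h)
  have n4 : i + 1 ≠ i := by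
    intro h; exact P.one_ne (by simpa using h)
  by_contra! h0
  rcases h0.eq_or_lt with h | h
  · rw [← h, zero_smul] at ht
    exact n4 (P.vertex_injective (sub_eq_zero.1 ht))
  rcases le_total t 1 with h1 | h1
  · have : P.vertex (i + 1) ∈ P.edge (i - 1) := by
      rw [edge, sub_add_cancel, segment_symm]
      refine mem_seg_iff.2 ⟨t, h.le, h1, ?_⟩
      rw [← ht]; abel
    rcases P.vertex_mem_edge this with h | h
    · exact hne h
    · rw [sub_add_cancel] at h; exact n4 h
  · have : P.vertex (i - 1) ∈ P.edge i := by
      refine mem_seg_iff.2 ⟨1 / t, by positivity, by rw [div_le_one] <;> linarith, ?_⟩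
      rw [ht, smul_smul, one_div_mul_cancel h.ne', one_smul]; abel
    rcases P.vertex_mem_edge this with h | h
    · exact n3 h
    · exact hne h.symm

lemma sector_of_split {p : Plane} (hp : p ∈ frontier P.carrier) {r : ℝ} (r0 : 0 < r)
    {A₁ A₂ : Set Plane} (c₁ : IsPreconnected A₁) (c₂ : IsPreconnected A₂)
    (h : ball p r \ frontier P.carrier = A₁ ∪ A₂) :
    IsPreconnected (ball p r ∩ interior P.carrier) ∧ IsPreconnected (ball p r ∩ P.carrierᶜ) := by
  rcases P.two_side hp r0 c₁ c₂ h with ⟨h1, h2⟩ | ⟨h1, h2⟩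
  · rw [h1, h2]; exact ⟨c₁, c₂⟩
  · rw [h1, h2]; exact ⟨c₂, c₁⟩

lemma sector_of_line {p e : Plane} (hp : p ∈ frontier P.carrier)
    (h : ∀ᶠ z in nhds p, z ∈ frontier P.carrier ↔ crs e (z - p) = 0) :
    ∃ r0 : ℝ, 0 < r0 ∧ ∀ r, 0 < r → r ≤ r0 → IsPreconnected (ball p r ∩ interior P.carrier) ∧
      IsPreconnected (ball p r ∩ P.carrierᶜ) := by
  obtain ⟨r0, h0, hr⟩ := Metric.eventually_nhds_iff_ball.1 h
  refine ⟨r0, h0, fun r rp rle => ?_⟩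
  obtain ⟨c1, c2, hun⟩ := P.line_split p e (r := r) fun z hz => hr z (ball_subset_ball rle hz)
  exact P.sector_of_split hp rp c1 c2 hun

lemma sector {p : Plane} (hp : p ∈ frontier P.carrier) (h3 : ∀ i : ZMod P.n, i + 1 ≠ i - 1) :
    ∃ r0 : ℝ, 0 < r0 ∧ ∀ r, 0 < r → r ≤ r0 → IsPreconnected (ball p r ∩ interior P.carrier) ∧
      IsPreconnected (ball p r ∩ P.carrierᶜ) := by
  by_cases hv : ∀ k, p ≠ P.vertex k
  · obtain ⟨i, hi⟩ := P.mem_frontier.1 hp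
    exact P.sector_of_line hp (P.frontier_near hi hv)
  push Not at hv
  obtain ⟨i, rfl⟩ := hv
  set v := P.vertex i with hvd
  set a := P.vertex (i - 1) - v with ha
  set b := P.vertex (i + 1) - v with hb
  have ha0 : a ≠ 0 := sub_ne_zero.2 fun h => by
    have := P.vertex_injective h
    exact P.one_ne (by simpa using this)
  have hb0 : b ≠ 0 := sub_ne_zero.2 fun h => by
    have := P.vertex_injective h
    exact P.one_ne (by simpa using this)
  have hedge : ∀ᶠ z in nhds v, z ∈ frontier P.carrier ↔
      (∃ s : ℝ, 0 ≤ s ∧ s ≤ 1 ∧ z = v + s • a) ∨ (∃ s : ℝ, 0 ≤ s ∧ s ≤ 1 ∧ z = v + s • b) := by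
    have hA : ∀ z, z ∈ P.edge (i - 1) ↔ ∃ s : ℝ, 0 ≤ s ∧ s ≤ 1 ∧ z = v + s • a := by
      intro z; rw [edge, sub_add_cancel, segment_symm, mem_seg_iff]
    have hB : ∀ z, z ∈ P.edge i ↔ ∃ s : ℝ, 0 ≤ s ∧ s ≤ 1 ∧ z = v + s • b := by
      intro z; rw [edge, mem_seg_iff]
    filter_upwards [P.eventually_edge v] with z hz
    rw [← hA, ← hB]
    constructor
    · intro h
      obtain ⟨j, hj⟩ := P.mem_frontier.1 h
      rcases P.vertex_mem_edge (hz j hj) with h | h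
      · subst h; exact Or.inr hj
      · left
        have : j = i - 1 := by rw [h]; ring
        rw [← this]; exact hj
    · rintro (h | h)
      · exact P.edge_subset_frontier _ h
      · exact P.edge_subset_frontier _ h
  by_cases hD : crs a b = 0
  · obtain ⟨t, ht⟩ := exists_smul_of_crs_eq_zero ha0 hD
    have htneg := P.opposite (h3 i) ht
    refine P.sector_of_line (e := a) hp ?_
    have key : ∀ c : ℝ, 0 < c → ∀ᶠ z in nhds v, ∀ κ : ℝ, z - v = κ • a → |κ| < c := by
      intro c hc
      filter_upwards [Metric.ball_mem_nhds v (mul_pos hc (norm_pos_iff.2 ha0))] with z hz κ hκ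
      rw [mem_ball, dist_eq_norm, hκ, norm_smul, Real.norm_eq_abs] at hz
      exact lt_of_mul_lt_mul_right hz (norm_nonneg _)
    filter_upwards [hedge, key 1 one_pos, key (-t) (by linarith)] with z hz k1 k2
    rw [hz]
    constructor
    · rintro (⟨s, _, _, rfl⟩ | ⟨s, _, _, rfl⟩)
      · rw [add_sub_cancel_left, crs_smul_right, crs_self, mul_zero]
      · rw [add_sub_cancel_left, crs_smul_right, hD, mul_zero]
    · intro h
      obtain ⟨κ, hκ⟩ := exists_smul_of_crs_eq_zero ha0 h
      have a1 := abs_lt.1 (k1 κ hκ)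
      have a2 := abs_lt.1 (k2 κ hκ)
      have hz' : z = v + κ • a := by rw [← hκ]; abel
      rcases le_total 0 κ with h | h
      · exact Or.inl ⟨κ, h, by linarith, hz'⟩
      · refine Or.inr ⟨κ / t, div_nonneg_of_nonpos h htneg.le, ?_, ?_⟩
        · rw [div_le_one_of_neg htneg]; linarith
        · rw [ht, smul_smul, div_mul_cancel₀ _ htneg.ne]; exact hz'
  · set X := cX v a b with hX
    set Y := cY v a b with hY
    have X0 : X v = 0 := by have := cX_mk (b := v) hD 0 0; simpa using this
    have Y0 : Y v = 0 := by have := cY_mk (b := v) hD 0 0; simpa using this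
    have hXc : Continuous X := cX_continuous _ _ _
    have hYc : Continuous Y := cY_continuous _ _ _
    have hX1 : ∀ᶠ z in nhds v, X z < 1 :=
      hXc.continuousAt.eventually_lt continuousAt_const (by rw [X0]; norm_num)
    have hY1 : ∀ᶠ z in nhds v, Y z < 1 :=
      hYc.continuousAt.eventually_lt continuousAt_const (by rw [Y0]; norm_num)
    have hfr : ∀ᶠ z in nhds v, z ∈ frontier P.carrier ↔
        (0 ≤ X z ∧ Y z = 0) ∨ (X z = 0 ∧ 0 ≤ Y z) := by
      filter_upwards [hedge, hX1, hY1] with z hz x1 y1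
      rw [hz]
      have hzc : z = v + X z • a + Y z • b := eq_coords hD z
      constructor
      · rintro (⟨s, s0, s1, hs⟩ | ⟨s, s0, s1, hs⟩)
        · have hs' : z = v + s • a + (0:ℝ) • b := by rw [hs]; simp
          have e1 : X z = s := by rw [hs']; exact cX_mk hD _ _
          have e2 : Y z = 0 := by rw [hs']; exact cY_mk hD _ _
          exact Or.inl ⟨by linarith, e2⟩
        · have hs' : z = v + (0:ℝ) • a + s • b := by rw [hs]; simp
          have e1 : X z = 0 := by rw [hs']; exact cX_mk hD _ _
          have e2 : Y z = s := by rw [hs']; exact cY_mk hD _ _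
          exact Or.inr ⟨e1, by linarith⟩
      · rintro (⟨h1, h2⟩ | ⟨h1, h2⟩)
        · refine Or.inl ⟨X z, h1, x1.le, ?_⟩
          conv_lhs => rw [hzc, h2]
          simp
        · refine Or.inr ⟨Y z, h2, y1.le, ?_⟩
          conv_lhs => rw [hzc, h1]
          simp
    obtain ⟨r0, h0, hr⟩ := Metric.eventually_nhds_iff_ball.1 hfr
    refine ⟨r0, h0, fun r rp rle => ?_⟩
    have hr' : ∀ z ∈ ball v r, z ∈ frontier P.carrier ↔
        (0 ≤ X z ∧ Y z = 0) ∨ (X z = 0 ∧ 0 ≤ Y z) := fun z hz => hr z (ball_subset_ball rle hz)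
    have c1 : IsPreconnected (ball v r ∩ ({z | 0 < X z} ∩ {z | 0 < Y z})) :=
      ((convex_ball v r).inter ((affLike_cX v a b).convex_pos.inter
        (affLike_cY v a b).convex_pos)).isPreconnected
    have c2 : IsPreconnected ((ball v r ∩ {z | X z < 0}) ∪ (ball v r ∩ {z | Y z < 0})) := by
      obtain ⟨ε, e0, _, he⟩ := eventually_step v (-(a + b)) (ball_mem_nhds v rp)
      have hm : v + ε • (-(a + b)) = v + (-ε) • a + (-ε) • b := by
        rw [smul_neg, smul_add, neg_smul, neg_smul]; abel
      have hmb := he ε (by rw [abs_of_pos e0])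
      rw [hm] at hmb
      refine IsPreconnected.union (v + (-ε) • a + (-ε) • b) ⟨hmb, ?_⟩ ⟨hmb, ?_⟩
        ((convex_ball v r).inter (affLike_cX v a b).convex_neg).isPreconnected
        ((convex_ball v r).inter (affLike_cY v a b).convex_neg).isPreconnected
      · have : X (v + (-ε) • a + (-ε) • b) = -ε := cX_mk hD _ _
        simp only [mem_ofPred_eq, this]; linarith
      · have : Y (v + (-ε) • a + (-ε) • b) = -ε := cY_mk hD _ _
        simp only [mem_ofPred_eq, this]; linarith
    refine P.sector_of_split hp rp c1 c2 ?_
    ext z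
    simp only [mem_sdiff, mem_union, mem_inter_iff, mem_ofPred_eq]
    constructor
    · rintro ⟨h1, h2⟩
      rw [hr' z h1] at h2
      push Not at h2
      rcases lt_trichotomy (X z) 0 with hx | hx | hx
      · exact Or.inr (Or.inl ⟨h1, hx⟩)
      · exact Or.inr (Or.inr ⟨h1, h2.2 hx⟩)
      · rcases lt_trichotomy (Y z) 0 with hy | hy | hy
        · exact Or.inr (Or.inr ⟨h1, hy⟩)
        · exact absurd hy (h2.1 hx.le)
        · exact Or.inl ⟨h1, hx, hy⟩
    · rintro (⟨h1, hx, hy⟩ | ⟨h1, hx⟩ | ⟨h1, hy⟩)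
      · refine ⟨h1, fun h => ?_⟩
        rcases (hr' z h1).1 h with h | h <;> linarith [h.1, h.2]
      · refine ⟨h1, fun h => ?_⟩
        rcases (hr' z h1).1 h with h | h <;> linarith [h.1, h.2]
      · refine ⟨h1, fun h => ?_⟩
        rcases (hr' z h1).1 h with h | h <;> linarith [h.1, h.2]

end SimplePolygon


/-! ### A parity function for a closed quadrilateral curve -/

/-- `conj (u - p) * (w - p)` as a complex number -/
def dc (u w p : Plane) : ℂ :=
  ⟨(u 0 - p 0) * (w 0 - p 0) + (u 1 - p 1) * (w 1 - p 1),
    (u 0 - p 0) * (w 1 - p 1) - (u 1 - p 1) * (w 0 - p 0)⟩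

/-- half-angle unit complex number -/
def hf (z : ℂ) : ℂ := Complex.exp (((Complex.arg z / 2 : ℝ) : ℂ) * Complex.I)

lemma hf_norm (z : ℂ) : ‖hf z‖ = 1 := Complex.norm_exp_ofReal_mul_I _

lemma hf_sq (z : ℂ) : hf z ^ 2 * (‖z‖ : ℂ) = z := by
  have : hf z ^ 2 = Complex.exp ((Complex.arg z : ℂ) * Complex.I) := by
    rw [hf, ← Complex.exp_nat_mul]
    congr 1; push_cast; ring
  rw [this, mul_comm]
  exact Complex.norm_mul_exp_arg_mul_I z

lemma hf_cont {z : ℂ} (hz : z ∈ Complex.slitPlane) : ContinuousAt hf z := by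
  have h1 := Complex.continuousAt_arg hz
  unfold hf
  have h2 : ContinuousAt (fun z : ℂ => (((Complex.arg z / 2 : ℝ) : ℂ) * Complex.I)) z :=
    (Complex.continuous_ofReal.continuousAt.comp (h1.div_const 2)).mul continuousAt_const
  exact Complex.continuous_exp.continuousAt.comp h2

lemma hf_neg_pos {z : ℂ} (hz : 0 < z.im) : hf z = Complex.I * hf (-z) := by
  unfold hf
  rw [Complex.arg_neg_eq_arg_sub_pi_of_im_pos hz]
  have : (((Complex.arg z / 2 : ℝ) : ℂ) * Complex.I) =
      (Real.pi / 2 : ℂ) * Complex.I + ((((Complex.arg z - Real.pi) / 2 : ℝ) : ℂ) * Complex.I) := by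
    push_cast; ring
  rw [this, Complex.exp_add, Complex.exp_pi_div_two_mul_I]

lemma hf_neg_neg {z : ℂ} (hz : z.im < 0) : hf z = -(Complex.I * hf (-z)) := by
  have h := hf_neg_pos (z := -z) (by simpa using hz)
  rw [neg_neg] at h
  rw [h, ← mul_assoc, Complex.I_mul_I]; simp

lemma dc_cont (u w : Plane) : Continuous (dc u w) := by
  have : dc u w = fun p => (((u 0 - p 0) * (w 0 - p 0) + (u 1 - p 1) * (w 1 - p 1) : ℝ) : ℂ) +
    (((u 0 - p 0) * (w 1 - p 1) - (u 1 - p 1) * (w 0 - p 0) : ℝ) : ℂ) * Complex.I := by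
    funext p; apply Complex.ext <;> simp [dc]
  rw [this]
  fun_prop

lemma dc_slit {u w p : Plane} (h : p ∉ segment ℝ u w) : dc u w p ∈ Complex.slitPlane := by
  by_contra hc
  rw [Complex.mem_slitPlane_iff] at hc
  push Not at hc
  obtain ⟨h1, h2⟩ := hc
  apply h
  simp only [dc] at h1 h2
  by_cases hu : u = p
  · rw [hu]; exact left_mem_segment ℝ _ _
  have hu' : u - p ≠ 0 := sub_ne_zero.2 hu
  obtain ⟨t, ht⟩ := exists_smul_of_crs_eq_zero (a := u - p) (b := w - p) hu' (by simpa [crs] using h2)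
  have w0 : w 0 - p 0 = t * (u 0 - p 0) := by have := congrArg (fun z : Plane => z 0) ht; simpa using this
  have w1 : w 1 - p 1 = t * (u 1 - p 1) := by have := congrArg (fun z : Plane => z 1) ht; simpa using this
  have hpos : 0 < (u 0 - p 0)^2 + (u 1 - p 1)^2 := by
    by_contra! hh
    apply hu
    apply plane_ext
    · nlinarith [sq_nonneg (u 0 - p 0), sq_nonneg (u 1 - p 1)]
    · nlinarith [sq_nonneg (u 0 - p 0), sq_nonneg (u 1 - p 1)]
  have ht0 : t ≤ 0 := by
    rw [w0, w1] at h1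
    by_contra! hh
    have := mul_pos hh hpos
    nlinarith
  refine mem_seg_iff.2 ⟨1 / (1 - t), div_nonneg (by norm_num) (by linarith), by
    rw [div_le_one] <;> linarith, ?_⟩
  have hne : 1 - t ≠ 0 := by linarith
  apply plane_ext
  · simp only [PiLp.add_apply, PiLp.smul_apply, PiLp.sub_apply, smul_eq_mul]
    field_simp
    linear_combination - w0
  · simp only [PiLp.add_apply, PiLp.smul_apply, PiLp.sub_apply, smul_eq_mul]
    field_simp
    linear_combination - w1

/-- parity function of closed quadrilateral `a b c d` -/
def par (a b c d p : Plane) : ℂ :=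
  hf (dc a b p) * (hf (dc b c p) * hf (dc c d p) * hf (dc d a p))

lemma ne_of_slit {z : ℂ} (h : z ∈ Complex.slitPlane) : z ≠ 0 := Complex.slitPlane_ne_zero h

lemma hf_dc_cont {u w p : Plane} (h : p ∉ segment ℝ u w) :
    ContinuousAt (fun p => hf (dc u w p)) p :=
  ContinuousAt.comp (f := dc u w) (g := hf) (hf_cont (dc_slit h)) (dc_cont u w).continuousAt

lemma par_cont {a b c d p : Plane} (h1 : p ∉ segment ℝ a b) (h2 : p ∉ segment ℝ b c)
    (h3 : p ∉ segment ℝ c d) (h4 : p ∉ segment ℝ d a) : ContinuousAt (par a b c d) p :=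
  (hf_dc_cont h1).mul (((hf_dc_cont h2).mul (hf_dc_cont h3)).mul (hf_dc_cont h4))

lemma par_sq {a b c d p : Plane} (h1 : p ∉ segment ℝ a b) (h2 : p ∉ segment ℝ b c)
    (h3 : p ∉ segment ℝ c d) (h4 : p ∉ segment ℝ d a) : par a b c d p ^ 2 = 1 := by
  have n1 := ne_of_slit (dc_slit h1)
  have n2 := ne_of_slit (dc_slit h2)
  have n3 := ne_of_slit (dc_slit h3)
  have n4 := ne_of_slit (dc_slit h4)
  set N : ℝ := ‖dc a b p‖ * ‖dc b c p‖ * ‖dc c d p‖ * ‖dc d a p‖ with hN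
  have Npos : 0 < N := by
    have := norm_pos_iff.2 n1
    have := norm_pos_iff.2 n2
    have := norm_pos_iff.2 n3
    have := norm_pos_iff.2 n4
    positivity
  set q : Plane → ℝ := fun u => (u 0 - p 0)^2 + (u 1 - p 1)^2 with hq
  have hprod : dc a b p * dc b c p * dc c d p * dc d a p = ((q a * q b * q c * q d : ℝ) : ℂ) := by
    set f : Plane → ℂ := fun u => ⟨u 0 - p 0, u 1 - p 1⟩ with hfd
    have hd : ∀ u w, dc u w p = (starRingEnd ℂ) (f u) * f w := by
      intro u w
      apply Complex.ext
      · rw [Complex.mul_re, Complex.conj_re, Complex.conj_im]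
        simp only [dc, hfd]; ring
      · rw [Complex.mul_im, Complex.conj_re, Complex.conj_im]
        simp only [dc, hfd]; ring
    have hqq : ∀ u, ((q u : ℝ) : ℂ) = (starRingEnd ℂ) (f u) * f u := by
      intro u
      apply Complex.ext
      · rw [Complex.mul_re, Complex.conj_re, Complex.conj_im, Complex.ofReal_re]
        simp only [hq, hfd]; ring
      · rw [Complex.mul_im, Complex.conj_re, Complex.conj_im, Complex.ofReal_im]
        simp only [hfd]; ring
    rw [Complex.ofReal_mul, Complex.ofReal_mul, Complex.ofReal_mul, hqq, hqq, hqq, hqq,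
      hd, hd, hd, hd]
    ring
  have hN2 : N = q a * q b * q c * q d := by
    have h := congrArg norm hprod
    rw [norm_mul, norm_mul, norm_mul, Complex.norm_real, Real.norm_eq_abs, abs_of_nonneg] at h
    · exact h
    · simp only [hq]; positivity
  have key : par a b c d p ^ 2 * (N : ℂ) = (N : ℂ) := by
    have e1 := hf_sq (dc a b p)
    have e2 := hf_sq (dc b c p)
    have e3 := hf_sq (dc c d p)
    have e4 := hf_sq (dc d a p)
    conv_rhs => rw [hN2, ← hprod, ← e1, ← e2, ← e3, ← e4]
    rw [hN, par]; push_cast; ring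
  have hNc : (N : ℂ) ≠ 0 := by exact_mod_cast Npos.ne'
  exact mul_right_cancel₀ hNc (by rw [key, one_mul])

lemma par_const {a b c d : Plane} {S : Set Plane} (hS : IsPreconnected S)
    (h : ∀ p ∈ S, p ∉ segment ℝ a b ∧ p ∉ segment ℝ b c ∧ p ∉ segment ℝ c d ∧ p ∉ segment ℝ d a)
    {x y : Plane} (hx : x ∈ S) (hy : y ∈ S) : par a b c d x = par a b c d y := by
  have hc : ContinuousOn (par a b c d) S := fun p hp =>
    (par_cont (h p hp).1 (h p hp).2.1 (h p hp).2.2.1 (h p hp).2.2.2).continuousWithinAt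
  have hm : ∀ p ∈ S, par a b c d p ∈ ({1, -1} : Set ℂ) := by
    intro p hp
    have := par_sq (h p hp).1 (h p hp).2.1 (h p hp).2.2.1 (h p hp).2.2.2
    rcases mul_self_eq_one_iff.1 ((sq _).symm.trans this) with h | h <;> simp [h]
  exact hS.constant_of_mapsTo (Set.toFinite _).isDiscrete hc hm hx hy

lemma par_jump {a b c d m : Plane} {t : ℝ} (t0 : 0 < t) (t1 : t < 1) (hab : a ≠ b)
    (hm : m = a + t • (b - a)) (h2 : m ∉ segment ℝ b c)
    (h3 : m ∉ segment ℝ c d) (h4 : m ∉ segment ℝ d a) :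
    ∃ r : ℝ, 0 < r ∧ ∀ p ∈ ball m r, ∀ p' ∈ ball m r, 0 < crs (b - a) (p - m) →
      crs (b - a) (p' - m) < 0 → par a b c d p ≠ par a b c d p' := by
  set k : Plane → ℂ := fun p => hf (- dc a b p) *
    (hf (dc b c p) * hf (dc c d p) * hf (dc d a p)) with hk
  have m0 : m 0 = a 0 + t * (b 0 - a 0) := by rw [hm]; simp
  have m1 : m 1 = a 1 + t * (b 1 - a 1) := by rw [hm]; simp
  have hpos : 0 < (b 0 - a 0)^2 + (b 1 - a 1)^2 := by
    by_contra! hh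
    apply hab
    apply plane_ext
    · nlinarith [sq_nonneg (b 0 - a 0), sq_nonneg (b 1 - a 1)]
    · nlinarith [sq_nonneg (b 0 - a 0), sq_nonneg (b 1 - a 1)]
  have hsl : - dc a b m ∈ Complex.slitPlane := by
    rw [Complex.mem_slitPlane_iff]; left
    simp only [Complex.neg_re, dc, m0, m1]
    have := mul_pos (mul_pos t0 (sub_pos.2 t1)) hpos
    nlinarith
  have hkc : ContinuousAt k m :=
    (ContinuousAt.comp (f := fun p => - dc a b p) (g := hf) (hf_cont hsl)
      (dc_cont a b).neg.continuousAt).mul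
      (((hf_dc_cont h2).mul (hf_dc_cont h3)).mul (hf_dc_cont h4))
  have hkn : ∀ p, ‖k p‖ = 1 := by intro p; simp [hk, hf_norm]
  obtain ⟨r, r0, hr⟩ := Metric.continuousAt_iff.1 hkc 1 one_pos
  have him : ∀ p, (dc a b p).im = crs (b - a) (p - m) := by
    intro p
    simp only [dc, crs, PiLp.sub_apply, m0, m1]; ring
  refine ⟨r, r0, fun p hp p' hp' h h' heq => ?_⟩
  have e1 : par a b c d p = Complex.I * k p := by
    rw [par, hf_neg_pos (by rw [him]; exact h), hk]; ring
  have e2 : par a b c d p' = -(Complex.I * k p') := by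
    rw [par, hf_neg_neg (by rw [him]; exact h'), hk]; ring
  rw [e1, e2] at heq
  have hs : k p + k p' = 0 := by
    have : Complex.I * (k p + k p') = 0 := by rw [mul_add, heq]; ring
    exact (mul_eq_zero.1 this).resolve_left Complex.I_ne_zero
  have d1 := hr hp
  have d2 := hr hp'
  rw [dist_eq_norm] at d1 d2
  have : (2:ℂ) * k m = -((k p - k m) + (k p' - k m)) := by linear_combination hs
  have hn : ‖(2:ℂ) * k m‖ < 2 := by
    rw [this, norm_neg]
    exact (norm_add_le _ _).trans_lt (by linarith)
  rw [norm_mul, hkn] at hn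
  norm_num at hn


lemma succ7 {n : ℕ} (hn : n = 7) : (0 : ZMod n) + 1 = 1 ∧ (1 : ZMod n) + 1 = 2 ∧
    (2 : ZMod n) + 1 = 3 ∧ (3 : ZMod n) + 1 = 4 ∧ (4 : ZMod n) + 1 = 5 ∧ (5 : ZMod n) + 1 = 6 ∧
    (6 : ZMod n) + 1 = 0 ∧ (3 : ZMod n) - 1 = 2 ∧ (6 : ZMod n) - 1 = 5 := by
  subst hn; decide

/-- edges that are neither equal nor adjacent -/
def Far {n : ℕ} (i j : ZMod n) : Prop := i ≠ j ∧ i + 1 ≠ j ∧ j + 1 ≠ i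

lemma far7 {n : ℕ} (hn : n = 7) : Far (0 : ZMod n) 4 ∧ Far (0 : ZMod n) 5 ∧ Far (1 : ZMod n) 4 ∧
    Far (1 : ZMod n) 5 ∧ Far (1 : ZMod n) 6 ∧ Far (2 : ZMod n) 4 ∧ Far (2 : ZMod n) 5 ∧
    Far (2 : ZMod n) 6 ∧ Far (3 : ZMod n) 5 ∧ Far (3 : ZMod n) 6 ∧ Far (6 : ZMod n) 4 := by
  unfold Far; subst hn; decide

lemma nes7 {n : ℕ} (hn : n = 7) : (0 : ZMod n) ≠ 6 ∧ (3 : ZMod n) ≠ 4 ∧ (5 : ZMod n) ≠ 6 ∧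
    (1 : ZMod n) ≠ 6 ∧ (4 : ZMod n) ≠ 0 ∧ (5 : ZMod n) ≠ 3 ∧ (0 : ZMod n) ≠ 5 := by
  subst hn; decide

namespace SimplePolygon
variable (P : SimplePolygon)

lemma far_disj {i j : ZMod P.n} (h : Far i j) {z : Plane} (hi : z ∈ P.edge i) : z ∉ P.edge j :=
  disjoint_left.1 (P.edges_disjoint i j h.1 h.2.1 h.2.2) hi

lemma int_off {z : Plane} (hz : z ∈ interior P.carrier) (i : ZMod P.n) : z ∉ P.edge i := fun h =>
  (P.edge_subset_frontier i h).2 hz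

lemma out_off {z : Plane} (hz : z ∉ P.carrier) (i : ZMod P.n) : z ∉ P.edge i := fun h =>
  hz (P.edge_subset i h)

lemma chord_frontier {i j : ZMod P.n} (hs : segment ℝ (P.vertex i) (P.vertex j) ⊆ P.carrier)
    (hv : ∀ k, P.vertex k ∈ segment ℝ (P.vertex i) (P.vertex j) → k = i ∨ k = j)
    (h : Far i j) {z : Plane} (hz : z ∈ segment ℝ (P.vertex i) (P.vertex j)) :
    z ∈ interior P.carrier ∨ z = P.vertex i ∨ z = P.vertex j := by
  obtain ⟨s, s0, s1, rfl⟩ := mem_seg_iff.1 hz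
  rcases s0.eq_or_lt with rfl | s0
  · right; left; simp
  rcases s1.eq_or_lt with rfl | s1
  · right; right; simp
  · left; exact P.chord_interior hs hv h.1 h.2.1 h.2.2 s0 s1

lemma near_out {p : Plane} (hp : p ∈ frontier P.carrier) {Q : Plane → Prop}
    (h : ∀ᶠ z in nhds p, Q z) : ∃ z, z ∉ P.carrier ∧ Q z := by
  rw [frontier_eq_closure_inter_closure] at hp
  obtain ⟨z, hz1, hz2⟩ := mem_closure_iff_nhds.1 hp.2 _ h
  exact ⟨z, hz2, hz1⟩

lemma near_in {p : Plane} (hp : p ∈ P.carrier) {Q : Plane → Prop}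
    (h : ∀ᶠ z in nhds p, Q z) : ∃ z, z ∈ interior P.carrier ∧ Q z := by
  rw [P.regular] at hp
  obtain ⟨z, hz1, hz2⟩ := mem_closure_iff_nhds.1 hp _ h
  exact ⟨z, hz2, hz1⟩

/-- the two long diagonals cross -/
lemma crossing (hn : P.n = 7)
    (hs1 : segment ℝ (P.vertex 0) (P.vertex 4) ⊆ P.carrier)
    (hv1 : ∀ k, P.vertex k ∈ segment ℝ (P.vertex 0) (P.vertex 4) → k = 0 ∨ k = 4)
    (hs2 : segment ℝ (P.vertex 2) (P.vertex 5) ⊆ P.carrier)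
    (hv2 : ∀ k, P.vertex k ∈ segment ℝ (P.vertex 2) (P.vertex 5) → k = 2 ∨ k = 5) :
    ∃ x, x ∈ segment ℝ (P.vertex 0) (P.vertex 4) ∧ x ∈ segment ℝ (P.vertex 2) (P.vertex 5) := by
  by_contra! hdis
  obtain ⟨a0, a1, a2, a3, a4, a5, a6, -, -⟩ := succ7 hn
  obtain ⟨f04, f05, f14, f15, f16, f24, f25, f26, f35, f36, f64⟩ := far7 hn
  obtain ⟨n06, n34, n56, n16, n40, n53, n05⟩ := nes7 hn
  have h3 : ∀ i : ZMod P.n, i + 1 ≠ i - 1 := fun i => (ne7 hn i).1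
  have e0 : P.edge 0 = segment ℝ (P.vertex 0) (P.vertex 1) := by rw [edge, a0]
  have e1 : P.edge 1 = segment ℝ (P.vertex 1) (P.vertex 2) := by rw [edge, a1]
  have e2 : P.edge 2 = segment ℝ (P.vertex 2) (P.vertex 3) := by rw [edge, a2]
  have e3 : P.edge 3 = segment ℝ (P.vertex 3) (P.vertex 4) := by rw [edge, a3]
  have e4 : P.edge 4 = segment ℝ (P.vertex 4) (P.vertex 5) := by rw [edge, a4]
  have e5 : P.edge 5 = segment ℝ (P.vertex 5) (P.vertex 6) := by rw [edge, a5]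
  have e6 : P.edge 6 = segment ℝ (P.vertex 6) (P.vertex 0) := by rw [edge, a6]
  have m00 : P.vertex 0 ∈ P.edge 0 := P.left_mem_edge 0
  have m43 : P.vertex 4 ∈ P.edge 3 := by rw [e3]; exact right_mem_segment ℝ _ _
  have m44 : P.vertex 4 ∈ P.edge 4 := P.left_mem_edge 4
  have m06 : P.vertex 0 ∈ P.edge 6 := by rw [e6]; exact right_mem_segment ℝ _ _
  have v01 : P.vertex 0 ≠ P.vertex 1 := by have := P.vertex_ne 0; rwa [a0] at this
  have v34 : P.vertex 3 ≠ P.vertex 4 := by have := P.vertex_ne 3; rwa [a3] at this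
  have v45 : P.vertex 4 ≠ P.vertex 5 := by have := P.vertex_ne 4; rwa [a4] at this
  have v60 : P.vertex 6 ≠ P.vertex 0 := by have := P.vertex_ne 6; rwa [a6] at this
  have f_04 : Far (0 : ZMod P.n) 4 := f04
  -- frontier points of the diagonal
  have dfr : ∀ z ∈ segment ℝ (P.vertex 0) (P.vertex 4), z ∈ frontier P.carrier →
      z = P.vertex 0 ∨ z = P.vertex 4 := by
    intro z hz hf
    rcases P.chord_frontier hs1 hv1 f04 hz with h | h
    · exact absurd h hf.2
    · exact h
  have dint : ∀ {z}, z ∈ interior P.carrier → z ∉ segment ℝ (P.vertex 0) (P.vertex 4) →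
      z ∉ segment ℝ (P.vertex 6) (P.vertex 0) ∧ z ∉ segment ℝ (P.vertex 0) (P.vertex 4) ∧
      z ∉ segment ℝ (P.vertex 4) (P.vertex 5) ∧ z ∉ segment ℝ (P.vertex 5) (P.vertex 6) := by
    intro z hz h
    exact ⟨e6 ▸ P.int_off hz 6, h, e4 ▸ P.int_off hz 4, e5 ▸ P.int_off hz 5⟩
  have dout : ∀ {z}, z ∉ P.carrier →
      z ∉ segment ℝ (P.vertex 6) (P.vertex 0) ∧ z ∉ segment ℝ (P.vertex 0) (P.vertex 4) ∧
      z ∉ segment ℝ (P.vertex 4) (P.vertex 5) ∧ z ∉ segment ℝ (P.vertex 5) (P.vertex 6) := by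
    intro z hz
    exact ⟨e6 ▸ P.out_off hz 6, fun h => hz (hs1 h), e4 ▸ P.out_off hz 4, e5 ▸ P.out_off hz 5⟩
  have dfro : ∀ {z}, z ∈ frontier P.carrier → z ∉ P.edge 4 → z ∉ P.edge 5 → z ∉ P.edge 6 →
      z ∉ segment ℝ (P.vertex 6) (P.vertex 0) ∧ z ∉ segment ℝ (P.vertex 0) (P.vertex 4) ∧
      z ∉ segment ℝ (P.vertex 4) (P.vertex 5) ∧ z ∉ segment ℝ (P.vertex 5) (P.vertex 6) := by
    intro z hz h4 h5 h6
    refine ⟨e6 ▸ h6, fun h => ?_, e4 ▸ h4, e5 ▸ h5⟩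
    rcases dfr z h hz with rfl | rfl
    · exact h6 m06
    · exact h4 m44
  set g : Plane → ℂ := par (P.vertex 6) (P.vertex 0) (P.vertex 4) (P.vertex 5) with hg
  -- the first chain
  set Γ : Set Plane := ((sIoc (P.vertex 0) (P.vertex 1) ∪ P.edge 1) ∪ P.edge 2) ∪
    sIco (P.vertex 3) (P.vertex 4) with hΓ
  have mem01 : P.vertex 1 ∈ sIoc (P.vertex 0) (P.vertex 1) :=
    mem_sIoc (right_mem_segment ℝ _ _) v01.symm
  have mem33 : P.vertex 3 ∈ sIco (P.vertex 3) (P.vertex 4) :=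
    mem_sIco (left_mem_segment ℝ _ _) v34
  have Γpre : IsPreconnected Γ := by
    refine IsPreconnected.union (P.vertex 3) (Or.inr ?_) mem33
      (IsPreconnected.union (P.vertex 2) (Or.inr ?_) (P.left_mem_edge 2)
        (IsPreconnected.union (P.vertex 1) mem01 (P.left_mem_edge 1) (sIoc_preconn _ _)
          (seg_preconn _ _)) (seg_preconn _ _)) (sIco_preconn _ _)
    · rw [e2]; exact right_mem_segment ℝ _ _
    · rw [e1]; exact right_mem_segment ℝ _ _
  have Γoff : ∀ z ∈ Γ,
      z ∉ segment ℝ (P.vertex 6) (P.vertex 0) ∧ z ∉ segment ℝ (P.vertex 0) (P.vertex 4) ∧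
      z ∉ segment ℝ (P.vertex 4) (P.vertex 5) ∧ z ∉ segment ℝ (P.vertex 5) (P.vertex 6) := by
    rintro z (((hz | hz) | hz) | hz)
    · have hz0 : z ∈ P.edge 0 := by rw [e0]; exact sIoc_subset _ _ hz
      refine dfro (P.edge_subset_frontier 0 hz0) (P.far_disj f04 hz0) (P.far_disj f05 hz0) ?_
      intro h6
      rcases P.edge_inter n06 hz0 h6 with ⟨h, -⟩ | ⟨-, h⟩
      · rw [a0] at h; exact n16 h
      · exact sIoc_ne v01 hz h
    · exact dfro (P.edge_subset_frontier 1 hz) (P.far_disj f14 hz) (P.far_disj f15 hz)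
        (P.far_disj f16 hz)
    · exact dfro (P.edge_subset_frontier 2 hz) (P.far_disj f24 hz) (P.far_disj f25 hz)
        (P.far_disj f26 hz)
    · have hz0 : z ∈ P.edge 3 := by rw [e3]; exact sIco_subset _ _ hz
      refine dfro (P.edge_subset_frontier 3 hz0) ?_ (P.far_disj f35 hz0) (P.far_disj f36 hz0)
      intro h6
      rcases P.edge_inter n34 hz0 h6 with ⟨-, h⟩ | ⟨h, -⟩
      · exact sIco_ne v34 hz h
      · rw [a4] at h; exact n53 h
  have mem2Γ : P.vertex 2 ∈ Γ := Or.inl (Or.inr (P.left_mem_edge 2))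
  have v0fr : P.vertex 0 ∈ frontier P.carrier := P.edge_subset_frontier 0 m00
  obtain ⟨r, r0, hsec⟩ := P.sector v0fr h3
  obtain ⟨-, hout⟩ := hsec r r0 le_rfl
  have evr : ∀ᶠ z in nhds (P.vertex 0), z ∈ ball (P.vertex 0) r := ball_mem_nhds _ r0
  -- outside point near the first chain
  obtain ⟨o1, ho1, ho1r, hgo1⟩ : ∃ o, o ∉ P.carrier ∧ o ∈ ball (P.vertex 0) r ∧
      g o = g (P.vertex 2) := by
    obtain ⟨ε, ε0, ε1, hε⟩ := eventually_step _ (P.vertex 1 - P.vertex 0) evr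
    have hxr := hε ε (by rw [abs_of_pos ε0])
    set x := P.vertex 0 + ε • (P.vertex 1 - P.vertex 0) with hx
    have hxs : x ∈ sIoc (P.vertex 0) (P.vertex 1) := ⟨ε, ⟨ε0, ε1.le⟩, rfl⟩
    have hxΓ : x ∈ Γ := Or.inl (Or.inl (Or.inl hxs))
    have hx0 : x ∈ P.edge 0 := by rw [e0]; exact sIoc_subset _ _ hxs
    obtain ⟨o6, o0, o4, o5⟩ := Γoff x hxΓ
    have hop : IsOpen ((segment ℝ (P.vertex 6) (P.vertex 0))ᶜ ∩
        ((segment ℝ (P.vertex 0) (P.vertex 4))ᶜ ∩ ((segment ℝ (P.vertex 4) (P.vertex 5))ᶜ ∩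
        (segment ℝ (P.vertex 5) (P.vertex 6))ᶜ))) :=
      (isClosed_seg _ _).isOpen_compl.inter ((isClosed_seg _ _).isOpen_compl.inter
        ((isClosed_seg _ _).isOpen_compl.inter (isClosed_seg _ _).isOpen_compl))
    obtain ⟨ρ, ρ0, hρ⟩ := Metric.isOpen_iff.1 hop x ⟨o6, o0, o4, o5⟩
    have ev : ∀ᶠ z in nhds x, z ∈ ball x ρ ∧ z ∈ ball (P.vertex 0) r :=
      (Filter.Eventually.and (ball_mem_nhds x ρ0) (isOpen_ball.mem_nhds hxr))
    obtain ⟨o, ho, ho1, ho2⟩ := P.near_out (P.edge_subset_frontier 0 hx0) ev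
    refine ⟨o, ho, ho2, ?_⟩
    have q1 : g o = g x := par_const (convex_ball x ρ).isPreconnected (fun p hp => hρ hp) ho1
      (mem_ball_self ρ0)
    have q2 : g x = g (P.vertex 2) := par_const Γpre Γoff hxΓ mem2Γ
    exact q1.trans q2
  -- local constancy on the inside
  have loc : ∀ p ∈ frontier P.carrier, p ∉ segment ℝ (P.vertex 0) (P.vertex 4) →
      ∃ ρ : ℝ, 0 < ρ ∧ ∀ z ∈ ball p ρ ∩ interior P.carrier, ∀ w ∈ ball p ρ ∩ interior P.carrier,
        g z = g w := by
    intro p hp hpd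
    obtain ⟨r1, r10, hr1⟩ := P.sector hp h3
    obtain ⟨r2, r20, hr2⟩ := Metric.isOpen_iff.1 (isClosed_seg (P.vertex 0)
      (P.vertex 4)).isOpen_compl p hpd
    refine ⟨min r1 r2, lt_min r10 r20, fun z hz w hw => ?_⟩
    refine par_const (hr1 _ (lt_min r10 r20) (min_le_left _ _)).1 (fun u hu => ?_) hz hw
    exact dint hu.2 (hr2 (ball_subset_ball (min_le_right _ _) hu.1))
  -- the last chain
  set Λ : Set Plane := (sIoc (P.vertex 4) (P.vertex 5) ∪ P.edge 5) ∪
    sIco (P.vertex 6) (P.vertex 0) with hΛ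
  have mem55 : P.vertex 5 ∈ sIoc (P.vertex 4) (P.vertex 5) :=
    mem_sIoc (right_mem_segment ℝ _ _) v45.symm
  have Λpre : IsPreconnected Λ := by
    refine IsPreconnected.union (P.vertex 6) (Or.inr ?_) (mem_sIco (left_mem_segment ℝ _ _) v60)
      (IsPreconnected.union (P.vertex 5) mem55 (P.left_mem_edge 5) (sIoc_preconn _ _)
          (seg_preconn _ _)) (sIco_preconn _ _)
    rw [e5]; exact right_mem_segment ℝ _ _
  have Λoff : ∀ p ∈ Λ, p ∈ frontier P.carrier ∧ p ∉ segment ℝ (P.vertex 0) (P.vertex 4) := by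
    rintro z ((hz | hz) | hz)
    · have hz0 : z ∈ P.edge 4 := by rw [e4]; exact sIoc_subset _ _ hz
      have hf := P.edge_subset_frontier 4 hz0
      refine ⟨hf, fun h => ?_⟩
      rcases dfr z h hf with rfl | rfl
      · exact P.far_disj f04 m00 hz0
      · exact sIoc_ne v45 hz rfl
    · have hf := P.edge_subset_frontier 5 hz
      refine ⟨hf, fun h => ?_⟩
      rcases dfr z h hf with rfl | rfl
      · exact P.far_disj f05 m00 hz
      · exact P.far_disj f35 m43 hz
    · have hz0 : z ∈ P.edge 6 := by rw [e6]; exact sIco_subset _ _ hz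
      have hf := P.edge_subset_frontier 6 hz0
      refine ⟨hf, fun h => ?_⟩
      rcases dfr z h hf with rfl | rfl
      · exact sIco_ne v60 hz rfl
      · exact P.far_disj f36 m43 hz0
  -- crossing the edge `[v₇, v₁]`
  obtain ⟨y, hyΛ, ρ, ρ0, hρ, c, hcβ, i2, hi2, hgc⟩ : ∃ y ∈ Λ, ∃ ρ : ℝ, 0 < ρ ∧
      (∀ z ∈ ball y ρ ∩ interior P.carrier, ∀ w ∈ ball y ρ ∩ interior P.carrier, g z = g w) ∧
      ∃ c, c ≠ g (P.vertex 2) ∧ ∃ i2 ∈ ball y ρ ∩ interior P.carrier, g i2 = c := by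
    obtain ⟨ε, ε0, ε1, hε⟩ := eventually_step _ (P.vertex 6 - P.vertex 0) evr
    have hyr := hε ε (by rw [abs_of_pos ε0])
    set y := P.vertex 0 + ε • (P.vertex 6 - P.vertex 0) with hy
    have hy' : y = P.vertex 6 + (1 - ε) • (P.vertex 0 - P.vertex 6) := by
      rw [hy]; module
    have hy1 : y ∈ sIco (P.vertex 6) (P.vertex 0) :=
      ⟨1 - ε, ⟨by linarith, by linarith⟩, hy'.symm⟩
    have hy2 : y ∈ sIoc (P.vertex 6) (P.vertex 0) :=
      ⟨1 - ε, ⟨by linarith, by linarith⟩, hy'.symm⟩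
    have hy6 : y ∈ P.edge 6 := by rw [e6]; exact sIco_subset _ _ hy1
    have hyΛ : y ∈ Λ := Or.inr hy1
    obtain ⟨hyf, hyd⟩ := Λoff y hyΛ
    have hyv : ∀ k, y ≠ P.vertex k := by
      rintro k hk
      have : P.vertex k ∈ P.edge 6 := hk ▸ hy6
      rcases P.vertex_mem_edge this with rfl | rfl
      · exact sIoc_ne v60 hy2 hk
      · rw [a6] at hk; exact sIco_ne v60 hy1 hk
    have hy4 : y ∉ segment ℝ (P.vertex 4) (P.vertex 5) := e4 ▸ P.far_disj f64 hy6
    have hy5 : y ∉ segment ℝ (P.vertex 5) (P.vertex 6) := by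
      rw [← e5]; intro h5
      rcases P.edge_inter n56 h5 hy6 with ⟨-, h⟩ | ⟨h, -⟩
      · exact hyv _ h
      · rw [a6] at h; exact n05 h
    obtain ⟨rj, rj0, hj⟩ := par_jump (t := 1 - ε) (by linarith) (by linarith) v60 hy' hyd hy4 hy5
    obtain ⟨σ, σ0, hσ1, hσ2⟩ := P.half_disc hy6 hyv
    rw [a6] at hσ1 hσ2
    obtain ⟨ρ, ρ0, hρ⟩ := loc y hyf hyd
    have ev : ∀ᶠ z in nhds y, (z ∈ P.carrier ↔
      0 ≤ σ * crs (P.vertex 0 - P.vertex 6) (z - y)) ∧ (z ∈ interior P.carrier ↔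
      0 < σ * crs (P.vertex 0 - P.vertex 6) (z - y)) ∧ z ∈ ball y rj ∧ z ∈ ball y ρ ∧
      z ∈ ball (P.vertex 0) r := by
      filter_upwards [hσ1, hσ2, ball_mem_nhds y rj0, ball_mem_nhds y ρ0,
        isOpen_ball.mem_nhds hyr] with z q1 q2 q3 q4 q5 using ⟨q1, q2, q3, q4, q5⟩
    obtain ⟨o2, ho, o1', -, o3, -, o5⟩ := P.near_out hyf ev
    obtain ⟨i2, hi, -, i2', i3, i4, -⟩ := P.near_in (P.frontier_subset hyf) ev
    refine ⟨y, hyΛ, ρ, ρ0, hρ, g i2, ?_, i2, ⟨i4, hi⟩, rfl⟩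
    have hgo : g o2 = g o1 := par_const hout (fun z hz => dout hz.2) ⟨o5, ho⟩ ⟨ho1r, ho1⟩
    rw [← hgo1, ← hgo]
    have s1 := i2'.1 hi
    have s2 : σ * crs (P.vertex 0 - P.vertex 6) (o2 - y) < 0 := by
      by_contra! hh; exact ho (o1'.2 hh)
    rcases lt_or_gt_of_ne σ0 with hneg | hpos
    · have t1 : crs (P.vertex 0 - P.vertex 6) (i2 - y) < 0 := by
        by_contra! hh; nlinarith
      have t2 : 0 < crs (P.vertex 0 - P.vertex 6) (o2 - y) := by
        by_contra! hh; nlinarith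
      exact (hj o2 o3 i2 i3 t2 t1).symm
    · have t1 : 0 < crs (P.vertex 0 - P.vertex 6) (i2 - y) := by
        by_contra! hh; nlinarith
      have t2 : crs (P.vertex 0 - P.vertex 6) (o2 - y) < 0 := by
        by_contra! hh; nlinarith
      exact hj i2 i3 o2 o3 t1 t2
  -- propagate along the last chain
  have h5U : ∃ ρ : ℝ, 0 < ρ ∧ ∀ z ∈ ball (P.vertex 5) ρ ∩ interior P.carrier, g z = c := by
    have opn : ∀ Q : Plane → Prop, IsOpen {p : Plane | ∃ ρ : ℝ, 0 < ρ ∧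
        ∀ z ∈ ball p ρ ∩ interior P.carrier, Q z} := by
      intro Q
      rw [Metric.isOpen_iff]
      rintro p ⟨ρ, ρ0, h⟩
      refine ⟨ρ / 2, half_pos ρ0, fun q hq => ⟨ρ / 2, half_pos ρ0, fun z hz => h z ⟨?_, hz.2⟩⟩⟩
      have h1 := mem_ball.1 hq
      have h2 := mem_ball.1 hz.1
      exact mem_ball.2 (by linarith [dist_triangle z q p])
    by_contra hne
    have h5f := Λoff (P.vertex 5) (Or.inl (Or.inl mem55))
    have split : ∀ p ∈ Λ, (∃ ρ : ℝ, 0 < ρ ∧ ∀ z ∈ ball p ρ ∩ interior P.carrier, g z = c) ∨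
        (∃ ρ : ℝ, 0 < ρ ∧ ∀ z ∈ ball p ρ ∩ interior P.carrier, g z ≠ c) := by
      intro p hp
      obtain ⟨ρ, ρ0, h⟩ := loc p (Λoff p hp).1 (Λoff p hp).2
      by_cases hh : ∀ z ∈ ball p ρ ∩ interior P.carrier, g z = c
      · exact Or.inl ⟨ρ, ρ0, hh⟩
      · push Not at hh
        obtain ⟨w, hw, hwc⟩ := hh
        exact Or.inr ⟨ρ, ρ0, fun z hz => by rw [h z hz w hw]; exact hwc⟩
    obtain ⟨p, hpΛ, ⟨ρ1, ρ10, h1⟩, ⟨ρ2, ρ20, h2⟩⟩ := Λpre _ _ (opn (fun z => g z = c))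
      (opn (fun z => g z ≠ c)) (fun p hp => split p hp)
      ⟨y, hyΛ, ρ, ρ0, fun z hz => (hρ z hz i2 hi2).trans hgc⟩
      ⟨P.vertex 5, Or.inl (Or.inl mem55),
        (split _ (Or.inl (Or.inl mem55))).resolve_left hne⟩
    obtain ⟨z, hz, z1, z2⟩ := P.near_in (P.frontier_subset (Λoff p hpΛ).1)
      (Q := fun z => z ∈ ball p ρ1 ∧ z ∈ ball p ρ2)
      (Filter.Eventually.and (ball_mem_nhds p ρ10) (ball_mem_nhds p ρ20))
    exact h2 z ⟨z2, hz⟩ (h1 z ⟨z1, hz⟩)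
  obtain ⟨ρ5, ρ50, h5⟩ := h5U
  have f25' : Far (2 : ZMod P.n) 5 := f25
  have int2 : ∀ s : ℝ, 0 < s → s < 1 →
      P.vertex 2 + s • (P.vertex 5 - P.vertex 2) ∈ interior P.carrier := fun s s0 s1 =>
    P.chord_interior hs2 hv2 f25.1 f25.2.1 f25.2.2 s0 s1
  have doff : ∀ z ∈ sIco (P.vertex 2) (P.vertex 5),
      z ∉ segment ℝ (P.vertex 6) (P.vertex 0) ∧ z ∉ segment ℝ (P.vertex 0) (P.vertex 4) ∧
      z ∉ segment ℝ (P.vertex 4) (P.vertex 5) ∧ z ∉ segment ℝ (P.vertex 5) (P.vertex 6) := by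
    rintro _ ⟨s, ⟨s0, s1⟩, rfl⟩
    rcases s0.eq_or_lt with rfl | s0
    · have : P.vertex 2 + (0 : ℝ) • (P.vertex 5 - P.vertex 2) = P.vertex 2 := by simp
      simp only [this]
      exact Γoff _ mem2Γ
    · exact dint (int2 s s0 s1) fun h => hdis _ h (mem_seg_iff.2 ⟨s, s0.le, s1.le, rfl⟩)
  have ev5 : ∀ᶠ z in nhds (P.vertex 5), z ∈ ball (P.vertex 5) ρ5 := ball_mem_nhds _ ρ50
  obtain ⟨ε, ε0, ε1, hε⟩ := eventually_step _ (P.vertex 2 - P.vertex 5) ev5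
  have hw := hε ε (by rw [abs_of_pos ε0])
  have hw' : P.vertex 5 + ε • (P.vertex 2 - P.vertex 5) =
      P.vertex 2 + (1 - ε) • (P.vertex 5 - P.vertex 2) := by module
  rw [hw'] at hw
  have q1 := h5 _ ⟨hw, int2 (1 - ε) (by linarith) (by linarith)⟩
  have q2 : g (P.vertex 2 + (1 - ε) • (P.vertex 5 - P.vertex 2)) = g (P.vertex 2) :=
    par_const (sIco_preconn _ _) doff ⟨1 - ε, ⟨by linarith, by linarith⟩, rfl⟩
      ⟨0, ⟨le_rfl, one_pos⟩, by simp⟩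
  exact hcβ (q1.symm.trans q2)

lemma ear_lit (hn : P.n = 7) {i j k : ZMod P.n} (hj : i - 1 = j) (hk : i + 1 = k)
    (hs : segment ℝ (P.vertex j) (P.vertex k) ⊆ P.carrier)
    (hv : ∀ l, P.vertex l ∈ segment ℝ (P.vertex j) (P.vertex k) → l = j ∨ l = k) :
    ¬ P.IsReflexAt i := by
  subst hj hk
  exact P.ear hn hs hv

lemma sub_seg_left {p q x : Plane} (h : x ∈ segment ℝ p q) : segment ℝ p x ⊆ segment ℝ p q :=
  (convex_segment p q).segment_subset (left_mem_segment ℝ _ _) h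

lemma sub_seg_right {p q x : Plane} (h : x ∈ segment ℝ p q) : segment ℝ x q ⊆ segment ℝ p q :=
  (convex_segment p q).segment_subset h (right_mem_segment ℝ _ _)

end SimplePolygon

theorem main_aux (P : SimplePolygon) (hn : P.n = 7)
    (hsep : ∀ i j : ZMod P.n, i ≠ j →
      1 ≤ geodesicDist P.carrier (P.vertex i) (P.vertex j))
    (h15 : geodesicDist P.carrier (P.vertex 0) (P.vertex 4) < 2)
    (h4 : P.IsReflexAt 3) (h7 : P.IsReflexAt 6) :
    2 ≤ geodesicDist P.carrier (P.vertex 2) (P.vertex 5) := by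
  by_contra! h36
  obtain ⟨-, -, -, a3, -, -, a6, s3, s6⟩ := succ7 hn
  have hs1 := P.chord hsep h15
  have hs2 := P.chord hsep h36
  obtain ⟨x, hx1, hx2⟩ := P.crossing hn hs1 (fun k hk => P.chord_no_vertex hsep h15 hk) hs2
    (fun k hk => P.chord_no_vertex hsep h36 hk)
  have l1 : edist (P.vertex 0) x + edist x (P.vertex 4) < 2 := by
    rw [edist_seg hx1]; exact lt_of_le_of_lt edist_le_geo h15
  have l2 : edist (P.vertex 2) x + edist x (P.vertex 5) < 2 := by
    rw [edist_seg hx2]; exact lt_of_le_of_lt edist_le_geo h36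
  have g24 : geodesicDist P.carrier (P.vertex 2) (P.vertex 4) ≤
      edist (P.vertex 2) x + edist x (P.vertex 4) :=
    (geo_triangle _ x _).trans (add_le_add
      (geo_le_edist ((SimplePolygon.sub_seg_left hx2).trans hs2))
      (geo_le_edist ((SimplePolygon.sub_seg_right hx1).trans hs1)))
  have g50 : geodesicDist P.carrier (P.vertex 5) (P.vertex 0) ≤
      edist x (P.vertex 5) + edist (P.vertex 0) x := by
    rw [edist_comm x (P.vertex 5), edist_comm (P.vertex 0) x]
    refine (geo_triangle _ x _).trans (add_le_add (geo_le_edist ?_) (geo_le_edist ?_))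
    · rw [segment_symm]; exact (SimplePolygon.sub_seg_right hx2).trans hs2
    · rw [segment_symm]; exact (SimplePolygon.sub_seg_left hx1).trans hs1
  by_cases hA : edist (P.vertex 2) x + edist x (P.vertex 4) < 2
  · have hd := lt_of_le_of_lt g24 hA
    exact P.ear_lit hn s3 a3 (P.chord hsep hd) (fun k hk => P.chord_no_vertex hsep hd hk) h4
  · have hB : edist x (P.vertex 5) + edist (P.vertex 0) x < 2 := by
      by_contra hB
      push Not at hA hB
      have h1 := ENNReal.add_lt_add l1 l2
      have h2 := add_le_add hA hB
      have : edist (P.vertex 2) x + edist x (P.vertex 4) +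
        (edist x (P.vertex 5) + edist (P.vertex 0) x) =
        edist (P.vertex 0) x + edist x (P.vertex 4) +
          (edist (P.vertex 2) x + edist x (P.vertex 5)) := by ring
      rw [this] at h2
      exact absurd h1 (not_lt.2 h2)
    have hd := lt_of_le_of_lt g50 hB
    exact P.ear_lit hn s6 a6 (P.chord hsep hd) (fun k hk => P.chord_no_vertex hsep hd hk) h7

/-- structural lemma.  Let `P = (v₁,…,v₇)` be a simple
heptagon, labeled counterclockwise, with pairwise geodesic vertex distance at
least `1`, with `δ(v₁,v₅) < 2`, and with `v₂`, `v₄`, `v₇` reflex.  Then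
`δ(v₃,v₆) ≥ 2`.  (Here `v₁,…,v₇` are `P.vertex 0, …, P.vertex 6`.) -/
theorem geodesic_dist_v3_v6_ge_two (P : SimplePolygon) (hn : P.n = 7)
    (hccw : P.IsCCW)
    (hsep : ∀ i j : ZMod P.n, i ≠ j →
      1 ≤ geodesicDist P.carrier (P.vertex i) (P.vertex j))
    (h15 : geodesicDist P.carrier (P.vertex 0) (P.vertex 4) < 2)
    (h2 : P.IsReflexAt 1) (h4 : P.IsReflexAt 3) (h7 : P.IsReflexAt 6) :
    2 ≤ geodesicDist P.carrier (P.vertex 2) (P.vertex 5) := by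
  exact main_aux P hn hsep h15 h4 h7
end
end
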